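/- Let K be a centrally symmetric convex body of volume 1 in ℝⁿ. There is an absolute constant c > 0 such that for every δ ∈ (0,1), β^{(R)}_{δ,n}(K,K) ≤ c log(2/δ) · ∫_K⋯∫_K ‖∑_{j=1}^n x_j‖_K dx₁⋯dx_n. Consequently, β^{(R)}_{δ,n}(K,K) ≤ c' log(2/δ) L_K n^{3/4} √n M(K_iso) for an absolute constant c' > 0 and an isotropic image K_iso of K, and if K is a ψ₂-body with constant ϱ then β^{(R)}_{δ,n}(K,K) ≤ c' log(2/δ) ϱ² √n · √n M(K_iso). -/

import Mathlib

open MeasureTheory Real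
open scoped ENNReal RealInnerProductSpace Pointwise

noncomputable section

/-- A centrally symmetric convex body. -/
def IsSymmConvexBody {n : ℕ} (C : Set (EuclideanSpace ℝ (Fin n))) : Prop :=
  Convex ℝ C ∧ IsCompact C ∧ (interior C).Nonempty ∧ C = -C

/-- `C` is isotropic with isotropic constant `L`. -/
def IsIsotropic {n : ℕ} (C : Set (EuclideanSpace ℝ (Fin n))) (L : ℝ) : Prop :=
  volume C = 1 ∧ (∫ x in C, x) = 0 ∧ 0 < L ∧
    ∀ ξ : EuclideanSpace ℝ (Fin n), ‖ξ‖ = 1 → (∫ x in C, ⟪x, ξ⟫ ^ 2) = L ^ 2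

/-- `C` (of volume 1) is a `ψ₂`-body with constant `ϱ`. -/
def IsPsiTwoBody {n : ℕ} (C : Set (EuclideanSpace ℝ (Fin n))) (ϱ : ℝ) : Prop :=
  ∀ ξ : EuclideanSpace ℝ (Fin n), ‖ξ‖ = 1 →
    sInf {r : ℝ | 0 < r ∧ (∫ x in C, Real.exp ((|⟪x, ξ⟫| / r) ^ 2)) ≤ 2}
      ≤ ϱ * Real.sqrt (∫ x in C, ⟪x, ξ⟫ ^ 2)

/-- `M(K) = ∫_{S^{n-1}} ‖ξ‖_K dσ(ξ)`. -/
def sphereM {n : ℕ} (K : Set (EuclideanSpace ℝ (Fin n))) : ℝ :=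
  ⨍ ξ, gauge K (ξ : EuclideanSpace ℝ (Fin n))
    ∂((volume : Measure (EuclideanSpace ℝ (Fin n))).toSphere)

/-- The randomized balancing parameter `β^{(R)}_{δ,n}(K,K)`: the least `r > 0` such that
the set of `n`-tuples `(x₁,…,x_n) ∈ Kⁿ` admitting signs `ε ∈ {-1,1}ⁿ` with
`‖∑ ε_j x_j‖_K ≤ r` has volume at least `1 - δ`. -/
def betaR {n : ℕ} (K : Set (EuclideanSpace ℝ (Fin n))) (δ : ℝ) : ℝ :=
  sInf {r : ℝ | 0 < r ∧
    ENNReal.ofReal (1 - δ) ≤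
      volume {x : Fin n → EuclideanSpace ℝ (Fin n) |
        (∀ j, x j ∈ K) ∧
        ∃ ε : Fin n → ℝ, (∀ j, ε j = 1 ∨ ε j = -1) ∧
          gauge K (∑ j, ε j • x j) ≤ r}}

/-- One-dimensional Brunn–Minkowski inequality. -/
lemma volume_add_le_of_add_subset {A B C : Set ℝ} (hA : MeasurableSet A) (hB : MeasurableSet B)
    (hA0 : A.Nonempty) (hB0 : B.Nonempty) (hC : ∀ a ∈ A, ∀ b ∈ B, a + b ∈ C) :
    volume A + volume B ≤ volume C := by
  have key : ∀ K L : Set ℝ, IsCompact K → IsCompact L → K ⊆ A → L ⊆ B → K.Nonempty → L.Nonempty →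
      volume K + volume L ≤ volume C := by
    intro K L hK hL hKA hLB hK0 hL0
    obtain ⟨m, hm, hmax⟩ := hK.exists_isGreatest hK0
    obtain ⟨l, hl, hmin⟩ := hL.exists_isLeast hL0
    have h1 : volume K = volume ((fun x => x + l) '' K) := by
      rw [Set.image_add_right, measure_preimage_add_right]
    have h2 : volume L = volume ((fun x => m + x) '' L) := by
      rw [Set.image_add_left, measure_preimage_add]
    have hd : AEDisjoint volume ((fun x => x + l) '' K) ((fun x => m + x) '' L) := by
      refine measure_mono_null (t := {m + l}) ?_ (by simp)
      rintro x ⟨⟨a, ha, rfl⟩, ⟨b, hb, hab⟩⟩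
      have h3 := hmax ha
      have h4 := hmin hb
      simp only [Set.mem_singleton_iff] at hab ⊢
      linarith
    rw [h1, h2, ← measure_union₀ ?_ hd]
    · refine measure_mono ?_
      rintro x (⟨a, ha, rfl⟩ | ⟨b, hb, rfl⟩)
      · exact hC a (hKA ha) l (hLB hl)
      · exact hC m (hKA hm) b (hLB hb)
    · exact (hL.image (by fun_prop)).measurableSet.nullMeasurableSet
  obtain ⟨a, ha⟩ := hA0
  obtain ⟨b, hb⟩ := hB0
  refine le_of_forall_lt fun c hc => ?_
  obtain ⟨c₁, c₂, h₁, h₂, h₁₂⟩ : ∃ c₁ c₂, (c₁ < volume A ∨ c₁ = 0) ∧ (c₂ < volume B ∨ c₂ = 0) ∧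
      c < c₁ + c₂ := by
    by_cases hA0 : volume A = 0
    · rw [hA0, zero_add] at hc
      obtain ⟨d, hd1, hd2⟩ := exists_between hc
      exact ⟨0, d, Or.inr rfl, Or.inl hd2, by simpa using hd1⟩
    by_cases hB0 : volume B = 0
    · rw [hB0, add_zero] at hc
      obtain ⟨d, hd1, hd2⟩ := exists_between hc
      exact ⟨d, 0, Or.inl hd2, Or.inr rfl, by simpa using hd1⟩
    obtain ⟨d, hd1, hd2⟩ := exists_between hc
    obtain ⟨c₁, h1, c₂, h2, h3⟩ := ENNReal.exists_lt_add_of_lt_add hd2 hA0 hB0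
    exact ⟨c₁, c₂, Or.inl h1, Or.inl h2, hd1.trans h3⟩
  have aux : ∀ (S : Set ℝ), MeasurableSet S → ∀ s ∈ S, ∀ c, (c < volume S ∨ c = 0) →
      ∃ K ⊆ S, IsCompact K ∧ K.Nonempty ∧ c ≤ volume K := by
    rintro S hS s hs c (h | rfl)
    · obtain ⟨K, hK, hKc, hlt⟩ := hS.exists_lt_isCompact h
      refine ⟨K, hK, hKc, ?_, hlt.le⟩
      rw [Set.nonempty_iff_ne_empty]
      rintro rfl
      simp at hlt
    · exact ⟨{s}, by simpa using hs, isCompact_singleton, by simp, by simp⟩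
  obtain ⟨K, hK, hKc, hK0, hK1⟩ := aux A hA a ha c₁ h₁
  obtain ⟨L, hL, hLc, hL0, hL1⟩ := aux B hB b hb c₂ h₂
  exact h₁₂.trans_le ((add_le_add hK1 hL1).trans (key K L hKc hLc hK hL hK0 hL0))

lemma volume_convex_comb_le {l : ℝ} (hl : l ∈ Set.Ioo (0 : ℝ) 1) {A B C : Set ℝ}
    (hA : MeasurableSet A) (hB : MeasurableSet B)
    (hA0 : A.Nonempty) (hB0 : B.Nonempty) (hC : ∀ a ∈ A, ∀ b ∈ B, l * a + (1 - l) * b ∈ C) :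
    ENNReal.ofReal l * volume A + ENNReal.ofReal (1 - l) * volume B ≤ volume C := by
  obtain ⟨h0, h1⟩ := hl
  have e1 : ∀ {l : ℝ} (_ : 0 < l) (A : Set ℝ), ENNReal.ofReal l * volume A = volume (l • A) := by
    intro l hl A
    rw [Measure.addHaar_smul]
    simp [abs_of_pos hl]
  rw [e1 h0, e1 (by linarith : 0 < 1 - l)]
  refine volume_add_le_of_add_subset (hA.const_smul₀ _) (hB.const_smul₀ _) (hA0.smul_set)
    (hB0.smul_set) ?_
  rintro _ ⟨a, ha, rfl⟩ _ ⟨b, hb, rfl⟩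
  exact hC a ha b hb

/-- The Prékopa–Leindler inequality, as a property of a measure. -/
def PrekopaLeindler {E : Type*} [AddCommGroup E] [Module ℝ E] [MeasurableSpace E]
    (μ : Measure E) : Prop :=
  ∀ l ∈ Set.Ioo (0 : ℝ) 1, ∀ f g h : E → ℝ≥0∞, Measurable f → Measurable g → Measurable h →
    (∀ x y, f x ^ l * g y ^ (1 - l) ≤ h (l • x + (1 - l) • y)) →
    (∫⁻ x, f x ∂μ) ^ l * (∫⁻ x, g x ∂μ) ^ (1 - l) ≤ ∫⁻ x, h x ∂μ

lemma prekopaLeindler_of_iSup_eq_one {l : ℝ} (hl : l ∈ Set.Ioo (0 : ℝ) 1) {f g h : ℝ → ℝ≥0∞}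
    (hf : Measurable f) (hg : Measurable g) (hh : Measurable h) (hf1 : ⨆ x, f x = 1)
    (hg1 : ⨆ x, g x = 1)
    (H : ∀ x y, f x ^ l * g y ^ (1 - l) ≤ h (l • x + (1 - l) • y)) :
    ENNReal.ofReal l * (∫⁻ x, f x) + ENNReal.ofReal (1 - l) * (∫⁻ x, g x) ≤ ∫⁻ x, h x := by
  obtain ⟨h0, h1⟩ := hl
  have layer : ∀ f : ℝ → ℝ≥0∞, Measurable f → (∀ x, f x ≤ 1) →
      ∫⁻ x, f x = ∫⁻ t in Set.Ioi (0 : ℝ), volume {x | ENNReal.ofReal t < f x} := by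
    intro f hf hf1
    have e : ∀ x, ENNReal.ofReal (f x).toReal = f x := fun x =>
      ENNReal.ofReal_toReal (ne_top_of_le_ne_top ENNReal.one_ne_top (hf1 x))
    have := lintegral_eq_lintegral_meas_lt volume (f := fun x => (f x).toReal)
      (Filter.Eventually.of_forall fun x => ENNReal.toReal_nonneg) hf.ennreal_toReal.aemeasurable
    simp only [e] at this
    rw [this]
    refine setLIntegral_congr_fun measurableSet_Ioi fun t ht => ?_
    congr 1
    ext x
    simp only [Set.mem_ofPred_eq]
    rw [ENNReal.ofReal_lt_iff_lt_toReal (le_of_lt ht)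
      (ne_top_of_le_ne_top ENNReal.one_ne_top (hf1 x))]
  have hfle : ∀ x, f x ≤ 1 := fun x => hf1 ▸ le_iSup f x
  have hgle : ∀ x, g x ≤ 1 := fun x => hg1 ▸ le_iSup g x
  have hmin : ∫⁻ x, min (h x) 1 ≤ ∫⁻ x, h x := lintegral_mono fun x => min_le_left _ _
  refine le_trans ?_ hmin
  rw [layer f hf hfle, layer g hg hgle, layer _ (hh.min measurable_const) fun x => min_le_right _ _]
  have mf : ∀ f : ℝ → ℝ≥0∞, Measurable fun t : ℝ => volume {x | ENNReal.ofReal t < f x} := by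
    intro f
    refine Antitone.measurable fun s t hst => measure_mono fun x hx => ?_
    exact (ENNReal.ofReal_le_ofReal hst).trans_lt hx
  rw [← lintegral_const_mul _ (mf f), ← lintegral_const_mul _ (mf g),
    ← lintegral_add_left ((mf f).const_mul _)]
  refine setLIntegral_mono' measurableSet_Ioi fun t ht => ?_
  have ht0 : (0 : ℝ) < t := ht
  by_cases ht1 : t < 1
  · have hlt1 : ENNReal.ofReal t < 1 := by rwa [ENNReal.ofReal_lt_one]
    refine volume_convex_comb_le ⟨h0, h1⟩ (measurableSet_lt measurable_const hf)
      (measurableSet_lt measurable_const hg) ?_ ?_ ?_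
    · rw [← hf1] at hlt1
      exact lt_iSup_iff.1 hlt1
    · rw [← hg1] at hlt1
      exact lt_iSup_iff.1 hlt1
    · intro a ha b hb
      simp only [Set.mem_ofPred_eq] at ha hb ⊢
      refine lt_min (lt_of_lt_of_le ?_ (H a b)) hlt1
      have e : ENNReal.ofReal t = ENNReal.ofReal t ^ l * ENNReal.ofReal t ^ (1 - l) := by
        rw [← ENNReal.rpow_add _ _ (by simpa using ht0) (by simp)]
        simp
      rw [e]
      refine ENNReal.mul_lt_mul ?_ ?_
      · exact ENNReal.rpow_lt_rpow ha h0
      · exact ENNReal.rpow_lt_rpow hb (by linarith)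
  · have : ENNReal.ofReal t ≥ 1 := by
      rw [ge_iff_le, ENNReal.one_le_ofReal]; linarith
    have e1 : {x | ENNReal.ofReal t < f x} = ∅ := by
      ext x; simpa using (hfle x).trans this
    have e2 : {x | ENNReal.ofReal t < g x} = ∅ := by
      ext x; simpa using (hgle x).trans this
    simp [e1, e2]

lemma prekopaLeindler_real : PrekopaLeindler (volume : Measure ℝ) := by
  intro l hl f g h hf hg hh H
  have hl' := hl
  obtain ⟨h0, h1⟩ := hl
  have h1' : 0 < 1 - l := by linarith
  have bdd : ∀ f g : ℝ → ℝ≥0∞, Measurable f → Measurable g → (∃ N : ℕ, ∀ x, f x ≤ N) →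
      (∃ N : ℕ, ∀ x, g x ≤ N) →
      (∀ x y, f x ^ l * g y ^ (1 - l) ≤ h (l • x + (1 - l) • y)) →
      (∫⁻ x, f x) ^ l * (∫⁻ x, g x) ^ (1 - l) ≤ ∫⁻ x, h x := by
    intro f g hf hg ⟨N, hN⟩ ⟨N', hN'⟩ H
    set M := ⨆ x, f x with hM
    set M' := ⨆ x, g x with hM'
    have hMt : M ≠ ∞ := ne_top_of_le_ne_top (by simp) (iSup_le hN)
    have hMt' : M' ≠ ∞ := ne_top_of_le_ne_top (by simp) (iSup_le hN')
    by_cases hM0 : M = 0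
    · have : ∀ x, f x = 0 := fun x => le_antisymm (hM0 ▸ le_iSup f x) bot_le
      simp [this, h0]
    by_cases hM0' : M' = 0
    · have : ∀ x, g x = 0 := fun x => le_antisymm (hM0' ▸ le_iSup g x) bot_le
      simp [this, h1']
    set c := M ^ l * M' ^ (1 - l) with hc
    have hc0 : c ≠ 0 := mul_ne_zero (by simp [hM0, hMt]) (by simp [hM0', hMt'])
    have hct : c ≠ ∞ := ENNReal.mul_ne_top (ENNReal.rpow_ne_top_of_nonneg h0.le hMt)
      (ENNReal.rpow_ne_top_of_nonneg h1'.le hMt')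
    have inv_c : c⁻¹ = (M⁻¹) ^ l * (M'⁻¹) ^ (1 - l) := by
      rw [hc, ENNReal.mul_inv (Or.inr (ENNReal.rpow_ne_top_of_nonneg h1'.le hMt'))
        (Or.inl (ENNReal.rpow_ne_top_of_nonneg h0.le hMt)), ENNReal.inv_rpow, ENNReal.inv_rpow]
    have key := prekopaLeindler_of_iSup_eq_one hl' (hf.const_mul M⁻¹) (hg.const_mul M'⁻¹)
      (hh.const_mul c⁻¹) (by rw [← ENNReal.mul_iSup]; exact ENNReal.inv_mul_cancel hM0 hMt)
      (by rw [← ENNReal.mul_iSup]; exact ENNReal.inv_mul_cancel hM0' hMt') (by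
        intro x y
        rw [ENNReal.mul_rpow_of_nonneg _ _ h0.le, ENNReal.mul_rpow_of_nonneg _ _ h1'.le, inv_c,
          mul_mul_mul_comm]
        exact mul_le_mul_right (H x y) _)
    rw [lintegral_const_mul _ hf, lintegral_const_mul _ hg, lintegral_const_mul _ hh] at key
    have amgm : (M⁻¹ * ∫⁻ x, f x) ^ l * (M'⁻¹ * ∫⁻ x, g x) ^ (1 - l) ≤
        ENNReal.ofReal l * (M⁻¹ * ∫⁻ x, f x) + ENNReal.ofReal (1 - l) * (M'⁻¹ * ∫⁻ x, g x) := by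
      generalize M⁻¹ * ∫⁻ x, f x = a
      generalize M'⁻¹ * ∫⁻ x, g x = b
      by_cases ha : a = ∞
      · have : ENNReal.ofReal l ≠ 0 := by simpa using h0
        simp [ha, this]
      by_cases hb : b = ∞
      · have : ENNReal.ofReal (1 - l) ≠ 0 := by simpa using h1
        simp [hb, ENNReal.mul_top this]
      lift a to NNReal using ha
      lift b to NNReal using hb
      have := NNReal.geom_mean_le_arith_mean2_weighted (Real.toNNReal l) (Real.toNNReal (1 - l)) a b
        (by rw [← Real.toNNReal_add h0.le h1'.le]; simp)
      rw [← ENNReal.coe_rpow_of_nonneg _ h0.le, ← ENNReal.coe_rpow_of_nonneg _ h1'.le]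
      simp only [ENNReal.ofReal]
      rw [Real.coe_toNNReal _ h0.le, Real.coe_toNNReal _ h1'.le] at this
      exact_mod_cast this
    have := amgm.trans key
    rw [ENNReal.mul_rpow_of_nonneg _ _ h0.le, ENNReal.mul_rpow_of_nonneg _ _ h1'.le,
      mul_mul_mul_comm, ← inv_c] at this
    exact (ENNReal.mul_le_mul_iff_right (ENNReal.inv_ne_zero.2 hct) (ENNReal.inv_ne_top.2 hc0)).1 this
  have trunc : ∀ f : ℝ → ℝ≥0∞, Measurable f →
      ∫⁻ x, f x = ⨆ N : ℕ, ∫⁻ x, min (f x) N := by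
    intro f hf
    rw [← lintegral_iSup (fun n => hf.min measurable_const)]
    · congr 1
      ext x
      change f x = ⨆ n : ℕ, f x ⊓ (n : ℝ≥0∞)
      rw [← inf_iSup_eq, ENNReal.iSup_natCast, inf_top_eq]
    · intro m n hmn x
      exact min_le_min le_rfl (by exact_mod_cast hmn)
  rw [trunc f hf, trunc g hg]
  have mono : ∀ f : ℝ → ℝ≥0∞, Monotone fun N : ℕ => ∫⁻ x, min (f x) N := fun f m n hmn =>
    lintegral_mono fun x => min_le_min le_rfl (by exact_mod_cast hmn)
  have t1 := (ENNReal.continuous_rpow_const (y := l)).continuousAt.tendsto.comp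
    (tendsto_atTop_iSup (mono f))
  have t2 := (ENNReal.continuous_rpow_const (y := 1 - l)).continuousAt.tendsto.comp
    (tendsto_atTop_iSup (mono g))
  by_cases hfi : (⨆ N : ℕ, ∫⁻ x, min (f x) N) = 0
  · simp [hfi, h0]
  by_cases hgi : (⨆ N : ℕ, ∫⁻ x, min (g x) N) = 0
  · simp [hgi, h1']
  have t3 := ENNReal.Tendsto.mul t1 (Or.inl (by simp [hfi, h0, h0.not_gt]))
    t2 (Or.inl (by simp [hgi, h1'.not_gt, h1']))
  refine le_of_tendsto t3 (Filter.Eventually.of_forall fun N => ?_)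
  refine bdd _ _ (hf.min measurable_const) (hg.min measurable_const) ⟨N, fun x => min_le_right _ _⟩
    ⟨N, fun x => min_le_right _ _⟩ fun x y => (le_trans ?_ (H x y))
  gcongr <;> exact min_le_left _ _

section PL
variable {E F : Type*} [AddCommGroup E] [Module ℝ E] [MeasurableSpace E]
  [AddCommGroup F] [Module ℝ F] [MeasurableSpace F]

lemma PrekopaLeindler.prod {μ : Measure E} {ν : Measure F} [SFinite μ] [SFinite ν]
    (hμ : PrekopaLeindler μ) (hν : PrekopaLeindler ν) : PrekopaLeindler (μ.prod ν) := by
  intro l hl f g h hf hg hh H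
  rw [lintegral_prod _ hf.aemeasurable, lintegral_prod _ hg.aemeasurable,
    lintegral_prod _ hh.aemeasurable]
  refine hμ l hl _ _ _ hf.lintegral_prod_right' hg.lintegral_prod_right' hh.lintegral_prod_right' ?_
  intro x y
  exact hν l hl _ _ _ (hf.comp measurable_prodMk_left) (hg.comp measurable_prodMk_left)
    (hh.comp measurable_prodMk_left) fun x' y' => H (x, x') (y, y')

lemma PrekopaLeindler.of_measurePreserving {μ : Measure E} {ν : Measure F}
    (hν : PrekopaLeindler ν) (e : E ≃ᵐ F) (he : MeasurePreserving e μ ν)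
    (hlin : ∀ (a b : ℝ) (x y : E), e (a • x + b • y) = a • e x + b • e y) :
    PrekopaLeindler μ := by
  intro l hl f g h hf hg hh H
  have key : ∀ f : E → ℝ≥0∞, ∫⁻ x, f x ∂μ = ∫⁻ y, f (e.symm y) ∂ν := by
    intro f
    rw [← he.map_eq, lintegral_map_equiv]
    simp
  rw [key f, key g, key h]
  refine hν l hl _ _ _ (hf.comp e.symm.measurable) (hg.comp e.symm.measurable)
    (hh.comp e.symm.measurable) fun x y => ?_
  convert H (e.symm x) (e.symm y) using 2
  rw [e.symm_apply_eq, hlin]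
  simp

end PL

lemma PrekopaLeindler.pi {E : Type*} [AddCommGroup E] [Module ℝ E] [MeasureSpace E]
    [SigmaFinite (volume : Measure E)] (hE : PrekopaLeindler (volume : Measure E)) (n : ℕ) :
    PrekopaLeindler (volume : Measure (Fin n → E)) := by
  induction n with
  | zero =>
    intro l hl f g h hf hg hh H
    rw [volume_pi, Measure.pi_of_empty (x := 0), lintegral_dirac' _ hf, lintegral_dirac' _ hg,
      lintegral_dirac' _ hh]
    simpa using H 0 0
  | succ n ih =>
    exact (hE.prod ih).of_measurePreserving _
      (volume_preserving_piFinSuccAbove (fun _ : Fin (n + 1) => E) 0) fun _ _ _ _ => rfl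

lemma prekopaLeindler_euclideanSpace (n : ℕ) :
    PrekopaLeindler (volume : Measure (EuclideanSpace ℝ (Fin n))) :=
  (prekopaLeindler_real.pi n).of_measurePreserving _
    (EuclideanSpace.volume_preserving_symm_measurableEquiv_toLp (Fin n)) fun _ _ _ _ => rfl

/-- Log-concavity of a measure. -/
def LogConc {E : Type*} [AddCommGroup E] [Module ℝ E] [MeasurableSpace E] (μ : Measure E) : Prop :=
  ∀ l ∈ Set.Ioo (0 : ℝ) 1, ∀ A B C : Set E, MeasurableSet A → MeasurableSet B → MeasurableSet C →
    (∀ a ∈ A, ∀ b ∈ B, l • a + (1 - l) • b ∈ C) → μ A ^ l * μ B ^ (1 - l) ≤ μ C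

section LC
variable {E F : Type*} [AddCommGroup E] [Module ℝ E] [MeasurableSpace E]
  [AddCommGroup F] [Module ℝ F] [MeasurableSpace F]

lemma LogConc.map {μ : Measure E} (hμ : LogConc μ) {φ : E → F} (hφ : Measurable φ)
    (hlin : ∀ (a b : ℝ) (x y : E), φ (a • x + b • y) = a • φ x + b • φ y) :
    LogConc (μ.map φ) := by
  intro l hl A B C hA hB hC H
  rw [Measure.map_apply hφ hA, Measure.map_apply hφ hB, Measure.map_apply hφ hC]
  refine hμ l hl _ _ _ (hφ hA) (hφ hB) (hφ hC) fun a ha b hb => ?_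
  simp only [Set.mem_preimage, hlin]
  exact H _ ha _ hb

lemma LogConc.smul {μ : Measure E} (hμ : LogConc μ) {c : ℝ≥0∞} (hc0 : c ≠ 0) (hc : c ≠ ∞) :
    LogConc (c • μ) := by
  intro l hl A B C hA hB hC H
  simp only [Measure.smul_apply, smul_eq_mul]
  rw [ENNReal.mul_rpow_of_nonneg _ _ hl.1.le, ENNReal.mul_rpow_of_nonneg _ _ (by linarith [hl.2]),
    mul_mul_mul_comm, ← ENNReal.rpow_add _ _ hc0 hc]
  simpa using mul_le_mul_right (hμ l hl A B C hA hB hC H) c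

lemma PrekopaLeindler.logConc_withDensity {μ : Measure E} (hμ : PrekopaLeindler μ) {w : E → ℝ≥0∞}
    (hw : Measurable w)
    (hw1 : ∀ l ∈ Set.Ioo (0 : ℝ) 1, ∀ x y, w x ^ l * w y ^ (1 - l) ≤ w (l • x + (1 - l) • y)) :
    LogConc (μ.withDensity w) := by
  intro l hl A B C hA hB hC H
  have hl1 : 0 < 1 - l := by linarith [hl.2]
  simp only [withDensity_apply _ hA, withDensity_apply _ hB, withDensity_apply _ hC,
    ← lintegral_indicator hA, ← lintegral_indicator hB, ← lintegral_indicator hC]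
  refine hμ l hl _ _ _ (hw.indicator hA) (hw.indicator hB) (hw.indicator hC) fun x y => ?_
  by_cases hx : x ∈ A
  · by_cases hy : y ∈ B
    · rw [Set.indicator_of_mem hx, Set.indicator_of_mem hy, Set.indicator_of_mem (H x hx y hy)]
      exact hw1 l hl x y
    · simp [hy, hl1]
  · simp [hx, hl.1]

/-- Exponential tilts of the restriction to a convex set are log-concave. -/
lemma PrekopaLeindler.logConc_restrict_tilt {μ : Measure E} (hμ : PrekopaLeindler μ) {K : Set E}
    (hK : MeasurableSet K) (hKc : Convex ℝ K) {φ : E → ℝ} (hφ : Measurable φ)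
    (hlin : ∀ (a b : ℝ) (x y : E), φ (a • x + b • y) = a • φ x + b • φ y) :
    LogConc ((μ.restrict K).withDensity fun x => ENNReal.ofReal (exp (φ x))) := by
  have hm : Measurable fun x => ENNReal.ofReal (exp (φ x)) := by fun_prop
  rw [← withDensity_indicator hK]
  refine hμ.logConc_withDensity (hm.indicator hK) fun l hl x y => ?_
  have hl1 : 0 < 1 - l := by linarith [hl.2]
  by_cases hx : x ∈ K
  · by_cases hy : y ∈ K
    · rw [Set.indicator_of_mem hx, Set.indicator_of_mem hy,
        Set.indicator_of_mem (hKc hx hy hl.1.le hl1.le (by ring)),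
        ENNReal.ofReal_rpow_of_pos (exp_pos _), ENNReal.ofReal_rpow_of_pos (exp_pos _),
        ← ENNReal.ofReal_mul (by positivity), ← exp_mul, ← exp_mul, ← exp_add, hlin]
      simp [mul_comm]
    · simp [hy, hl1]
  · simp [hx, hl.1]

lemma PrekopaLeindler.logConc_restrict {μ : Measure E} (hμ : PrekopaLeindler μ) {K : Set E}
    (hK : MeasurableSet K) (hKc : Convex ℝ K) : LogConc (μ.restrict K) := by
  have := hμ.logConc_restrict_tilt hK hKc (φ := fun _ => (0 : ℝ)) measurable_const (by simp)
  simpa using this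

lemma LogConc.real {μ : Measure E} [IsFiniteMeasure μ] (hμ : LogConc μ) {l : ℝ}
    (hl : l ∈ Set.Ioo (0 : ℝ) 1) {A B C : Set E} (hA : MeasurableSet A) (hB : MeasurableSet B)
    (hC : MeasurableSet C) (H : ∀ a ∈ A, ∀ b ∈ B, l • a + (1 - l) • b ∈ C) :
    μ.real A ^ l * μ.real B ^ (1 - l) ≤ μ.real C := by
  have := ENNReal.toReal_mono (measure_ne_top μ C) (hμ l hl A B C hA hB hC H)
  rwa [ENNReal.toReal_mul, ← ENNReal.toReal_rpow, ← ENNReal.toReal_rpow] at this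

end LC

lemma IsSymmConvexBody.mem_nhds {n : ℕ} {K : Set (EuclideanSpace ℝ (Fin n))}
    (hK : IsSymmConvexBody K) : K ∈ nhds (0 : EuclideanSpace ℝ (Fin n)) := by
  obtain ⟨hc, hk, ⟨x, hx⟩, hs⟩ := hK
  have hx' : -x ∈ K := by rw [hs]; simpa using interior_subset hx
  have := hc.combo_interior_self_mem_interior hx hx' (a := 1 / 2) (b := 1 / 2) (by norm_num)
    (by norm_num) (by norm_num)
  rw [smul_neg, add_neg_cancel] at this
  exact mem_interior_iff_mem_nhds.1 this

/-- The Minkowski functional of a symmetric convex body, as a seminorm. -/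
def IsSymmConvexBody.seminorm {n : ℕ} {K : Set (EuclideanSpace ℝ (Fin n))}
    (hK : IsSymmConvexBody K) : Seminorm ℝ (EuclideanSpace ℝ (Fin n)) :=
  Seminorm.of (gauge K) (gauge_add_le hK.1 (absorbent_nhds_zero hK.mem_nhds)) <| by
    have hneg : ∀ x ∈ K, -x ∈ K := fun x hx => by
      rw [hK.2.2.2]; simpa using hx
    intro c x
    rcases le_total 0 c with hc | hc
    · rw [gauge_smul_of_nonneg hc, Real.norm_of_nonneg hc, smul_eq_mul]
    · rw [← neg_smul_neg, gauge_smul_of_nonneg (neg_nonneg.2 hc), gauge_neg hneg,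
        Real.norm_of_nonpos hc, smul_eq_mul]

lemma IsSymmConvexBody.coe_seminorm {n : ℕ} {K : Set (EuclideanSpace ℝ (Fin n))}
    (hK : IsSymmConvexBody K) : ⇑hK.seminorm = gauge K := rfl

lemma IsSymmConvexBody.continuous_seminorm {n : ℕ} {K : Set (EuclideanSpace ℝ (Fin n))}
    (hK : IsSymmConvexBody K) : Continuous hK.seminorm :=
  continuous_gauge hK.1 hK.mem_nhds

/-- Borell's lemma, for the level `1 / 4`. -/
lemma LogConc.borell {E : Type*} [AddCommGroup E] [Module ℝ E] [MeasurableSpace E]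
    {μ : Measure E} [IsProbabilityMeasure μ] (hμ : LogConc μ) (p : Seminorm ℝ E)
    (hp : Measurable p) {u s : ℝ} (hu : 0 < u) (h : μ {x | u < p x} ≤ 1 / 4) (hs : 1 < s) :
    μ {x | 2 * s * u < p x} ≤ ENNReal.ofReal (exp (-s)) := by
  set l : ℝ := 1 / s with hl
  have hs0 : 0 < s := by linarith
  have hl0 : 0 < l := by positivity
  have hl1 : l < 1 := by rw [hl, div_lt_one hs0]; exact hs
  have hm : ∀ t : ℝ, MeasurableSet {x | t < p x} := fun t => measurableSet_lt measurable_const hp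
  have hcompl : 3 / 4 ≤ μ {x | p x ≤ u} := by
    have : {x | p x ≤ u} = {x | u < p x}ᶜ := by ext; simp
    rw [this, prob_compl_eq_one_sub (hm u)]
    refine le_trans ?_ (tsub_le_tsub_left h 1)
    refine ENNReal.le_sub_of_add_le_right (by simp) (le_of_eq ?_)
    rw [← ENNReal.toReal_eq_toReal_iff' (by finiteness) (by finiteness)]
    rw [ENNReal.toReal_add (by finiteness) (by finiteness)]
    norm_num
  have key := hμ l ⟨hl0, hl1⟩ {x | 2 * s * u < p x} {x | p x ≤ u} {x | u < p x} (hm _)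
    (measurableSet_le hp measurable_const) (hm _) (by
      intro a ha b hb
      simp only [Set.mem_ofPred_eq] at ha hb ⊢
      have h1 : p (l • a) ≤ p (l • a + (1 - l) • b) + p ((1 - l) • b) := by
        have := map_sub_le_add p (l • a + (1 - l) • b) ((1 - l) • b)
        simpa using this
      rw [map_smul_eq_mul, map_smul_eq_mul, Real.norm_of_nonneg hl0.le,
        Real.norm_of_nonneg (by linarith)] at h1
      have h2 : l * (2 * s * u) < l * p a := by gcongr
      have h3 : l * (2 * s * u) = 2 * u := by rw [hl]; field_simp
      have h4 : (1 - l) * p b ≤ 1 * u := by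
        have : 0 ≤ p b := apply_nonneg p b
        nlinarith
      linarith)
  set X := (μ {x | 2 * s * u < p x}).toReal
  have hX : ENNReal.ofReal X = μ {x | 2 * s * u < p x} := ENNReal.ofReal_toReal (by finiteness)
  have hX0 : 0 ≤ X := ENNReal.toReal_nonneg
  rw [← hX]
  refine ENNReal.ofReal_le_ofReal ?_
  have key2 : ENNReal.ofReal (X ^ l * (3 / 4) ^ (1 - l)) ≤ ENNReal.ofReal (1 / 4) := by
    rw [ENNReal.ofReal_mul (by positivity), ← ENNReal.ofReal_rpow_of_nonneg hX0 hl0.le, hX,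
      ← ENNReal.ofReal_rpow_of_pos (by norm_num)]
    refine le_trans ?_ (key.trans (h.trans ?_))
    · gcongr
      refine le_trans (le_of_eq ?_) hcompl
      rw [ENNReal.ofReal_div_of_pos (by norm_num)]
      norm_num
    · rw [ENNReal.ofReal_div_of_pos (by norm_num)]
      norm_num
  have key3 := (ENNReal.ofReal_le_ofReal_iff (by norm_num)).1 key2
  have e1 : ((3 : ℝ) / 4) ^ (1 - l) = (3 / 4) * ((3 / 4) ^ l)⁻¹ := by
    rw [rpow_sub (by norm_num), rpow_one, div_eq_mul_inv]
  have hq : (0 : ℝ) < (3 / 4) ^ l := by positivity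
  have hXl : X ^ l ≤ (1 / 3) * (3 / 4) ^ l := by
    rw [e1] at key3
    have h2 : X ^ l * (3 / 4 * ((3 / 4) ^ l)⁻¹) * (3 / 4) ^ l = X ^ l * (3 / 4) := by
      field_simp
    nlinarith [mul_le_mul_of_nonneg_right key3 hq.le]
  have hXs : X ≤ ((1 / 3) * (3 / 4) ^ l) ^ s := by
    calc X = (X ^ l) ^ s := by
          rw [← rpow_mul hX0, hl]; field_simp; simp
      _ ≤ _ := by gcongr
  refine hXs.trans ?_
  calc ((1 / 3 : ℝ) * (3 / 4) ^ l) ^ s ≤ (exp (-1)) ^ s := by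
        gcongr
        have h1 : ((3 : ℝ) / 4) ^ l ≤ 1 := rpow_le_one (by norm_num) (by norm_num) hl0.le
        have h2 : (1 / 3 : ℝ) ≤ exp (-1) := by
          rw [exp_neg, one_div]
          exact inv_anti₀ (exp_pos 1) (by linarith [exp_one_lt_d9])
        linarith
    _ = exp (-s) := by rw [← exp_mul]; simp

lemma volume_pi_const_eq_one {n : ℕ} {K : Set (EuclideanSpace ℝ (Fin n))} (hv : volume K = 1) :
    volume (Set.univ.pi fun _ : Fin n => K) = 1 := by
  rw [volume_pi_pi]; simp [hv]

lemma betaR_le_of_measure {n : ℕ} {K : Set (EuclideanSpace ℝ (Fin n))} {δ r : ℝ} (hr : 0 < r)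
    (h : ENNReal.ofReal (1 - δ) ≤ volume {x : Fin n → EuclideanSpace ℝ (Fin n) |
        (∀ j, x j ∈ K) ∧ gauge K (∑ j, x j) ≤ r}) : betaR K δ ≤ r := by
  refine csInf_le ⟨0, fun s hs => hs.1.le⟩ ⟨hr, h.trans (measure_mono ?_)⟩
  rintro x ⟨hx, hx'⟩
  exact ⟨hx, fun _ => 1, by simp, by simpa using hx'⟩

/-- The bound of the randomized balancing parameter by the average norm of a sum. -/
theorem betaR_le_integral {n : ℕ} {K : Set (EuclideanSpace ℝ (Fin n))} (hK : IsSymmConvexBody K)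
    (hv : volume K = 1) {δ : ℝ} (hδ0 : 0 < δ) (hδ1 : δ < 1) :
    betaR K δ ≤ 16 * log (2 / δ) * ∫ x in Set.univ.pi fun _ : Fin n => K, gauge K (∑ j, x j) := by
  set μ : Measure (Fin n → EuclideanSpace ℝ (Fin n)) :=
    volume.restrict (Set.univ.pi fun _ : Fin n => K) with hμ
  have hKm : MeasurableSet K := hK.2.1.measurableSet
  have hKn : MeasurableSet (Set.univ.pi fun _ : Fin n => K) :=
    MeasurableSet.univ_pi fun _ => hKm
  have : IsProbabilityMeasure μ := ⟨by simp [hμ, volume_pi_const_eq_one hv]⟩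
  have hlc : LogConc μ := ((prekopaLeindler_euclideanSpace n).pi n).logConc_restrict hKn
    (convex_pi fun _ _ => hK.1)
  let Φ : (Fin n → EuclideanSpace ℝ (Fin n)) →ₗ[ℝ] EuclideanSpace ℝ (Fin n) :=
    ∑ j, LinearMap.proj j
  have hΦ : ∀ x, Φ x = ∑ j, x j := fun x => by simp [Φ, LinearMap.sum_apply]
  let p : Seminorm ℝ (Fin n → EuclideanSpace ℝ (Fin n)) := hK.seminorm.comp Φ
  have hp : ∀ x, p x = gauge K (∑ j, x j) := fun x => by
    simp [p, Seminorm.comp_apply, hΦ, hK.coe_seminorm]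
  have hpc : Continuous p := by
    have : ⇑p = fun x => hK.seminorm (∑ j, x j) := by ext x; rw [hp]; rfl
    rw [this]
    exact hK.continuous_seminorm.comp (by fun_prop)
  have hcpt : IsCompact (Set.univ.pi fun _ : Fin n => K) := isCompact_univ_pi fun _ => hK.2.1
  have hint : Integrable p μ := hpc.continuousOn.integrableOn_compact hcpt
  simp only [← hp]
  set I := ∫ x, p x ∂μ with hI
  have hI0 : 0 ≤ I := integral_nonneg fun x => apply_nonneg p x
  set s := 2 * log (2 / δ) with hs
  have hlog : log 2 < log (2 / δ) := log_lt_log (by norm_num) (by rw [lt_div_iff₀ hδ0]; linarith)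
  have hs1 : 1 < s := by linarith [log_two_gt_d9]
  have main : ∀ η > 0, betaR K δ ≤ 2 * s * (4 * (I + η)) := by
    intro η hη
    have hu : 0 < 4 * (I + η) := by linarith
    refine betaR_le_of_measure (by positivity) ?_
    have hmarkov : μ {x | 4 * (I + η) < p x} ≤ 1 / 4 := by
      have h1 := mul_meas_ge_le_integral_of_nonneg (μ := μ) (f := p)
        (Filter.Eventually.of_forall fun x => apply_nonneg p x) hint (4 * (I + η))
      have h2 : μ.real {x | 4 * (I + η) ≤ p x} ≤ 1 / 4 := by
        by_contra hcon
        push Not at hcon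
        nlinarith [h1]
      have h3 : μ {x | 4 * (I + η) ≤ p x} ≤ ENNReal.ofReal (1 / 4) := by
        rw [← ENNReal.ofReal_toReal (measure_ne_top μ {x | 4 * (I + η) ≤ p x})]
        exact ENNReal.ofReal_le_ofReal h2
      have h4 : μ {x | 4 * (I + η) < p x} ≤ μ {x | 4 * (I + η) ≤ p x} :=
        measure_mono fun x hx => by
          simp only [Set.mem_ofPred_eq] at hx ⊢
          exact hx.le
      refine h4.trans (h3.trans (le_of_eq ?_))
      rw [ENNReal.ofReal_div_of_pos (by norm_num)]; norm_num
    have hb := hlc.borell p hpc.measurable hu hmarkov hs1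
    have hexp : exp (-s) ≤ δ := by
      have h1 : exp (-s) ≤ exp (-log (2 / δ)) := exp_le_exp.2 (by linarith [log_two_gt_d9])
      rw [exp_neg (log _), exp_log (by positivity), inv_div] at h1
      linarith
    have hset : {x : Fin n → EuclideanSpace ℝ (Fin n) | (∀ j, x j ∈ K) ∧
        gauge K (∑ j, x j) ≤ 2 * s * (4 * (I + η))} =
        {x | 2 * s * (4 * (I + η)) < p x}ᶜ ∩ Set.univ.pi fun _ : Fin n => K := by
      ext x
      simp only [Set.mem_inter_iff, Set.mem_compl_iff, Set.mem_ofPred_eq, not_lt, hp,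
        Set.mem_univ_pi]
      tauto
    have hms : MeasurableSet {x | 2 * s * (4 * (I + η)) < p x} :=
      measurableSet_lt measurable_const hpc.measurable
    rw [hset, ← Measure.restrict_apply hms.compl, ← hμ, prob_compl_eq_one_sub hms,
      ENNReal.ofReal_sub _ hδ0.le, ENNReal.ofReal_one]
    exact tsub_le_tsub_left (hb.trans (ENNReal.ofReal_le_ofReal hexp)) 1
  have : betaR K δ ≤ 2 * s * (4 * I) := by
    refine le_of_forall_pos_le_add fun ε hε => ?_
    have := main (ε / (8 * s)) (by positivity)
    refine this.trans (le_of_eq ?_)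
    have : s ≠ 0 := by positivity
    field_simp
    ring
  rw [hs] at this
  linarith

lemma LogConc.half_le_measureReal_Ici {ν : Measure ℝ} [IsProbabilityMeasure ν]
    (hsymm : ν.map Neg.neg = ν) : 1 / 2 ≤ ν.real (Set.Ici 0) := by
  have h1 : ν.real (Set.Iic 0) = ν.real (Set.Ici 0) := by
    conv_lhs => rw [← hsymm]
    rw [map_measureReal_apply measurable_neg measurableSet_Iic]
    simp
  have h2 : ν.real Set.univ ≤ ν.real (Set.Iic 0) + ν.real (Set.Ici 0) := by
    rw [← Set.Iic_union_Ici (a := (0 : ℝ))]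
    exact measureReal_union_le _ _
  rw [h1] at h2
  simp only [probReal_univ] at h2
  linarith

lemma LogConc.measureReal_Ici_mul_le {ν : Measure ℝ} [IsProbabilityMeasure ν] (hν : LogConc ν)
    (hsymm : ν.map Neg.neg = ν) {u b : ℝ} (h : ν.real (Set.Ici u) ≤ b / 2) {j : ℕ}
    (hj : 1 ≤ j) : ν.real (Set.Ici (j * u)) ≤ b ^ j / 2 := by
  have hb : 0 ≤ b := by
    have : 0 ≤ ν.real (Set.Ici u) := measureReal_nonneg
    linarith
  rcases hj.eq_or_lt with rfl | hj
  · simpa using h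
  have hj0 : (0 : ℝ) < j := by positivity
  have hj1 : (1 : ℝ) < j := by exact_mod_cast hj
  set l : ℝ := 1 / j with hl
  have hl1 : l < 1 := by rw [hl, div_lt_one hj0]; exact hj1
  have hl0 : 0 < l := by positivity
  have key := hν.real ⟨hl0, hl1⟩ (measurableSet_Ici (a := (j * u : ℝ)))
    (measurableSet_Ici (a := (0 : ℝ))) (measurableSet_Ici (a := u)) (by
      intro x hx y hy
      simp only [Set.mem_Ici, smul_eq_mul] at hx hy ⊢
      have h1 : l * (j * u) ≤ l * x := by gcongr
      have h2 : l * (j * u) = u := by rw [hl]; field_simp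
      have h3 : 0 ≤ (1 - l) * y := mul_nonneg (by linarith) hy
      linarith)
  set t := ν.real (Set.Ici (j * u : ℝ))
  have ht : 0 ≤ t := measureReal_nonneg
  have h1 : t ^ l * (1 / 2) ^ (1 - l) ≤ b / 2 := by
    refine le_trans ?_ (key.trans h)
    gcongr
    exact half_le_measureReal_Ici hsymm
  have h2 : (t ^ l * (1 / 2) ^ (1 - l)) ^ j ≤ (b / 2) ^ j := by gcongr
  have h3 : (t ^ l) ^ j = t := by
    rw [← rpow_natCast, ← rpow_mul ht, hl]; field_simp; simp
  have h4 : (((1 : ℝ) / 2) ^ (1 - l)) ^ j = (1 / 2) ^ j * 2 := by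
    rw [← rpow_natCast, ← rpow_mul (by norm_num), sub_mul, one_mul, rpow_sub (by norm_num),
      rpow_natCast, hl]
    field_simp
    simp
  rw [mul_pow, h3, h4, div_pow, div_pow, one_pow] at h2
  have h5 : (0 : ℝ) < 2 ^ j := by positivity
  field_simp at h2 ⊢
  linarith

/-- A symmetric log-concave random variable with small tail at `u` has a bounded exponential
moment at the corresponding scale. -/
lemma LogConc.integral_exp_le {ν : Measure ℝ} [IsProbabilityMeasure ν] (hν : LogConc ν)
    (hsymm : ν.map Neg.neg = ν) {R : ℝ} (hR : ∀ᵐ x ∂ν, |x| ≤ R) {u m : ℝ} (hu : 0 < u)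
    (hm : 1 ≤ m) (h : ν.real (Set.Ici u) ≤ exp (-2 * m) / 2) :
    ∫ x, exp (m / (2 * u) * |x|) ∂ν ≤ 2 * exp (m / 2) := by
  set J := ⌊R / u⌋₊ with hJ
  have hms : ∀ s : ℝ, MeasurableSet {x : ℝ | s ≤ |x|} := fun s =>
    measurableSet_le measurable_const (by fun_prop)
  have htail : ∀ j : ℕ, ν.real {x : ℝ | j * u ≤ |x|} ≤ exp (-2 * m) ^ j := by
    intro j
    rcases Nat.eq_zero_or_pos j with rfl | hj
    · simp
    have h1 := hν.measureReal_Ici_mul_le hsymm h hj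
    have h2 : ν.real (Set.Iic (-(j * u))) = ν.real (Set.Ici (j * u : ℝ)) := by
      conv_lhs => rw [← hsymm]
      rw [map_measureReal_apply measurable_neg measurableSet_Iic]
      simp
    have h3 : {x : ℝ | j * u ≤ |x|} = Set.Ici (j * u : ℝ) ∪ Set.Iic (-(j * u)) := by
      ext x
      simp only [Set.mem_ofPred_eq, Set.mem_union, Set.mem_Ici, Set.mem_Iic, le_abs]
      constructor <;> (rintro (h | h) <;> [left; right] <;> linarith)
    rw [h3]
    refine (measureReal_union_le _ _).trans ?_
    rw [h2]
    linarith
  have hpt : ∀ᵐ x ∂ν, exp (m / (2 * u) * |x|) ≤ ∑ j ∈ Finset.range (J + 1),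
      {x : ℝ | j * u ≤ |x|}.indicator (fun _ => exp (m / 2) * exp (m / 2) ^ j) x := by
    filter_upwards [hR] with x hx
    set i := ⌊|x| / u⌋₊ with hi
    have hiJ : i ∈ Finset.range (J + 1) := by
      rw [Finset.mem_range, Nat.lt_succ_iff]
      exact Nat.floor_le_floor (by gcongr)
    have hi1 : (i : ℝ) * u ≤ |x| := by
      have := Nat.floor_le (a := |x| / u) (by positivity)
      rwa [le_div_iff₀ hu] at this
    have hi2 : |x| ≤ (i + 1) * u := by
      have := (Nat.lt_floor_add_one (|x| / u)).le
      rwa [div_le_iff₀ hu] at this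
    refine le_trans ?_ (Finset.single_le_sum (f := fun j : ℕ => {x : ℝ | j * u ≤ |x|}.indicator
      (fun _ => exp (m / 2) * exp (m / 2) ^ j) x) (fun j _ =>
        Set.indicator_nonneg (fun _ _ => by positivity) _) hiJ)
    rw [Set.indicator_of_mem (by simpa using hi1), ← exp_nat_mul, ← exp_add]
    refine exp_le_exp.2 ?_
    calc m / (2 * u) * |x| ≤ m / (2 * u) * ((i + 1) * u) := by gcongr
      _ = _ := by field_simp; ring
  have hint : ∀ j ∈ Finset.range (J + 1), Integrable
      ({x : ℝ | j * u ≤ |x|}.indicator (fun _ => exp (m / 2) * exp (m / 2) ^ j)) ν := fun j _ =>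
    (integrable_const _).indicator (hms _)
  refine (integral_mono_of_nonneg (Filter.Eventually.of_forall fun x => (exp_pos _).le)
    (integrable_finsetSum _ hint) hpt).trans ?_
  rw [integral_finsetSum _ hint]
  have hr1 : exp (m / 2) * exp (-2 * m) ≤ 1 / 2 := by
    rw [← exp_add]
    calc exp (m / 2 + -2 * m) ≤ exp (-1) := exp_le_exp.2 (by linarith)
      _ ≤ 1 / 2 := by
        rw [exp_neg, one_div]
        exact inv_anti₀ (by norm_num) (by linarith [exp_one_gt_d9])
  calc _ ≤ ∑ j ∈ Finset.range (J + 1), exp (m / 2) * (1 / 2) ^ j := by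
        refine Finset.sum_le_sum fun j _ => ?_
        rw [integral_indicator (hms _), setIntegral_const, smul_eq_mul]
        calc _ ≤ exp (-2 * m) ^ j * (exp (m / 2) * exp (m / 2) ^ j) := by
              gcongr; exact htail j
          _ = exp (m / 2) * (exp (m / 2) * exp (-2 * m)) ^ j := by rw [mul_pow]; ring
          _ ≤ _ := by gcongr
    _ ≤ 2 * exp (m / 2) := by
        rw [← Finset.mul_sum, mul_comm]
        gcongr
        have := sum_geometric_two_le (J + 1)
        simpa using this

section
variable {m : ℕ}

lemma isOpen_lt_measure_ball {E : Type*} [NormedAddCommGroup E] [NormedSpace ℝ E]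
    [FiniteDimensional ℝ E] [MeasurableSpace E] [BorelSpace E] (ν : Measure E) [IsFiniteMeasure ν]
    (r : ℝ) (c : ℝ≥0∞) : IsOpen {y : E | c < ν (Metric.ball y r)} := by
  rw [Metric.isOpen_iff]
  intro y hy
  have := FiniteDimensional.proper ℝ E
  obtain ⟨K, hK, hKc, hlt⟩ := Metric.isOpen_ball.exists_lt_isCompact (Set.mem_ofPred_eq ▸ hy)
  have hne : K.Nonempty := by
    rw [Set.nonempty_iff_ne_empty]; rintro rfl; simp at hlt
  obtain ⟨z, hz, hmax⟩ := hKc.exists_isMaxOn hne (f := fun z => dist z y) (by fun_prop)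
  refine ⟨r - dist z y, sub_pos.2 (hK hz), fun y' hy' => ?_⟩
  refine hlt.trans_le (measure_mono fun w hw => ?_)
  have h1 : dist w y ≤ dist z y := hmax hw
  have h2 : dist y' y < r - dist z y := hy'
  rw [Metric.mem_ball]
  linarith [dist_triangle w y y', dist_comm y y']

/-- A symmetric log-concave probability measure on `ℝᵐ` that puts mass `3 / 4` on a ball of radius
`r` has a direction whose one-dimensional tail at a multiple of `r` is exponentially small in the
dimension. -/
lemma LogConc.exists_direction {ν : Measure (EuclideanSpace ℝ (Fin m))} [IsProbabilityMeasure ν]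
    (hν : LogConc ν) (hm : 1 ≤ m) {r : ℝ} (hr : 0 < r) (hball : 3 / 4 ≤ ν.real (Metric.ball 0 r)) :
    ∃ t : EuclideanSpace ℝ (Fin m), ‖t‖ = 1 ∧
      ν.real {w | 8193 * r ≤ ⟪w, t⟫} ≤ exp (-2 * m) / 2 := by
  have : Nontrivial (EuclideanSpace ℝ (Fin m)) := by
    have : Nonempty (Fin m) := ⟨⟨0, hm⟩⟩
    infer_instance
  set g : EuclideanSpace ℝ (Fin m) → ℝ := fun y => ν.real (Metric.ball y r) with hg
  have hg0 : ∀ y, 0 ≤ g y := fun y => measureReal_nonneg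
  have hgc : ∀ l ∈ Set.Ioo (0 : ℝ) 1, ∀ x y, g x ^ l * g y ^ (1 - l) ≤ g (l • x + (1 - l) • y) := by
    intro l hl x y
    refine hν.real hl measurableSet_ball measurableSet_ball measurableSet_ball fun a ha b hb => ?_
    rw [mem_ball_iff_norm] at ha hb ⊢
    have : l • a + (1 - l) • b - (l • x + (1 - l) • y) = l • (a - x) + (1 - l) • (b - y) := by
      module
    rw [this]
    refine (norm_add_le _ _).trans_lt ?_
    rw [norm_smul, norm_smul, Real.norm_of_nonneg hl.1.le, Real.norm_of_nonneg (by linarith [hl.2])]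
    have h1 : 0 < 1 - l := by linarith [hl.2]
    have h2 := hl.1
    nlinarith
  set δ : ℝ := (1 / 4096) ^ m with hδ
  have hδ0 : 0 < δ := by positivity
  have hδ1 : δ < 3 / 4 := by
    have : δ ≤ (1 / 4096) ^ 1 := pow_le_pow_of_le_one (by norm_num) (by norm_num) hm
    linarith
  set A : Set (EuclideanSpace ℝ (Fin m)) := {y | δ < g y} with hA
  have hAo : IsOpen A := by
    have e : A = {y | ENNReal.ofReal δ < ν (Metric.ball y r)} := by
      ext y
      simp only [hA, Set.mem_ofPred_eq]
      rw [ENNReal.ofReal_lt_iff_lt_toReal hδ0.le (by finiteness)]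
      rfl
    rw [e]
    exact isOpen_lt_measure_ball ν r (ENNReal.ofReal δ)
  have hAc : Convex ℝ A := by
    rw [convex_iff_openSegment_subset]
    rintro x hx y hy _ ⟨a, b, ha, hb, hab, rfl⟩
    have hb' : b = 1 - a := by linarith
    subst hb'
    have hx' : δ < g x := hx
    have hy' : δ < g y := hy
    refine lt_of_lt_of_le ?_ (hgc a ⟨ha, by linarith⟩ x y)
    calc δ = δ ^ a * δ ^ (1 - a) := by rw [← rpow_add hδ0]; simp
      _ < _ := by
        refine mul_lt_mul'' ?_ ?_ (by positivity) (by positivity)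
        · exact rpow_lt_rpow hδ0.le hx' ha
        · exact rpow_lt_rpow hδ0.le hy' hb
  have h0A : (0 : EuclideanSpace ℝ (Fin m)) ∈ A := lt_of_lt_of_le hδ1 hball
  set V := volume (Metric.ball (0 : EuclideanSpace ℝ (Fin m)) r) with hV
  have hV0 : V ≠ 0 := (Metric.measure_ball_pos _ _ hr).ne'
  have hVt : V ≠ ∞ := measure_ball_lt_top.ne
  have hVb : ∀ x, volume (Metric.ball (x : EuclideanSpace ℝ (Fin m)) r) = V := fun x =>
    Measure.addHaar_ball_center _ _ _
  have hVmul : ∀ (c : ℝ) (_ : 0 < c) (x : EuclideanSpace ℝ (Fin m)),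
      volume (Metric.ball x (c * r)) = ENNReal.ofReal (c ^ m) * V := by
    intro c hc x
    rw [Measure.addHaar_ball_mul _ _ hc.le]
    simp [hV]
  have hfub : ∀ S : Set (EuclideanSpace ℝ (Fin m) × EuclideanSpace ℝ (Fin m)), MeasurableSet S →
      ∫⁻ y, ν (Prod.mk y ⁻¹' S) = ∫⁻ w, volume ((fun y => (y, w)) ⁻¹' S) ∂ν := by
    intro S hS
    rw [← Measure.prod_apply hS, ← Measure.prod_apply_symm hS]
  have hgG : ∀ y, ν (Metric.ball y r) = ENNReal.ofReal (g y) := fun y =>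
    (ENNReal.ofReal_toReal (by finiteness)).symm
  have htot : ∫⁻ y, ν (Metric.ball y r) = V := by
    have h1 := hfub {p | dist p.2 p.1 < r} (measurableSet_lt (by fun_prop) (by fun_prop))
    have h2 : ∀ y : EuclideanSpace ℝ (Fin m), Prod.mk y ⁻¹' {p | dist p.2 p.1 < r} =
        Metric.ball y r := fun y => by ext; simp
    have h3 : ∀ w : EuclideanSpace ℝ (Fin m), (fun y => (y, w)) ⁻¹' {p | dist p.2 p.1 < r} =
        Metric.ball w r := fun w => by ext; simp [dist_comm]
    simp only [h2, h3, hVb] at h1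
    simpa using h1
  have hhalf : ∫⁻ y, ν (Metric.ball ((1 / 2 : ℝ) • y) r) = ENNReal.ofReal (2 ^ m) * V := by
    have h1 := hfub {p | dist p.2 ((1 / 2 : ℝ) • p.1) < r}
      (measurableSet_lt (by fun_prop) (by fun_prop))
    have h2 : ∀ y : EuclideanSpace ℝ (Fin m),
        Prod.mk y ⁻¹' {p | dist p.2 ((1 / 2 : ℝ) • p.1) < r} =
        Metric.ball ((1 / 2 : ℝ) • y) r := fun y => by ext; simp
    have h3 : ∀ w : EuclideanSpace ℝ (Fin m),
        (fun y => (y, w)) ⁻¹' {p | dist p.2 ((1 / 2 : ℝ) • p.1) < r} =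
        Metric.ball ((2 : ℝ) • w) (2 * r) := fun w => by
      ext y
      simp only [Set.mem_preimage, Set.mem_ofPred_eq, Metric.mem_ball]
      have : dist y ((2 : ℝ) • w) = 2 * dist w ((1 / 2 : ℝ) • y) := by
        rw [dist_eq_norm, dist_eq_norm, ← norm_neg]
        have : -(y - (2 : ℝ) • w) = (2 : ℝ) • (w - (1 / 2 : ℝ) • y) := by module
        rw [this, norm_smul]; simp
      rw [this]
      constructor <;> intro h <;> linarith
    simp only [h2, h3, hVmul 2 (by norm_num)] at h1
    simpa using h1
  obtain ⟨y, hyA, hy⟩ : ∃ y, y ∉ A ∧ ‖y‖ < 8192 * r := by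
    by_contra! hcon
    have hsub : Metric.ball (0 : EuclideanSpace ℝ (Fin m)) (8192 * r) ⊆ A := by
      intro y hy
      by_contra hyA
      exact absurd (hcon y hyA) (not_le.2 (by simpa using hy))
    have h1 : ENNReal.ofReal δ * volume (Metric.ball (0 : EuclideanSpace ℝ (Fin m)) (8192 * r)) ≤ V := by
      rw [← htot, ← setLIntegral_const]
      refine (setLIntegral_mono' measurableSet_ball fun y hy => ?_).trans (setLIntegral_le_lintegral _ _)
      rw [hgG]
      exact ENNReal.ofReal_le_ofReal (le_of_lt (hsub hy))
    rw [hVmul _ (by norm_num), ← mul_assoc, ← ENNReal.ofReal_mul hδ0.le, hδ, ← mul_pow] at h1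
    have h2 : (1 : ℝ≥0∞) < ENNReal.ofReal ((1 / 4096 * 8192) ^ m) := by
      rw [ENNReal.one_lt_ofReal]
      exact one_lt_pow₀ (by norm_num) (by omega)
    have h3 := ENNReal.mul_lt_mul_left hV0 hVt h2
    rw [one_mul] at h3
    exact absurd h1 (not_le.2 h3)
  obtain ⟨f, hf⟩ := geometric_hahn_banach_open_point hAc hAo hyA
  set t' := (InnerProductSpace.toDual ℝ (EuclideanSpace ℝ (Fin m))).symm f with ht'
  have hft : ∀ w, f w = ⟪w, t'⟫ := fun w => by
    rw [real_inner_comm, ht', InnerProductSpace.toDual_symm_apply]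
  have hfy : 0 < ⟪y, t'⟫ := by
    have := hf 0 h0A
    rwa [map_zero, hft] at this
  have ht0 : t' ≠ 0 := by rintro h; simp [h] at hfy
  have htn : 0 < ‖t'‖ := norm_pos_iff.2 ht0
  set t := ‖t'‖⁻¹ • t' with ht
  have ht1 : ‖t‖ = 1 := by rw [ht, norm_smul, norm_inv, norm_norm, inv_mul_cancel₀ htn.ne']
  have hAt : ∀ a ∈ A, ⟪a, t⟫ < 8192 * r := by
    intro a ha
    have h1 := hf a ha
    rw [hft, hft] at h1
    have h2 : ⟪a, t⟫ < ⟪y, t⟫ := by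
      rw [ht, real_inner_smul_right, real_inner_smul_right]
      exact mul_lt_mul_of_pos_left h1 (inv_pos.2 htn)
    have h3 : ⟪y, t⟫ ≤ ‖y‖ * ‖t‖ := real_inner_le_norm _ _
    rw [ht1, mul_one] at h3
    linarith
  refine ⟨t, ht1, ?_⟩
  set H : Set (EuclideanSpace ℝ (Fin m)) := {y | 8192 * r ≤ ⟪y, t⟫} with hH
  have hHm : MeasurableSet H := measurableSet_le measurable_const (by fun_prop)
  set H' : Set (EuclideanSpace ℝ (Fin m)) := {w | 8193 * r ≤ ⟪w, t⟫} with hH'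
  have hHm' : MeasurableSet H' := measurableSet_le measurable_const (by fun_prop)
  have hlow : V * ν H' ≤ ∫⁻ y in H, ν (Metric.ball y r) := by
    have h0 : MeasurableSet {p : EuclideanSpace ℝ (Fin m) × EuclideanSpace ℝ (Fin m) |
        dist p.2 p.1 < r} := measurableSet_lt (by fun_prop) (by fun_prop)
    have h1 := hfub {p | p.1 ∈ H ∧ dist p.2 p.1 < r} ((measurable_fst hHm).inter h0)
    have h2 : ∀ y : EuclideanSpace ℝ (Fin m),
        ν (Prod.mk y ⁻¹' {p | p.1 ∈ H ∧ dist p.2 p.1 < r}) =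
        H.indicator (fun y => ν (Metric.ball y r)) y := fun y => by
      by_cases hy : y ∈ H
      · rw [Set.indicator_of_mem hy]; congr 1; ext; simp [hy]
      · rw [Set.indicator_of_notMem hy]; simp [hy]
    simp only [h2] at h1
    rw [lintegral_indicator hHm] at h1
    rw [h1, ← setLIntegral_const]
    refine (setLIntegral_mono' hHm' fun w hw => ?_).trans (setLIntegral_le_lintegral _ _)
    rw [← hVb w]
    refine measure_mono fun z hz => ?_
    simp only [hH', hH, Set.mem_ofPred_eq, Set.mem_preimage, Metric.mem_ball] at hw hz ⊢
    refine ⟨?_, by rwa [dist_comm]⟩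
    have h3 : ⟪w - z, t⟫ ≤ ‖w - z‖ * ‖t‖ := real_inner_le_norm _ _
    rw [inner_sub_left, ht1, mul_one, ← dist_eq_norm, dist_comm] at h3
    linarith
  have hup : ∫⁻ y in H, ν (Metric.ball y r) ≤
      ENNReal.ofReal (2 * (1 / 64) ^ m) * (ENNReal.ofReal (2 ^ m) * V) := by
    rw [← hhalf]
    have : ∀ y ∈ H, ν (Metric.ball y r) ≤
        ENNReal.ofReal (2 * (1 / 64) ^ m) * ν (Metric.ball ((1 / 2 : ℝ) • y) r) := by
      intro y hy
      rw [hgG, hgG, ← ENNReal.ofReal_mul (by positivity)]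
      refine ENNReal.ofReal_le_ofReal ?_
      have h1 : g y ≤ δ := by
        by_contra hcon
        exact absurd (hAt y (not_le.1 hcon)) (not_lt.2 hy)
      have h2 := hgc (1 / 2) ⟨by norm_num, by norm_num⟩ y 0
      rw [smul_zero, add_zero, show (1 : ℝ) - 1 / 2 = 1 / 2 by norm_num, ← sqrt_eq_rpow,
        ← sqrt_eq_rpow] at h2
      have h3 : √(1 / 4 : ℝ) ≤ √(g 0) := sqrt_le_sqrt (by linarith [show 3 / 4 ≤ g 0 from hball])
      have h4 : √(1 / 4 : ℝ) = 1 / 2 := by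
        rw [show (1 / 4 : ℝ) = (1 / 2) ^ 2 by norm_num, sqrt_sq (by norm_num)]
      rw [h4] at h3
      have h5 : √(g y) ≤ (1 / 64) ^ m := by
        rw [sqrt_le_left (by positivity), ← pow_mul, mul_comm, pow_mul]
        refine h1.trans (le_of_eq ?_)
        rw [hδ]; norm_num
      have h6 : √(g y) * √(g y) = g y := mul_self_sqrt (hg0 y)
      have h7 : √(g y) ≤ 2 * g ((1 / 2 : ℝ) • y) := by nlinarith [sqrt_nonneg (g y)]
      calc g y = √(g y) * √(g y) := h6.symm
        _ ≤ (1 / 64) ^ m * (2 * g ((1 / 2 : ℝ) • y)) := by gcongr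
        _ = _ := by ring
    refine (setLIntegral_mono' hHm this).trans ((setLIntegral_le_lintegral _ _).trans ?_)
    rw [lintegral_const_mul' _ _ (by finiteness)]
  have hfin : ν H' ≤ ENNReal.ofReal (2 * (1 / 32) ^ m) := by
    have h1 := hlow.trans hup
    rw [← mul_assoc, ← ENNReal.ofReal_mul (by positivity), mul_comm] at h1
    have h2 := (ENNReal.mul_le_mul_iff_left hV0 hVt).1 h1
    rwa [mul_assoc, ← mul_pow, show (1 / 64 * 2 : ℝ) = 1 / 32 by norm_num] at h2
  have hfin' : ν.real H' ≤ 2 * (1 / 32) ^ m := ENNReal.toReal_le_of_le_ofReal (by positivity) hfin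
  refine hfin'.trans ?_
  have he : exp (2 : ℝ) ≤ 8 := by
    have := exp_one_lt_d9
    rw [show (2 : ℝ) = 1 + 1 by norm_num, exp_add]
    nlinarith [exp_pos 1]
  have h1 : (1 / 8 : ℝ) ^ m ≤ exp (-2 * m) := by
    rw [mul_comm, exp_nat_mul]
    gcongr
    rw [exp_neg, one_div]
    exact inv_anti₀ (exp_pos _) he
  have h2 : (1 / 32 : ℝ) ^ m = (1 / 4) ^ m * (1 / 8) ^ m := by rw [← mul_pow]; norm_num
  have h3 : (1 / 4 : ℝ) ^ m ≤ (1 / 4) ^ 1 := pow_le_pow_of_le_one (by norm_num) (by norm_num) hm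
  rw [h2]
  have h4 : (1 / 4 : ℝ) ^ m * (1 / 8) ^ m ≤ (1 / 4) * exp (-2 * m) := by
    gcongr
    simpa using h3
  linarith
end

open ProbabilityTheory in
lemma stdGaussian_eq_withDensity {E : Type*} [NormedAddCommGroup E] [InnerProductSpace ℝ E]
    [FiniteDimensional ℝ E] [MeasurableSpace E] [BorelSpace E] :
    stdGaussian E = (volume : Measure E).withDensity fun x => ENNReal.ofReal
      ((2 * π) ^ (-(Module.finrank ℝ E : ℝ) / 2) * exp (-(1 / 2) * ‖x‖ ^ 2)) := by
  set Z : ℝ := (2 * π) ^ ((Module.finrank ℝ E : ℝ) / 2) with hZ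
  have hZ0 : 0 < Z := by positivity
  have hZ' : (2 * π) ^ (-(Module.finrank ℝ E : ℝ) / 2) = Z⁻¹ := by
    rw [hZ, neg_div, rpow_neg (by positivity)]
  rw [hZ']
  have hint : ∫ x : E, exp (-(1 / 2) * ‖x‖ ^ 2) = Z := by
    rw [GaussianFourier.integral_rexp_neg_mul_sq_norm (by norm_num)]
    congr 1
    ring
  have hI : Integrable fun x : E => exp (-(1 / 2) * ‖x‖ ^ 2) := by
    by_contra h
    rw [integral_undef h] at hint
    exact hZ0.ne hint
  have hd : Measurable fun x : E => Real.toNNReal (Z⁻¹ * exp (-(1 / 2) * ‖x‖ ^ 2)) := by fun_prop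
  have : IsFiniteMeasure ((volume : Measure E).withDensity fun x => ENNReal.ofReal
      (Z⁻¹ * exp (-(1 / 2) * ‖x‖ ^ 2))) := by
    refine isFiniteMeasure_withDensity_ofReal (hI.const_mul _).2
  refine Measure.ext_of_charFun ?_
  ext t
  rw [charFun_stdGaussian, charFun_apply]
  simp only [ENNReal.ofReal]
  rw [integral_withDensity_eq_integral_smul hd]
  have h1 := GaussianFourier.integral_cexp_neg_mul_sq_norm_add (V := E) (b := 1 / 2) (by norm_num)
    Complex.I t
  have h2 : ∀ x : E, (Real.toNNReal (Z⁻¹ * exp (-(1 / 2) * ‖x‖ ^ 2))) •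
      Complex.exp (⟪x, t⟫ * Complex.I) =
      (Z⁻¹ : ℂ) * Complex.exp (-(1 / 2) * ‖x‖ ^ 2 + Complex.I * ⟪t, x⟫) := by
    intro x
    rw [NNReal.smul_def, Real.coe_toNNReal _ (by positivity), Complex.real_smul, Complex.exp_add,
      real_inner_comm]
    push_cast
    ring_nf
  simp only [h2]
  rw [integral_const_mul, h1, hZ]
  have h3 : ((π : ℂ) / (1 / 2)) ^ ((Module.finrank ℝ E : ℂ) / 2) =
      (((2 * π) ^ ((Module.finrank ℝ E : ℝ) / 2) : ℝ) : ℂ) := by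
    rw [Complex.ofReal_cpow (by positivity)]
    push_cast
    ring_nf
  rw [h3, ← mul_assoc, ← Complex.ofReal_inv, ← Complex.ofReal_mul, ← hZ, inv_mul_cancel₀ hZ0.ne']
  simp only [Complex.ofReal_one, one_mul, Complex.I_sq]
  congr 1
  ring

open ProbabilityTheory in
/-- Concentration of the Gaussian measure, in exponential integral form. -/
lemma stdGaussian_mul_lintegral_infDist_le {k : ℕ} {A : Set (EuclideanSpace ℝ (Fin k))}
    (hA : MeasurableSet A) :
    stdGaussian _ A * ∫⁻ x, ENNReal.ofReal (exp (Metric.infDist x A ^ 2 / 4))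
      ∂(stdGaussian (EuclideanSpace ℝ (Fin k))) ≤ 1 := by
  set φ : EuclideanSpace ℝ (Fin k) → ℝ := fun x =>
    (2 * π) ^ (-(Module.finrank ℝ (EuclideanSpace ℝ (Fin k)) : ℝ) / 2) * exp (-(1 / 2) * ‖x‖ ^ 2)
    with hφ
  set c : ℝ := (2 * π) ^ (-(Module.finrank ℝ (EuclideanSpace ℝ (Fin k)) : ℝ) / 2)
  have hc : 0 < c := by positivity
  have hφm : Measurable φ := by fun_prop
  have hφm' : Measurable fun x => ENNReal.ofReal (φ x) := by fun_prop
  have h1 : ∫⁻ x, ENNReal.ofReal (φ x) = 1 := by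
    have : stdGaussian (EuclideanSpace ℝ (Fin k)) Set.univ = 1 := measure_univ
    rwa [stdGaussian_eq_withDensity, withDensity_apply _ MeasurableSet.univ, Measure.restrict_univ]
      at this
  have hdm : Measurable fun x => ENNReal.ofReal (exp (Metric.infDist x A ^ 2 / 4)) := by
    have := (Metric.continuous_infDist_pt A).measurable
    fun_prop
  have h2 := prekopaLeindler_euclideanSpace k (1 / 2) ⟨by norm_num, by norm_num⟩
    (A.indicator fun x => ENNReal.ofReal (φ x))
    (fun x => ENNReal.ofReal (φ x) * ENNReal.ofReal (exp (Metric.infDist x A ^ 2 / 4)))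
    (fun x => ENNReal.ofReal (φ x)) (hφm'.indicator hA) (hφm'.mul hdm) hφm' ?_
  · have h0 := lintegral_withDensity_eq_lintegral_mul volume hφm' hdm
    simp only [Pi.mul_apply] at h0
    rw [lintegral_indicator hA, ← withDensity_apply _ hA, ← h0, h1, ← stdGaussian_eq_withDensity,
      show (1 : ℝ) - 1 / 2 = 1 / 2 by norm_num, ← ENNReal.mul_rpow_of_nonneg _ _ (by norm_num)] at h2
    have h3 := ENNReal.rpow_le_rpow h2 (z := 2) (by norm_num)
    rwa [← ENNReal.rpow_mul, show (1 / 2 : ℝ) * 2 = 1 by norm_num, ENNReal.rpow_one,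
      ENNReal.one_rpow] at h3
  · intro x y
    by_cases hx : x ∈ A
    · rw [Set.indicator_of_mem hx, show (1 : ℝ) - 1 / 2 = 1 / 2 by norm_num,
        ← ENNReal.mul_rpow_of_nonneg _ _ (by norm_num),
        ← ENNReal.ofReal_mul (by positivity), ← ENNReal.ofReal_mul (by positivity),
        ENNReal.ofReal_rpow_of_nonneg (by positivity) (by norm_num), ← sqrt_eq_rpow]
      refine ENNReal.ofReal_le_ofReal (sqrt_le_iff.2 ⟨by positivity, ?_⟩)
      have h3 : Metric.infDist y A ^ 2 ≤ ‖y - x‖ ^ 2 := by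
        have := Metric.infDist_le_dist_of_mem (x := y) hx
        rw [dist_eq_norm] at this
        exact pow_le_pow_left₀ Metric.infDist_nonneg this 2
      have h4 : φ x * (φ y * exp (Metric.infDist y A ^ 2 / 4)) = c ^ 2 *
          exp (-(1 / 2) * ‖x‖ ^ 2 + -(1 / 2) * ‖y‖ ^ 2 + Metric.infDist y A ^ 2 / 4) := by
        simp only [hφ, exp_add]; ring
      rw [h4]
      simp only [hφ]
      rw [mul_pow, ← exp_nat_mul]
      gcongr
      have h5 := parallelogram_law_with_norm ℝ y x
      have h6 : ‖(1 / 2 : ℝ) • x + (1 / 2 : ℝ) • y‖ = 1 / 2 * ‖y + x‖ := by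
        rw [← smul_add, norm_smul, add_comm]; norm_num
      rw [h6]
      push_cast
      nlinarith
    · rw [Set.indicator_of_notMem hx, ENNReal.zero_rpow_of_pos (by norm_num), zero_mul]
      exact zero_le

open ProbabilityTheory in
/-- The distribution of a linear functional under the standard Gaussian measure. -/
lemma stdGaussian_map_inner {E : Type*} [NormedAddCommGroup E] [InnerProductSpace ℝ E]
    [FiniteDimensional ℝ E] [MeasurableSpace E] [BorelSpace E] (v : E) :
    (stdGaussian E).map (fun x => ⟪v, x⟫) = (gaussianReal 0 1).map (fun x => ‖v‖ * x) := by
  have h1 : IsProbabilityMeasure ((stdGaussian E).map (fun x => ⟪v, x⟫)) :=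
    Measure.isProbabilityMeasure_map (by fun_prop)
  have h2 : IsProbabilityMeasure ((gaussianReal 0 1).map (fun x => ‖v‖ * x)) :=
    Measure.isProbabilityMeasure_map (by fun_prop)
  refine Measure.ext_of_charFun ?_
  ext t
  rw [charFun_map_mul, charFun_gaussianReal, charFun_apply, integral_map (by fun_prop) (by fun_prop)]
  have := charFun_stdGaussian (E := E) (t • v)
  rw [charFun_apply] at this
  simp only [real_inner_smul_right] at this
  have h3 : ∀ x : E, ⟪⟪v, x⟫, t⟫ = t * ⟪x, v⟫ := fun x => by
    rw [real_inner_comm]; simp [real_inner_comm, mul_comm]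
  simp only [h3]
  rw [this, norm_smul]
  congr 1
  push_cast
  simp [mul_pow, ← Complex.ofReal_pow]
  ring

open ProbabilityTheory in
lemma integral_pow_gaussianReal (m : ℕ) :
    ∫ x, x ^ (2 * m) ∂(gaussianReal 0 1) = ((2 * m - 1).doubleFactorial : ℝ) := by
  rw [integral_gaussianReal_eq_integral_smul (by norm_num)]
  have h1 : ∀ x : ℝ, gaussianPDFReal 0 1 x • x ^ (2 * m) =
      (√(2 * π))⁻¹ * (fun y : ℝ => y ^ (2 * m) * exp (-(1 / 2) * y ^ 2)) |x| := by
    intro x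
    simp [gaussianPDFReal, (even_two_mul m).pow_abs]
    ring_nf
  simp only [h1]
  rw [integral_const_mul, integral_comp_abs (f := fun y : ℝ => y ^ (2 * m) * exp (-(1 / 2) * y ^ 2))]
  have h2 := integral_rpow_mul_exp_neg_mul_rpow (p := 2) (q := ((2 * m : ℕ) : ℝ)) (b := 1 / 2)
    (by norm_num) (by push_cast; linarith [show (0 : ℝ) ≤ m by positivity]) (by norm_num)
  have h3 : ∀ y : ℝ, y ^ (((2 * m : ℕ) : ℝ)) * exp (-(1 / 2) * y ^ (2 : ℝ)) =
      y ^ (2 * m) * exp (-(1 / 2) * y ^ 2) := fun y => by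
    rw [rpow_natCast, rpow_two]
  simp only [h3] at h2
  rw [h2]
  have h4 : (((2 * m : ℕ) : ℝ) + 1) / 2 = m + 1 / 2 := by push_cast; ring
  rw [h4, Real.Gamma_nat_add_half, neg_div, h4, rpow_neg (by norm_num), ← inv_rpow (by norm_num),
    show (1 / 2 : ℝ)⁻¹ = 2 by norm_num, rpow_add (by norm_num), rpow_natCast, ← sqrt_eq_rpow,
    sqrt_mul (by norm_num)]
  have : √2 ≠ (0 : ℝ) := by positivity
  have : √π ≠ 0 := by positivity
  field_simp

lemma half_pow_le_doubleFactorial (m : ℕ) :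
    ((m : ℝ) / 2) ^ m ≤ ((2 * m - 1).doubleFactorial : ℝ) := by
  rcases m with _ | m
  · simp
  have h1 := Nat.factorial_mul_pow_le_factorial (m := m + 1) (n := m + 1)
  have h2 := Nat.factorial_eq_mul_doubleFactorial (2 * m + 1)
  have h3 := Nat.doubleFactorial_two_mul (m + 1)
  have h4 : (m + 1).factorial * (m + 1) ^ (m + 1) ≤
      (m + 1).factorial * (2 ^ (m + 1) * (2 * m + 1).doubleFactorial) := by
    calc _ ≤ (m + 1).factorial * (m + 1 + 1) ^ (m + 1) := by gcongr; omega
      _ ≤ (m + 1 + (m + 1)).factorial := h1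
      _ = _ := by
        rw [show m + 1 + (m + 1) = 2 * m + 1 + 1 by ring, h2,
          show 2 * m + 1 + 1 = 2 * (m + 1) by ring, h3]; ring
  have h5 := Nat.le_of_mul_le_mul_left h4 (Nat.factorial_pos _)
  rw [div_pow, div_le_iff₀ (by positivity), show 2 * (m + 1) - 1 = 2 * m + 1 by omega, mul_comm]
  exact_mod_cast h5

open ProbabilityTheory in
lemma integral_inner_pow_stdGaussian {E : Type*} [NormedAddCommGroup E] [InnerProductSpace ℝ E]
    [FiniteDimensional ℝ E] [MeasurableSpace E] [BorelSpace E] (v : E) (m : ℕ) :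
    ∫ x, ⟪v, x⟫ ^ (2 * m) ∂(stdGaussian E) = ‖v‖ ^ (2 * m) * ((2 * m - 1).doubleFactorial : ℝ) := by
  have h1 : ∫ y, y ^ (2 * m) ∂((stdGaussian E).map (fun x => ⟪v, x⟫)) =
      ∫ x, ⟪v, x⟫ ^ (2 * m) ∂(stdGaussian E) := integral_map (by fun_prop) (by fun_prop)
  rw [← h1, stdGaussian_map_inner, integral_map (by fun_prop) (by fun_prop)]
  simp only [mul_pow]
  rw [integral_const_mul, integral_pow_gaussianReal]

open ProbabilityTheory in
lemma integrable_norm_pow_stdGaussian {E : Type*} [NormedAddCommGroup E] [InnerProductSpace ℝ E]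
    [FiniteDimensional ℝ E] [MeasurableSpace E] [BorelSpace E] (q : ℕ) :
    Integrable (fun x => ‖x‖ ^ q) (stdGaussian E) :=
  (IsGaussian.memLp_id (stdGaussian E) q (by finiteness)).integrable_norm_pow'

open ProbabilityTheory in
lemma integral_norm_sq_stdGaussian {E : Type*} [NormedAddCommGroup E] [InnerProductSpace ℝ E]
    [FiniteDimensional ℝ E] [MeasurableSpace E] [BorelSpace E] :
    ∫ x, ‖x‖ ^ 2 ∂(stdGaussian E) = Module.finrank ℝ E := by
  set b := stdOrthonormalBasis ℝ E
  have h1 : ∀ x : E, ‖x‖ ^ 2 = ∑ i, ⟪b i, x⟫ ^ (2 * 1) := fun x => by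
    rw [mul_one, b.sum_sq_inner_right]
  simp only [h1]
  rw [integral_finsetSum]
  · simp only [integral_inner_pow_stdGaussian]
    simp
  · intro i _
    refine (integrable_norm_pow_stdGaussian (E := E) 2).mono' (by fun_prop) (.of_forall fun x => ?_)
    rw [mul_one, Real.norm_of_nonneg (sq_nonneg _), ← sq_abs]
    have := abs_real_inner_le_norm (b i) x
    rw [b.norm_eq_one, one_mul] at this
    gcongr

open ProbabilityTheory in
/-- A normalized linear combination of independent standard Gaussian vectors is standard
Gaussian. -/
lemma pi_stdGaussian_map_sum_smul {E ι : Type*} [Fintype ι] [NormedAddCommGroup E]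
    [InnerProductSpace ℝ E] [FiniteDimensional ℝ E] [MeasurableSpace E] [BorelSpace E]
    (t : ι → ℝ) (ht : ∑ j, t j ^ 2 = 1) :
    (Measure.pi fun _ : ι => stdGaussian E).map (fun G => ∑ j, t j • G j) = stdGaussian E := by
  have hm : Measurable (fun G : ι → E => ∑ j, t j • G j) :=
    Finset.measurable_sum _ fun j _ => (measurable_pi_apply j).const_smul _
  have h1 : IsProbabilityMeasure
      ((Measure.pi fun _ : ι => stdGaussian E).map (fun G => ∑ j, t j • G j)) :=
    Measure.isProbabilityMeasure_map hm.aemeasurable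
  refine Measure.ext_of_charFun ?_
  ext ξ
  rw [charFun_apply, integral_map hm.aemeasurable (by fun_prop)]
  simp_rw [sum_inner, Complex.ofReal_sum, Finset.sum_mul, Complex.exp_sum]
  rw [integral_fintype_prod_eq_prod (f := fun j x => Complex.exp (⟪t j • x, ξ⟫ * Complex.I))]
  have h2 : ∀ j, ∫ x, Complex.exp (⟪t j • x, ξ⟫ * Complex.I) ∂(stdGaussian E) =
      Complex.exp (-(‖t j • ξ‖ : ℂ) ^ 2 / 2) := fun j => by
    rw [← charFun_stdGaussian, charFun_apply]
    simp only [real_inner_smul_left, real_inner_smul_right]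
  simp only [h2]
  rw [charFun_stdGaussian, ← Complex.exp_sum, ← Finset.sum_div, Finset.sum_neg_distrib]
  congr 3
  norm_cast
  simp only [norm_smul, mul_pow, Real.norm_eq_abs, sq_abs]
  rw [← Finset.sum_mul, ht, one_mul]

lemma card_le_of_separated {E : Type*} [NormedAddCommGroup E] [NormedSpace ℝ E]
    [FiniteDimensional ℝ E] (s : Finset E) {ε : ℝ} (hε : 0 < ε) (hs : ∀ x ∈ s, ‖x‖ = 1)
    (hsep : ∀ x ∈ s, ∀ y ∈ s, x ≠ y → ε < ‖x - y‖) :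
    (s.card : ℝ) ≤ (1 + 2 / ε) ^ Module.finrank ℝ E := by
  borelize E
  let μ : Measure E := Measure.addHaar
  set V := μ (Metric.ball 0 1)
  have hV0 : V ≠ 0 := (Metric.measure_ball_pos _ _ one_pos).ne'
  have hVt : V ≠ ∞ := measure_ball_lt_top.ne
  have hb : ∀ (r : ℝ) (_ : 0 < r) (x : E), μ (Metric.ball x r) =
      ENNReal.ofReal (r ^ Module.finrank ℝ E) * V := fun r hr x => Measure.addHaar_ball_of_pos _ _ hr
  have h1 : μ (⋃ x ∈ s, Metric.ball x (ε / 2)) = ∑ x ∈ s, μ (Metric.ball x (ε / 2)) := by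
    refine measure_biUnion_finset ?_ fun _ _ => measurableSet_ball
    intro x hx y hy hxy
    refine Metric.ball_disjoint_ball ?_
    rw [dist_eq_norm]
    linarith [hsep x hx y hy hxy]
  have h2 : (⋃ x ∈ s, Metric.ball x (ε / 2)) ⊆ Metric.ball 0 (1 + ε / 2) := by
    refine Set.iUnion₂_subset fun x hx => Metric.ball_subset_ball' ?_
    rw [dist_zero_right, hs x hx]; linarith
  have h3 := measure_mono (μ := μ) h2
  rw [h1] at h3
  simp only [hb _ (by positivity : 0 < ε / 2), hb _ (by positivity : 0 < 1 + ε / 2)] at h3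
  rw [Finset.sum_const, nsmul_eq_mul, ← mul_assoc, ENNReal.mul_le_mul_iff_left hV0 hVt,
    ← ENNReal.ofReal_natCast, ← ENNReal.ofReal_mul (by positivity),
    ENNReal.ofReal_le_ofReal_iff (by positivity)] at h3
  rw [show 1 + 2 / ε = (1 + ε / 2) / (ε / 2) by field_simp; ring, div_pow,
    le_div_iff₀ (by positivity)]
  exact h3

lemma exists_sphere_net (E : Type*) [NormedAddCommGroup E] [NormedSpace ℝ E]
    [FiniteDimensional ℝ E] {ε : ℝ} (hε : 0 < ε) :
    ∃ N : Finset E, (∀ x ∈ N, ‖x‖ = 1) ∧ (∀ x : E, ‖x‖ = 1 → ∃ y ∈ N, ‖x - y‖ ≤ ε) ∧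
      (N.card : ℝ) ≤ (1 + 2 / ε) ^ Module.finrank ℝ E := by
  classical
  set S : Set ℕ := {k | ∃ s : Finset E, s.card = k ∧ (∀ x ∈ s, ‖x‖ = 1) ∧
    ∀ x ∈ s, ∀ y ∈ s, x ≠ y → ε < ‖x - y‖} with hS
  have hb : BddAbove S := by
    refine ⟨⌊(1 + 2 / ε) ^ Module.finrank ℝ E⌋₊, ?_⟩
    rintro _ ⟨s, rfl, hs, hsep⟩
    exact Nat.le_floor (card_le_of_separated s hε hs hsep)
  obtain ⟨s, hcard, hs, hsep⟩ := Nat.sSup_mem (s := S) ⟨0, ∅, by simp⟩ hb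
  refine ⟨s, hs, fun x hx => ?_, card_le_of_separated s hε hs hsep⟩
  by_contra! hcon
  have hxs : x ∉ s := fun h => by
    have := hcon x h
    simp at this; linarith
  have : (insert x s).card ∈ S := by
    refine ⟨_, rfl, ?_, ?_⟩
    · simpa using ⟨hx, hs⟩
    · intro y hy z hz hyz
      rw [Finset.mem_insert] at hy hz
      rcases hy with rfl | hy <;> rcases hz with rfl | hz
      · exact absurd rfl hyz
      · exact hcon z hz
      · rw [norm_sub_rev]; exact hcon y hy
      · exact hsep y hy z hz hyz
  have := le_csSup hb this
  rw [Finset.card_insert_of_notMem hxs] at this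
  omega

/-- A seminorm on a finite-dimensional space is controlled by its values on a half-net of the
sphere. -/
lemma Seminorm.le_of_half_net {E : Type*} [NormedAddCommGroup E] [NormedSpace ℝ E]
    [FiniteDimensional ℝ E] (p : Seminorm ℝ E) {N : Finset E}
    (hN : ∀ x : E, ‖x‖ = 1 → ∃ y ∈ N, ‖x - y‖ ≤ 1 / 2) {C : ℝ} (hC : ∀ y ∈ N, p y ≤ C) (x : E) :
    p x ≤ 2 * C * ‖x‖ := by
  have hpc : Continuous p := by
    have := p.convexOn.continuousOn (isOpen_univ)
    rwa [continuousOn_univ] at this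
  have := FiniteDimensional.proper ℝ E
  have hC0 : ∀ x : E, ‖x‖ = 1 → 0 ≤ C := fun x hx => by
    obtain ⟨y, hy, -⟩ := hN x hx
    exact (apply_nonneg p y).trans (hC y hy)
  have key : ∀ x : E, ‖x‖ = 1 → p x ≤ 2 * C := by
    intro x0 hx0
    obtain ⟨x, hx, hmax⟩ := (isCompact_sphere (0 : E) 1).exists_isMaxOn ⟨x0, by simpa using hx0⟩
      hpc.continuousOn
    have hx1 : ‖x‖ = 1 := by simpa using hx
    have hhom : ∀ z : E, p z ≤ ‖z‖ * p x := by
      intro z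
      rcases eq_or_ne z 0 with rfl | hz
      · simp
      have hz' : 0 < ‖z‖ := norm_pos_iff.2 hz
      have h1 : p (‖z‖⁻¹ • z) ≤ p x := hmax (by simp [norm_smul, hz'.ne'])
      rw [map_smul_eq_mul, norm_inv, norm_norm, inv_mul_le_iff₀ hz'] at h1
      exact h1
    obtain ⟨y, hy, hxy⟩ := hN x hx1
    have h2 : p x ≤ p (x - y) + p y := by
      have := map_add_le_add p (x - y) y
      rwa [sub_add_cancel] at this
    have h3 := hhom (x - y)
    have h4 := hC y hy
    have h5 := apply_nonneg p x
    have h6 := hhom x0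
    rw [hx0, one_mul] at h6
    nlinarith
  rcases eq_or_ne x 0 with rfl | hx
  · simp
  have hx' : 0 < ‖x‖ := norm_pos_iff.2 hx
  have h1 := key (‖x‖⁻¹ • x) (by simp [norm_smul, hx'.ne'])
  rw [map_smul_eq_mul, norm_inv, norm_norm, inv_mul_le_iff₀ hx'] at h1
  linarith

lemma Seminorm.continuous_of_finiteDimensional {E : Type*} [NormedAddCommGroup E]
    [NormedSpace ℝ E] [FiniteDimensional ℝ E] (p : Seminorm ℝ E) : Continuous p := by
  have := p.convexOn.continuousOn isOpen_univ
  rwa [continuousOn_univ] at this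

open ProbabilityTheory in
lemma Seminorm.integrable_pow_stdGaussian {E : Type*} [NormedAddCommGroup E]
    [InnerProductSpace ℝ E] [FiniteDimensional ℝ E] [MeasurableSpace E] [BorelSpace E]
    (p : Seminorm ℝ E) {b : ℝ} (hb : ∀ g, p g ≤ b * ‖g‖) (q : ℕ) :
    Integrable (fun g => p g ^ q) (stdGaussian E) := by
  have := p.continuous_of_finiteDimensional
  refine ((integrable_norm_pow_stdGaussian (E := E) q).const_mul (b ^ q)).mono' (by fun_prop)
    (.of_forall fun g => ?_)
  have h := apply_nonneg p g
  rw [Real.norm_of_nonneg (by positivity), ← mul_pow]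
  exact pow_le_pow_left₀ h (hb g) _

open ProbabilityTheory in
/-- Small-ball estimate for a seminorm of a Gaussian vector, in terms of its Lipschitz constant and
a high moment. -/
lemma Seminorm.stdGaussian_real_le {k m : ℕ} (hm : 1 ≤ m) (p : Seminorm ℝ (EuclideanSpace ℝ (Fin k)))
    {b V : ℝ} (hV : 0 < V) (hb0 : 0 < b) (hb : ∀ g, p g ≤ b * ‖g‖)
    (hVp : ∫ g, p g ^ (2 * m) ∂(stdGaussian (EuclideanSpace ℝ (Fin k))) = V ^ (2 * m)) :
    (stdGaussian (EuclideanSpace ℝ (Fin k))).real {g | p g ≤ V / 4} ≤ (16 * b ^ 2 * m / V ^ 2) ^ m := by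
  have hpc := p.continuous_of_finiteDimensional
  set γ := stdGaussian (EuclideanSpace ℝ (Fin k))
  set A := {g | p g ≤ V / 4} with hA
  have hAm : MeasurableSet A := measurableSet_le (by fun_prop) (by fun_prop)
  have hAne : A.Nonempty := ⟨0, by simp only [hA, Set.mem_ofPred_eq, map_zero]; positivity⟩
  rcases eq_or_ne (γ A) 0 with h0 | h0
  · rw [measureReal_def, h0]; simp only [ENNReal.toReal_zero]; positivity
  have hconc := stdGaussian_mul_lintegral_infDist_le hAm
  set d : EuclideanSpace ℝ (Fin k) → ℝ := fun x => Metric.infDist x A with hd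
  have hdc : Continuous d := Metric.continuous_infDist_pt A
  have hfin : ∫⁻ x, ENNReal.ofReal (exp (d x ^ 2 / 4)) ∂γ ≠ ∞ := by
    intro h
    rw [h, ENNReal.mul_top h0] at hconc
    simp at hconc
  have hint : Integrable (fun x => exp (d x ^ 2 / 4)) γ := by
    refine ⟨by fun_prop, ?_⟩
    rw [hasFiniteIntegral_iff_ofReal (.of_forall fun x => (exp_pos _).le)]
    exact hfin.lt_top
  set D := ∫ x, exp (d x ^ 2 / 4) ∂γ with hD
  have hconc' : γ.real A * D ≤ 1 := by
    rw [hD, integral_eq_lintegral_of_nonneg_ae (.of_forall fun x => (exp_pos _).le) (by fun_prop),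
      measureReal_def, ← ENNReal.toReal_mul]
    exact ENNReal.toReal_le_of_le_ofReal zero_le_one (by simpa using hconc)
  have hpd : ∀ x, p x ≤ V / 4 + b * d x := by
    intro x
    have : (p x - V / 4) / b ≤ d x := by
      refine (Metric.le_infDist hAne).2 fun y hy => ?_
      rw [div_le_iff₀ hb0, dist_eq_norm]
      have h1 : p x ≤ p (x - y) + p y := by
        have := map_add_le_add p (x - y) y
        rwa [sub_add_cancel] at this
      have h2 : p y ≤ V / 4 := hy
      linarith [hb (x - y)]
    rw [div_le_iff₀ hb0] at this
    linarith
  have hpt : ∀ x, p x ^ (2 * m) ≤ 1 / 2 * V ^ (2 * m) +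
      1 / 2 * (16 * b ^ 2) ^ m * m.factorial * exp (d x ^ 2 / 4) := by
    intro x
    have hd0 : 0 ≤ d x := Metric.infDist_nonneg
    have h1 := pow_le_pow_left₀ (apply_nonneg p x) (hpd x) (2 * m)
    have h2 := add_pow_le (by positivity : 0 ≤ V / 4) (by positivity : 0 ≤ b * d x) (2 * m)
    have h3 : (d x ^ 2 / 4) ^ m ≤ m.factorial * exp (d x ^ 2 / 4) := by
      have := Real.pow_div_factorial_le_exp (d x ^ 2 / 4) (by positivity) m
      rwa [div_le_iff₀ (by positivity), mul_comm] at this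
    have h4 : (2 : ℝ) ^ (2 * m - 1) = 1 / 2 * 4 ^ m := by
      obtain ⟨j, rfl⟩ : ∃ j, m = j + 1 := ⟨m - 1, by omega⟩
      rw [show 2 * (j + 1) - 1 = 2 * j + 1 by omega, pow_succ, pow_mul, pow_succ]; norm_num; ring
    have h5 : (4 : ℝ) ^ m * (V / 4) ^ (2 * m) ≤ V ^ (2 * m) := by
      rw [pow_mul, ← mul_pow, pow_mul]
      gcongr
      nlinarith
    have h6 : (4 : ℝ) ^ m * (b * d x) ^ (2 * m) = (16 * b ^ 2) ^ m * (d x ^ 2 / 4) ^ m := by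
      rw [pow_mul, ← mul_pow, ← mul_pow]; congr 1; ring
    rw [h4] at h2
    have h7 : (16 * b ^ 2) ^ m * (d x ^ 2 / 4) ^ m ≤
      (16 * b ^ 2) ^ m * (m.factorial * exp (d x ^ 2 / 4)) := by gcongr
    linarith
  have hI := integral_mono (p.integrable_pow_stdGaussian hb (2 * m))
    ((integrable_const (1 / 2 * V ^ (2 * m))).add
      (hint.const_mul (1 / 2 * (16 * b ^ 2) ^ m * m.factorial))) hpt
  simp only [Pi.add_apply] at hI
  rw [hVp, integral_add (integrable_const _) (hint.const_mul _),
    integral_const_mul _ (fun x => exp (d x ^ 2 / 4)), integral_const] at hI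
  simp only [probReal_univ, smul_eq_mul, one_mul] at hI
  have h8 : V ^ (2 * m) ≤ (16 * b ^ 2) ^ m * m.factorial * D := by linarith
  have h9 : γ.real A * V ^ (2 * m) ≤ (16 * b ^ 2) ^ m * m.factorial := by
    calc _ ≤ γ.real A * ((16 * b ^ 2) ^ m * m.factorial * D) := by gcongr
      _ = (16 * b ^ 2) ^ m * m.factorial * (γ.real A * D) := by ring
      _ ≤ (16 * b ^ 2) ^ m * m.factorial * 1 := by gcongr
      _ = _ := mul_one _
  rw [div_pow, le_div_iff₀ (by positivity), ← pow_mul, mul_pow _ (m : ℝ)]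
  refine h9.trans ?_
  gcongr
  exact_mod_cast Nat.factorial_le_pow m

open ProbabilityTheory in
/-- A random subspace argument: a seminorm on `ℝᵏ` with large Gaussian moment compared to its
Lipschitz constant is uniformly large on an `m`-dimensional section. -/
lemma Seminorm.exists_section {k m : ℕ} (hm : 1 ≤ m) (p : Seminorm ℝ (EuclideanSpace ℝ (Fin k)))
    {b V : ℝ} (hV : 0 < V) (hb0 : 0 < b) (hb : ∀ g, p g ≤ b * ‖g‖)
    (hVp : ∫ g, p g ^ (2 * m) ∂(stdGaussian (EuclideanSpace ℝ (Fin k))) = V ^ (2 * m))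
    (hk : 0 < k) (hη : 16 * b ^ 2 * m / V ^ 2 ≤ 1 / 516) :
    ∃ G : Fin m → EuclideanSpace ℝ (Fin k), ∑ j, ‖G j‖ ^ 2 ≤ 4 * m * k ∧
      ∀ t : EuclideanSpace ℝ (Fin m), ‖t‖ = 1 → V / 8 ≤ p (∑ j, t j • G j) := by
  have hpc := p.continuous_of_finiteDimensional
  set γ := stdGaussian (EuclideanSpace ℝ (Fin k)) with hγ
  set P := Measure.pi fun _ : Fin m => γ with hP
  have hlaw : ∀ t : EuclideanSpace ℝ (Fin m), ‖t‖ = 1 →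
      P.map (fun G => ∑ j, t j • G j) = γ := fun t ht => by
    refine pi_stdGaussian_map_sum_smul (E := EuclideanSpace ℝ (Fin k)) (fun j => t j) ?_
    have := EuclideanSpace.real_norm_sq_eq t
    rw [ht] at this
    linarith
  obtain ⟨N₁, hN₁, hN₁', hN₁c⟩ := exists_sphere_net (EuclideanSpace ℝ (Fin m))
    (ε := 1 / 2) (by norm_num)
  obtain ⟨N₂, hN₂, hN₂', hN₂c⟩ := exists_sphere_net (EuclideanSpace ℝ (Fin m))
    (ε := 1 / 64) (by norm_num)
  rw [finrank_euclideanSpace_fin] at hN₁c hN₂c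
  have hmeas : ∀ t : EuclideanSpace ℝ (Fin m),
      Measurable fun G : Fin m → EuclideanSpace ℝ (Fin k) => ∑ j, t j • G j := fun t =>
    Finset.measurable_sum _ fun j _ => by fun_prop
  have hsmall : γ.real {g | p g ≤ V / 4} ≤ (1 / 516) ^ m :=
    (p.stdGaussian_real_le hm hV hb0 hb hVp).trans (pow_le_pow_left₀ (by positivity) hη m)
  have hlarge : γ.real {g | 4 * V ≤ p g} ≤ (1 / 16) ^ m := by
    have h1 := mul_meas_ge_le_integral_of_nonneg (μ := γ) (f := fun g => p g ^ (2 * m))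
      (.of_forall fun g => pow_nonneg (apply_nonneg p g) _)
      (p.integrable_pow_stdGaussian hb (2 * m)) ((4 * V) ^ (2 * m))
    rw [hVp] at h1
    have h2 : γ.real {g | 4 * V ≤ p g} ≤ γ.real {g | (4 * V) ^ (2 * m) ≤ p g ^ (2 * m)} :=
      measureReal_mono fun g (hg : 4 * V ≤ p g) =>
        pow_le_pow_left₀ (by positivity : (0 : ℝ) ≤ 4 * V) hg (2 * m)
    have h3 : (0 : ℝ) < V ^ (2 * m) := by positivity
    have h4 : (4 * V) ^ (2 * m) = 16 ^ m * V ^ (2 * m) := by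
      rw [mul_pow, pow_mul]; norm_num
    rw [h4] at h1 h2
    refine h2.trans ?_
    rw [one_div, inv_pow, ← one_div, le_div_iff₀ (by positivity)]
    refine le_of_mul_le_mul_left ?_ h3
    linarith
  set B₁ := ⋃ t ∈ N₁, {G : Fin m → EuclideanSpace ℝ (Fin k) | 4 * V ≤ p (∑ j, t j • G j)} with hB₁
  set B₂ := ⋃ t ∈ N₂, {G : Fin m → EuclideanSpace ℝ (Fin k) | p (∑ j, t j • G j) ≤ V / 4} with hB₂
  set B₃ := {G : Fin m → EuclideanSpace ℝ (Fin k) | 4 * m * k ≤ ∑ j, ‖G j‖ ^ 2} with hB₃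
  have hB₁p : P.real B₁ ≤ 5 / 16 := by
    refine (measureReal_biUnion_finset_le _ _).trans ?_
    have : ∀ t ∈ N₁, P.real {G : Fin m → EuclideanSpace ℝ (Fin k) | 4 * V ≤ p (∑ j, t j • G j)} ≤
        (1 / 16) ^ m := by
      intro t ht
      refine le_trans (le_of_eq ?_) hlarge
      rw [← hlaw t (hN₁ t ht), map_measureReal_apply (hmeas t)
        (measurableSet_le (by fun_prop) (by fun_prop))]
      rfl
    refine (Finset.sum_le_card_nsmul _ _ _ this).trans ?_
    rw [nsmul_eq_mul]
    calc (N₁.card : ℝ) * (1 / 16) ^ m ≤ (1 + 2 / (1 / 2)) ^ m * (1 / 16) ^ m := by gcongr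
      _ = (5 / 16) ^ m := by rw [← mul_pow]; norm_num
      _ ≤ (5 / 16) ^ 1 := pow_le_pow_of_le_one (by norm_num) (by norm_num) hm
      _ = _ := pow_one _
  have hB₂p : P.real B₂ ≤ 1 / 4 := by
    refine (measureReal_biUnion_finset_le _ _).trans ?_
    have : ∀ t ∈ N₂, P.real {G : Fin m → EuclideanSpace ℝ (Fin k) | p (∑ j, t j • G j) ≤ V / 4} ≤
        (1 / 516) ^ m := by
      intro t ht
      refine le_trans (le_of_eq ?_) hsmall
      rw [← hlaw t (hN₂ t ht), map_measureReal_apply (hmeas t)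
        (measurableSet_le (by fun_prop) (by fun_prop))]
      rfl
    refine (Finset.sum_le_card_nsmul _ _ _ this).trans ?_
    rw [nsmul_eq_mul]
    calc (N₂.card : ℝ) * (1 / 516) ^ m ≤ (1 + 2 / (1 / 64)) ^ m * (1 / 516) ^ m := by gcongr
      _ = (1 / 4) ^ m := by rw [← mul_pow]; norm_num
      _ ≤ (1 / 4) ^ 1 := pow_le_pow_of_le_one (by norm_num) (by norm_num) hm
      _ = _ := pow_one _
  have hB₃p : P.real B₃ ≤ 1 / 4 := by
    have hi : ∀ j ∈ Finset.univ, Integrable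
        (fun G : Fin m → EuclideanSpace ℝ (Fin k) => ‖G j‖ ^ 2) P := fun j _ =>
      (measurePreserving_eval (fun _ : Fin m => γ) j).integrable_comp_of_integrable
        (integrable_norm_pow_stdGaussian 2)
    have h1 := mul_meas_ge_le_integral_of_nonneg (μ := P)
      (f := fun G : Fin m → EuclideanSpace ℝ (Fin k) => ∑ j, ‖G j‖ ^ 2)
      (.of_forall fun g => by positivity) (integrable_finsetSum _ hi) (4 * m * k)
    rw [integral_finsetSum _ hi] at h1
    have h2 : ∀ j, ∫ G : Fin m → EuclideanSpace ℝ (Fin k), ‖G j‖ ^ 2 ∂P = k := fun j => by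
      have := integral_norm_sq_stdGaussian (E := EuclideanSpace ℝ (Fin k))
      rw [finrank_euclideanSpace_fin] at this
      rw [← this, ← hγ, ← (measurePreserving_eval (fun _ : Fin m => γ) j).map_eq,
        integral_map (measurable_pi_apply j).aemeasurable (by fun_prop)]
    simp only [h2, Finset.sum_const, Finset.card_univ, Fintype.card_fin, nsmul_eq_mul] at h1
    have : (0 : ℝ) < m * k := by positivity
    have h3 : (m * k) * (4 * P.real B₃) ≤ (m * k) * 1 := by linarith
    linarith [le_of_mul_le_mul_left h3 this]
  obtain ⟨G, hG⟩ : ∃ G, G ∉ B₁ ∪ B₂ ∪ B₃ := by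
    by_contra! hcon
    have h1 : P.real (B₁ ∪ B₂ ∪ B₃) = 1 := by
      rw [Set.eq_univ_of_forall hcon]; exact probReal_univ
    have h2 := measureReal_union_le (μ := P) (B₁ ∪ B₂) B₃
    have h3 := measureReal_union_le (μ := P) B₁ B₂
    linarith
  simp only [hB₁, hB₂, hB₃, Set.mem_union, Set.mem_iUnion, Set.mem_ofPred_eq, not_or, not_exists,
    not_le] at hG
  obtain ⟨⟨hG1, hG2⟩, hG3⟩ := hG
  refine ⟨G, hG3.le, ?_⟩
  let Φ : EuclideanSpace ℝ (Fin m) →ₗ[ℝ] EuclideanSpace ℝ (Fin k) :=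
    { toFun := fun t => ∑ j, t j • G j
      map_add' := fun s t => by simp [add_smul, Finset.sum_add_distrib]
      map_smul' := fun c t => by simp [mul_smul, Finset.smul_sum] }
  let q : Seminorm ℝ (EuclideanSpace ℝ (Fin m)) := p.comp Φ
  intro t ht
  obtain ⟨y, hy, hty⟩ := hN₂' t ht
  have h1 : q (t - y) ≤ 2 * (4 * V) * ‖t - y‖ := q.le_of_half_net hN₁' (fun z hz => (hG1 z hz).le) _
  have h2 : V / 4 < q y := hG2 y hy
  have h3 : q y ≤ q t + q (t - y) := by
    have := map_sub_le_add q t (t - y)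
    rwa [sub_sub_cancel] at this
  change V / 8 ≤ q t
  nlinarith

lemma Continuous.integrable_of_ae_norm_le {E F : Type*} [NormedAddCommGroup E] [NormedSpace ℝ E]
    [FiniteDimensional ℝ E] [MeasurableSpace E] [BorelSpace E] [NormedAddCommGroup F]
    {μ : Measure E} [IsFiniteMeasure μ] {R : ℝ}
    (hR : ∀ᵐ x ∂μ, ‖x‖ ≤ R) {f : E → F} (hf : Continuous f) : Integrable f μ := by
  have := FiniteDimensional.proper ℝ E
  obtain ⟨C, hC⟩ := (isCompact_closedBall (0 : E) R).exists_bound_of_continuousOn hf.continuousOn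
  refine Integrable.of_bound hf.aestronglyMeasurable C ?_
  filter_upwards [hR] with x hx
  exact hC x (by simpa using hx)

lemma exists_seminorm_pow_eq_integral {E : Type*} [NormedAddCommGroup E] [InnerProductSpace ℝ E]
    [FiniteDimensional ℝ E] [MeasurableSpace E] [BorelSpace E] {μ : Measure E} [IsFiniteMeasure μ]
    {R : ℝ} (hR : ∀ᵐ x ∂μ, ‖x‖ ≤ R) {q : ℕ} (hq : 1 ≤ q) :
    ∃ p : Seminorm ℝ E, ∀ θ, p θ ^ (2 * q) = ∫ x, ⟪x, θ⟫ ^ (2 * q) ∂μ := by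
  have hL : ∀ θ : E, MemLp (fun x => ⟪x, θ⟫) ((2 * q : ℕ) : ℝ≥0∞) μ := by
    intro θ
    have hc : Continuous fun x : E => ‖⟪x, θ⟫‖ ^ ((((2 * q : ℕ) : ℝ≥0∞)).toReal) :=
      Continuous.rpow_const (by fun_prop) fun x => Or.inr (by positivity)
    rw [← integrable_norm_rpow_iff (by fun_prop) (by norm_cast; omega) (by finiteness)]
    exact hc.integrable_of_ae_norm_le hR
  have h1 : (1 : ℝ≥0∞) ≤ ((2 * q : ℕ) : ℝ≥0∞) := by norm_cast; omega
  refine ⟨Seminorm.of (fun θ => (eLpNorm (fun x => ⟪x, θ⟫) ((2 * q : ℕ) : ℝ≥0∞) μ).toReal)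
    (fun θ η => ?_) (fun c θ => ?_), fun θ => ?_⟩
  · rw [← ENNReal.toReal_add (hL θ).eLpNorm_ne_top (hL η).eLpNorm_ne_top]
    refine ENNReal.toReal_mono (ENNReal.add_ne_top.2 ⟨(hL θ).eLpNorm_ne_top,
      (hL η).eLpNorm_ne_top⟩) ?_
    have := eLpNorm_add_le (hL θ).1 (hL η).1 h1
    refine le_trans (le_of_eq ?_) this
    congr 1; ext x; simp [inner_add_right]
  · have : (fun x : E => ⟪x, c • θ⟫) = c • fun x : E => ⟪x, θ⟫ := by
      ext x; simp [real_inner_smul_right]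
    rw [this, eLpNorm_const_smul, ENNReal.toReal_mul]; simp
  · change (eLpNorm (fun x => ⟪x, θ⟫) ((2 * q : ℕ) : ℝ≥0∞) μ).toReal ^ (2 * q) = _
    rw [(hL θ).eLpNorm_eq_integral_rpow_norm (by norm_cast; omega) (by finiteness),
      ENNReal.toReal_ofReal (by positivity), ← rpow_natCast, ← rpow_mul (by positivity)]
    simp only [ENNReal.toReal_natCast]
    rw [inv_mul_cancel₀ (by positivity), rpow_one]
    congr 1; ext x
    rw [rpow_natCast, Real.norm_eq_abs, (even_two_mul q).pow_abs]

open ProbabilityTheory in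
/-- Under a moment growth condition, every subspace of large dimension contains an `m`-dimensional
frame on which the `2m`-th marginal moments are uniformly as large as they can be. -/
lemma exists_frame_le_integral {E : Type*} [NormedAddCommGroup E] [InnerProductSpace ℝ E]
    [FiniteDimensional ℝ E] [MeasurableSpace E] [BorelSpace E] {μ : Measure E}
    [IsProbabilityMeasure μ] {R α ρ : ℝ} (hR : ∀ᵐ x ∂μ, ‖x‖ ≤ R) (hα : 0 < α) (hρ : 0 < ρ)
    (hlow : ∀ θ : E, α ^ 2 * ‖θ‖ ^ 2 ≤ ∫ x, ⟪x, θ⟫ ^ 2 ∂μ)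
    (hup : ∀ (q : ℕ) (θ : E), 1 ≤ q →
      ∫ x, ⟪x, θ⟫ ^ (2 * q) ∂μ ≤ 4 * q.factorial * (ρ * α * ‖θ‖) ^ (2 * q))
    (F : Submodule ℝ E) (hF : 1 ≤ Module.finrank ℝ F) {m : ℕ} (hm : 1 ≤ m)
    (hmF : m = 1 ∨ 66048 * ρ ^ 2 * m ≤ Module.finrank ℝ F) :
    ∃ γ : Fin m → E, (∀ j, γ j ∈ F) ∧ ∑ j, ‖γ j‖ ^ 2 ≤ 4 * m ∧
      ∀ t : EuclideanSpace ℝ (Fin m), ‖t‖ = 1 →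
        (√m * α / 12) ^ (2 * m) ≤ ∫ x, ⟪x, ∑ j, t j • γ j⟫ ^ (2 * m) ∂μ := by
  set k := Module.finrank ℝ F with hk
  have hk0 : (0 : ℝ) < k := by positivity
  have hm0 : (0 : ℝ) < m := by positivity
  set b := stdOrthonormalBasis ℝ F with hb
  rcases hmF with rfl | hmF
  · refine ⟨fun _ => b ⟨0, hF⟩, fun _ => Subtype.prop _, ?_, fun t ht => ?_⟩
    · have := b.norm_eq_one ⟨0, hF⟩
      rw [Submodule.coe_norm] at this
      simp [this]
    · have h1 : ‖∑ j, t j • ((b ⟨0, hF⟩ : F) : E)‖ = 1 := by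
        have := b.norm_eq_one ⟨0, hF⟩
        rw [Submodule.coe_norm] at this
        have h2 := EuclideanSpace.real_norm_sq_eq t
        rw [ht, Fin.sum_univ_one] at h2
        rw [Fin.sum_univ_one, norm_smul, this, mul_one, Real.norm_eq_abs, ← sqrt_sq_eq_abs, ← h2]
        simp
      have h2 := hlow (∑ j, t j • ((b ⟨0, hF⟩ : F) : E))
      rw [h1] at h2
      simp only [mul_one, Nat.cast_one, sqrt_one, one_mul, one_pow] at h2 ⊢
      nlinarith [sq_nonneg α]
  let U : EuclideanSpace ℝ (Fin k) →ₗᵢ[ℝ] E := F.subtypeₗᵢ.comp b.repr.symm.toLinearIsometry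
  have hUF : ∀ g, U g ∈ F := fun g => Subtype.prop (b.repr.symm g)
  obtain ⟨p₀, hp₀⟩ := exists_seminorm_pow_eq_integral hR hm
  let p : Seminorm ℝ (EuclideanSpace ℝ (Fin k)) := p₀.comp U.toLinearMap
  have hp : ∀ g, p g ^ (2 * m) = ∫ x, ⟪x, U g⟫ ^ (2 * m) ∂μ := fun g => hp₀ (U g)
  set B : ℝ := 2 * √m * ρ * α with hB
  have hB0 : 0 < B := by positivity
  have hpB : ∀ g, p g ≤ B * ‖g‖ := by
    intro g
    refine le_of_pow_le_pow_left₀ (n := 2 * m) (by omega) (by positivity) ?_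
    rw [hp]
    refine (hup m (U g) hm).trans ?_
    rw [U.norm_map, hB, show 2 * √m * ρ * α * ‖g‖ = 2 * √m * (ρ * α * ‖g‖) by ring, mul_pow (2 * √m)]
    gcongr
    rw [pow_mul, mul_pow, sq_sqrt hm0.le, mul_pow]
    have h1 : (m.factorial : ℝ) ≤ m ^ m := by exact_mod_cast Nat.factorial_le_pow m
    have h2 : (4 : ℝ) ≤ (2 ^ 2) ^ m := by
      calc (4 : ℝ) = (2 ^ 2) ^ 1 := by norm_num
        _ ≤ _ := pow_le_pow_right₀ (by norm_num) hm
    gcongr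
  set γ := stdGaussian (EuclideanSpace ℝ (Fin k)) with hγ
  set A : ℝ := ∫ g, p g ^ (2 * m) ∂γ with hA
  set V₀ : ℝ := √(m * k * α ^ 2 / 2) with hV₀
  have hV₀0 : 0 < V₀ := by positivity
  have hVA : V₀ ^ (2 * m) ≤ A := by
    have hjoint : Integrable (Function.uncurry fun (g : EuclideanSpace ℝ (Fin k)) (x : E) =>
        ⟪x, U g⟫ ^ (2 * m)) (γ.prod μ) := by
      have h1 : Integrable (fun z : EuclideanSpace ℝ (Fin k) × E => ‖z.1‖ ^ (2 * m) * ‖z.2‖ ^ (2 * m))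
          (γ.prod μ) := (integrable_norm_pow_stdGaussian (2 * m)).mul_prod
            (Continuous.integrable_of_ae_norm_le hR (f := fun x : E => ‖x‖ ^ (2 * m)) (by fun_prop))
      have hUc := U.continuous
      refine h1.mono' (by fun_prop) (.of_forall fun z => ?_)
      simp only [Function.uncurry]
      rw [norm_pow, ← mul_pow]
      gcongr
      have := norm_inner_le_norm (𝕜 := ℝ) z.2 (U z.1)
      rwa [U.norm_map, mul_comm] at this
    have h1 : A = ∫ x, (∫ g, ⟪x, U g⟫ ^ (2 * m) ∂γ) ∂μ := by
      rw [hA]; simp only [hp]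
      exact integral_integral_swap hjoint
    let Us : E →L[ℝ] EuclideanSpace ℝ (Fin k) := ContinuousLinearMap.adjoint U.toContinuousLinearMap
    have hUs : ∀ x g, ⟪x, U g⟫ = ⟪Us x, g⟫ := fun x g =>
      (ContinuousLinearMap.adjoint_inner_left U.toContinuousLinearMap g x).symm
    have h2 : A = (∫ x, ‖Us x‖ ^ (2 * m) ∂μ) * ((2 * m - 1).doubleFactorial : ℝ) := by
      rw [h1]; simp only [hUs, hγ, integral_inner_pow_stdGaussian]
      rw [integral_mul_const]
    have h3 : k * α ^ 2 ≤ ∫ x, ‖Us x‖ ^ 2 ∂μ := by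
      have h4 : ∀ x, ‖Us x‖ ^ 2 = ∑ i, ⟪x, (b i : E)⟫ ^ 2 := by
        intro x
        rw [EuclideanSpace.real_norm_sq_eq]
        refine Finset.sum_congr rfl fun i _ => ?_
        have h5 : (Us x) i = ⟪Us x, EuclideanSpace.single i 1⟫ := by
          rw [EuclideanSpace.inner_single_right]; simp
        have h6 : U (EuclideanSpace.single i 1) = b i := by
          change ((b.repr.symm (EuclideanSpace.single i 1) : F) : E) = _
          rw [b.repr_symm_single]
        rw [h5, ← hUs, h6]
      simp only [h4]
      rw [integral_finsetSum _ fun i _ => Continuous.integrable_of_ae_norm_le hR (by fun_prop)]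
      have h7 : ∀ i ∈ Finset.univ, α ^ 2 ≤ ∫ x, ⟪x, (b i : E)⟫ ^ 2 ∂μ := fun i _ => by
        have := hlow (b i : E)
        have h8 := b.norm_eq_one i
        rw [Submodule.coe_norm] at h8
        rwa [h8, one_pow, mul_one] at this
      have := Finset.card_nsmul_le_sum _ _ _ h7
      rwa [nsmul_eq_mul, Finset.card_univ, Fintype.card_fin] at this
    have h9 : (k * α ^ 2) ^ m ≤ ∫ x, ‖Us x‖ ^ (2 * m) ∂μ := by
      have hj := (convexOn_pow (𝕜 := ℝ) m).map_integral_le (μ := μ) (f := fun x => ‖Us x‖ ^ 2)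
        (by fun_prop) isClosed_Ici (.of_forall fun x => by simp only [Set.mem_Ici]; positivity)
        (Continuous.integrable_of_ae_norm_le hR (by fun_prop))
        (Continuous.integrable_of_ae_norm_le hR (by fun_prop))
      simp only [← pow_mul] at hj
      exact (pow_le_pow_left₀ (by positivity) h3 m).trans hj
    rw [h2, hV₀, pow_mul, sq_sqrt (by positivity),
      show m * k * α ^ 2 / 2 = (k * α ^ 2) * ((m : ℝ) / 2) by ring, mul_pow]
    have := half_pow_le_doubleFactorial m
    gcongr
  have hA0 : 0 < A := lt_of_lt_of_le (by positivity) hVA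
  set V : ℝ := A ^ ((((2 * m : ℕ) : ℝ))⁻¹) with hV
  have hVpow : V ^ (2 * m) = A := by
    rw [hV]; exact rpow_inv_natCast_pow hA0.le (by omega)
  have hV0 : 0 < V := by positivity
  have hVV : V₀ ≤ V := le_of_pow_le_pow_left₀ (n := 2 * m) (by omega) hV0.le (by rwa [hVpow])
  have hη : 16 * B ^ 2 * m / V ^ 2 ≤ 1 / 516 := by
    rw [div_le_iff₀ (by positivity)]
    have h1 : V₀ ^ 2 ≤ V ^ 2 := by gcongr
    rw [hV₀, sq_sqrt (by positivity)] at h1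
    have h2 : B ^ 2 = 4 * m * ρ ^ 2 * α ^ 2 := by
      rw [hB]; simp only [mul_pow, sq_sqrt hm0.le]; ring
    rw [h2]
    have h3 : (m * α ^ 2) * (66048 * ρ ^ 2 * m) ≤ (m * α ^ 2) * k := by gcongr
    nlinarith
  obtain ⟨G, hG, hGt⟩ := p.exists_section hm hV0 hB0 hpB (by rw [hVpow]) (by omega) hη
  refine ⟨fun j => (√k)⁻¹ • U (G j), fun j => F.smul_mem _ (hUF _), ?_, fun t ht => ?_⟩
  · simp only [norm_smul, mul_pow, U.norm_map, norm_inv, Real.norm_of_nonneg (sqrt_nonneg _),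
      inv_pow, sq_sqrt hk0.le]
    rw [← Finset.mul_sum, inv_mul_le_iff₀ hk0]
    linarith
  · have h1 : ∑ j, t j • (√k)⁻¹ • U (G j) = U ((√k)⁻¹ • ∑ j, t j • G j) := by
      rw [map_smul, map_sum, Finset.smul_sum]
      refine Finset.sum_congr rfl fun j _ => ?_
      rw [map_smul, smul_comm]
    rw [h1, ← hp]
    refine pow_le_pow_left₀ (by positivity) ?_ _
    rw [map_smul_eq_mul, norm_inv, Real.norm_of_nonneg (sqrt_nonneg _), inv_mul_eq_div,
      le_div_iff₀ (by positivity)]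
    refine le_trans ?_ (hGt t ht)
    refine le_trans ?_ (div_le_div_of_nonneg_right hVV (by norm_num))
    rw [hV₀, le_div_iff₀ (by norm_num)]
    refine le_sqrt_of_sq_le ?_
    simp only [mul_pow, div_pow, sq_sqrt hm0.le, sq_sqrt hk0.le]
    have : 0 < m * k * α ^ 2 := by positivity
    linarith

lemma ae_prod_norm_le {E : Type*} [NormedAddCommGroup E] [MeasurableSpace E] {μ : Measure E}
    [SFinite μ] {R : ℝ} (hR : ∀ᵐ x ∂μ, ‖x‖ ≤ R) : ∀ᵐ z ∂μ.prod μ, ‖z‖ ≤ R := by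
  filter_upwards [Measure.quasiMeasurePreserving_fst.ae hR,
    Measure.quasiMeasurePreserving_snd.ae hR] with z h1 h2
  exact max_le h1 h2

section TiltedVariance

variable {E : Type*} [NormedAddCommGroup E] [InnerProductSpace ℝ E]
  [FiniteDimensional ℝ E] [MeasurableSpace E] [BorelSpace E] {μ : Measure E}
  [IsProbabilityMeasure μ]

lemma integral_inner_pow_le_prod {R : ℝ} (hR : ∀ᵐ x ∂μ, ‖x‖ ≤ R) (hsymm : μ.map Neg.neg = μ)
    (v : E) (m : ℕ) :
    ∫ x, ⟪x, v⟫ ^ (2 * m) ∂μ ≤ ∫ z : E × E, ⟪z.1 - z.2, v⟫ ^ (2 * m) ∂μ.prod μ := by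
  have := FiniteDimensional.proper ℝ E
  have hQ := ae_prod_norm_le hR
  have h1 : ∫ x, ⟪x, v⟫ ^ (2 * m) ∂μ = ∫ z : E × E, ⟪z.1, v⟫ ^ (2 * m) ∂μ.prod μ := by
    rw [integral_fun_fst (fun x : E => ⟪x, v⟫ ^ (2 * m))]; simp
  have hmp : MeasurePreserving (fun z : E × E => (z.1, -z.2)) (μ.prod μ) (μ.prod μ) :=
    (MeasurePreserving.id μ).prod ⟨measurable_neg, hsymm⟩
  have h2 : ∫ z : E × E, ⟪z.1 + z.2, v⟫ ^ (2 * m) ∂μ.prod μ =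
      ∫ z : E × E, ⟪z.1 - z.2, v⟫ ^ (2 * m) ∂μ.prod μ := by
    conv_lhs => rw [← hmp.map_eq]
    rw [integral_map hmp.measurable.aemeasurable (by fun_prop)]
    simp [sub_eq_add_neg]
  have i1 : Integrable (fun z : E × E => ⟪z.1 + z.2, v⟫ ^ (2 * m)) (μ.prod μ) :=
    Continuous.integrable_of_ae_norm_le hQ (by fun_prop)
  have i2 : Integrable (fun z : E × E => ⟪z.1 - z.2, v⟫ ^ (2 * m)) (μ.prod μ) :=
    Continuous.integrable_of_ae_norm_le hQ (by fun_prop)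
  have h3 : ∫ z : E × E, ⟪z.1, v⟫ ^ (2 * m) ∂μ.prod μ ≤
      ∫ z : E × E, (1 / 2 * ⟪z.1 - z.2, v⟫ ^ (2 * m) + 1 / 2 * ⟪z.1 + z.2, v⟫ ^ (2 * m))
        ∂μ.prod μ := by
    refine integral_mono (Continuous.integrable_of_ae_norm_le hQ (by fun_prop))
      ((i2.const_mul _).add (i1.const_mul _)) fun z => ?_
    have hc := (even_two_mul m).convexOn_pow (𝕜 := ℝ)
    have := hc.2 (Set.mem_univ ⟪z.1 - z.2, v⟫) (Set.mem_univ ⟪z.1 + z.2, v⟫)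
      (by norm_num : (0 : ℝ) ≤ 1 / 2) (by norm_num : (0 : ℝ) ≤ 1 / 2) (by norm_num)
    simp only [smul_eq_mul] at this
    refine le_trans (le_of_eq ?_) this
    rw [inner_sub_left, inner_add_left]; ring
  rw [integral_add (i2.const_mul _) (i1.const_mul _), integral_const_mul, integral_const_mul, h2]
    at h3
  rw [h1]; linarith

lemma pow_mul_factorial_exp_ge {a y : ℝ} (ha : 0 < a) (k : ℕ) :
    y ^ (2 * k) ≤ a ^ (2 * k) * (2 * k).factorial * exp (1 / a * |y|) := by
  have h := Real.pow_div_factorial_le_exp (1 / a * |y|) (by positivity) (2 * k)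
  rw [div_le_iff₀ (by positivity), mul_pow, div_pow, one_pow, one_div_mul_eq_div,
    div_le_iff₀ (by positivity), pow_mul |y|, sq_abs, ← pow_mul] at h
  linarith

lemma tilted_prod_map_sub_symm (ξ v : E) :
    (((μ.prod μ).tilted fun z : E × E => ⟪ξ, z.1 + z.2⟫).map fun z => ⟪z.1 - z.2, v⟫).map Neg.neg
      = ((μ.prod μ).tilted fun z : E × E => ⟪ξ, z.1 + z.2⟫).map fun z => ⟪z.1 - z.2, v⟫ := by
  have := FiniteDimensional.proper ℝ E
  set f : E × E → ℝ := fun z => ⟪ξ, z.1 + z.2⟫ with hf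
  have hY : Measurable fun z : E × E => ⟪z.1 - z.2, v⟫ := by fun_prop
  have hsw : ((μ.prod μ).tilted f).map Prod.swap = (μ.prod μ).tilted f := by
    ext s hs
    rw [Measure.map_apply measurable_swap hs, tilted_apply' _ _ (measurable_swap hs),
      tilted_apply' _ _ hs]
    conv_rhs => rw [← (Measure.measurePreserving_swap (μ := μ) (ν := μ)).map_eq]
    rw [setLIntegral_map hs (by fun_prop) measurable_swap]
    have h1 : ∫ x, exp (f x) ∂(μ.prod μ).map Prod.swap = ∫ x, exp (f x) ∂μ.prod μ := by
      rw [(Measure.measurePreserving_swap (μ := μ) (ν := μ)).map_eq]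
    rw [h1]
    simp [hf, add_comm]
  rw [Measure.map_map measurable_neg hY]
  conv_rhs => rw [← hsw, Measure.map_map hY measurable_swap]
  congr 1
  ext z
  simp [← inner_neg_left]


lemma le_mul_of_tilted_variance_le {R α ρ : ℝ} (hR : ∀ᵐ x ∂μ, ‖x‖ ≤ R)
    (hsymm : μ.map Neg.neg = μ) (hα : 0 < α) (hρ : 0 < ρ)
    (hlow : ∀ θ : E, α ^ 2 * ‖θ‖ ^ 2 ≤ ∫ x, ⟪x, θ⟫ ^ 2 ∂μ)
    (hup : ∀ (q : ℕ) (θ : E), 1 ≤ q →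
      ∫ x, ⟪x, θ⟫ ^ (2 * q) ∂μ ≤ 4 * q.factorial * (ρ * α * ‖θ‖) ^ (2 * q))
    {ξ : E} (hν : LogConc ((μ.prod μ).tilted fun z : E × E => ⟪ξ, z.1 + z.2⟫))
    {F : Submodule ℝ E} (hF : 1 ≤ Module.finrank ℝ F) {l : ℝ} (hl : 0 < l)
    (hvar : ∀ θ ∈ F, ∫ z : E × E, ⟪z.1 - z.2, θ⟫ ^ 2
      ∂(μ.prod μ).tilted (fun z : E × E => ⟪ξ, z.1 + z.2⟫) ≤ 2 * l ^ 2 * ‖θ‖ ^ 2)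
    {m j : ℕ} (hm : 1 ≤ m) (hj : 1 ≤ j) (hmF : m = 1 ∨ 66048 * ρ ^ 2 * m ≤ Module.finrank ℝ F)
    {P : ℝ} (hP : ∫ x, exp ⟪ξ, x⟫ ∂μ ≤ exp P) (hPm : P ≤ m * j) :
    α ≤ 37753344 * j * l := by
  have := FiniteDimensional.proper ℝ E
  have hQ := ae_prod_norm_le hR
  set f : E × E → ℝ := fun z => ⟪ξ, z.1 + z.2⟫ with hf
  have hfc : Continuous f := by fun_prop
  set Q := μ.prod μ with hQdef
  set ν := Q.tilted f with hνdef
  have hint : Integrable (fun z => exp (f z)) Q :=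
    Continuous.integrable_of_ae_norm_le hQ (by fun_prop)
  have : IsProbabilityMeasure ν := isProbabilityMeasure_tilted hint
  have hνR : ∀ᵐ z ∂ν, ‖z‖ ≤ R := (tilted_absolutelyContinuous Q f).ae_le hQ
  have hm0 : (0 : ℝ) < m := by positivity
  obtain ⟨γ, hγF, hγ, hlo⟩ := exists_frame_le_integral hR hα hρ hlow hup F hF hm hmF
  let W : E × E → EuclideanSpace ℝ (Fin m) := fun z => WithLp.toLp 2 fun i => ⟪z.1 - z.2, γ i⟫
  have hWc : Continuous W := by
    refine (PiLp.continuous_toLp 2 _).comp ?_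
    fun_prop
  set r : ℝ := 6 * l * √m with hr
  have hr0 : 0 < r := by positivity
  have : IsProbabilityMeasure (ν.map W) := Measure.isProbabilityMeasure_map hWc.measurable.aemeasurable
  have hball : 3 / 4 ≤ (ν.map W).real (Metric.ball 0 r) := by
    have h1 : ∫ z, ‖W z‖ ^ 2 ∂ν ≤ 8 * l ^ 2 * m := by
      have h2 : ∀ z, ‖W z‖ ^ 2 = ∑ i, ⟪z.1 - z.2, γ i⟫ ^ 2 := fun z => by
        rw [EuclideanSpace.real_norm_sq_eq]
      simp_rw [h2]
      rw [integral_finsetSum _ fun i _ => Continuous.integrable_of_ae_norm_le hνR (by fun_prop)]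
      calc _ ≤ ∑ i, 2 * l ^ 2 * ‖γ i‖ ^ 2 := Finset.sum_le_sum fun i _ => hvar _ (hγF i)
        _ = 2 * l ^ 2 * ∑ i, ‖γ i‖ ^ 2 := by rw [Finset.mul_sum]
        _ ≤ 2 * l ^ 2 * (4 * m) := by gcongr
        _ = _ := by ring
    have h2 := mul_meas_ge_le_integral_of_nonneg (μ := ν) (f := fun z => ‖W z‖ ^ 2)
      (.of_forall fun z => by positivity)
      (Continuous.integrable_of_ae_norm_le hνR (by fun_prop)) (r ^ 2)
    have h3 : r ^ 2 = 36 * l ^ 2 * m := by rw [hr, mul_pow, sq_sqrt hm0.le]; ring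
    have h4 : ν.real {z | r ^ 2 ≤ ‖W z‖ ^ 2} ≤ 1 / 4 := by
      have h5 : 0 < l ^ 2 * m := by positivity
      refine le_of_mul_le_mul_left (a := 36 * (l ^ 2 * m)) ?_ (by positivity)
      rw [h3] at h2 ⊢
      linarith
    rw [map_measureReal_apply hWc.measurable measurableSet_ball]
    have h5 : W ⁻¹' Metric.ball 0 r = {z | r ^ 2 ≤ ‖W z‖ ^ 2}ᶜ := by
      ext z
      simp only [Set.mem_preimage, mem_ball_zero_iff, Set.mem_compl_iff, Set.mem_ofPred_eq, not_le]
      exact (sq_lt_sq₀ (norm_nonneg _) hr0.le).symm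
    rw [h5, measureReal_compl (measurableSet_le (g := fun z => ‖W z‖ ^ 2) (by fun_prop)
      (hWc.norm.pow 2).measurable)]
    simp only [probReal_univ]
    linarith
  obtain ⟨t, ht, htu⟩ := LogConc.exists_direction
    (hν.map hWc.measurable (fun a b x y => by
      ext i
      simp [W, inner_add_left, inner_sub_left, real_inner_smul_left]; ring)) hm hr0 hball
  set v : E := ∑ i, t i • γ i with hv
  set u : ℝ := 8193 * r with hu
  have hu0 : 0 < u := by positivity
  have hY : Continuous fun z : E × E => ⟪z.1 - z.2, v⟫ := by fun_prop
  have hYW : ∀ z : E × E, ⟪W z, t⟫ = ⟪z.1 - z.2, v⟫ := by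
    intro z
    rw [hv, inner_sum]
    simp only [PiLp.inner_apply, real_inner_smul_right, W]
    simp
  have : IsProbabilityMeasure (ν.map fun z : E × E => ⟪z.1 - z.2, v⟫) :=
    Measure.isProbabilityMeasure_map hY.measurable.aemeasurable
  have hYR : ∀ᵐ y ∂ν.map fun z : E × E => ⟪z.1 - z.2, v⟫, |y| ≤ 2 * R * ‖v‖ := by
    rw [ae_map_iff hY.measurable.aemeasurable (measurableSet_le (by fun_prop) (by fun_prop))]
    filter_upwards [hνR] with z hz
    refine (abs_real_inner_le_norm _ _).trans ?_
    gcongr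
    have h1 := norm_sub_le z.1 z.2
    have h2 := norm_fst_le z
    have h3 := norm_snd_le z
    linarith
  have hexp := LogConc.integral_exp_le
    (hν.map hY.measurable (fun a b x y => by
      simp [inner_add_left, inner_sub_left, real_inner_smul_left]; ring))
    (tilted_prod_map_sub_symm ξ v) hYR hu0 (m := m) (by exact_mod_cast hm) (by
      refine le_trans (le_of_eq ?_) htu
      rw [map_measureReal_apply hY.measurable measurableSet_Ici, map_measureReal_apply
        hWc.measurable (measurableSet_le (by fun_prop) (by fun_prop))]
      congr 1
      ext z
      simp only [Set.mem_preimage, Set.mem_Ici, Set.mem_ofPred_eq, hYW])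
  rw [integral_map hY.measurable.aemeasurable (by fun_prop)] at hexp
  set Y : E × E → ℝ := fun z => ⟪z.1 - z.2, v⟫ with hYdef
  set a : ℝ := 4 * u / m with ha
  have ha0 : 0 < a := by positivity
  set L := ∫ x, exp ⟪ξ, x⟫ ∂μ with hL
  have hL0 : 0 ≤ L := by positivity
  have hLf : ∫ z, exp (f z) ∂Q = L ^ 2 := by
    have h1 : ∀ z, exp (f z) = exp ⟪ξ, z.1⟫ * exp ⟪ξ, z.2⟫ := fun z => by
      rw [← exp_add, hf]; simp [inner_add_right]
    simp_rw [h1]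
    rw [hQdef, integral_prod_mul (fun x : E => exp ⟪ξ, x⟫) (fun x : E => exp ⟪ξ, x⟫), hL, sq]
  have hLneg : ∫ x, exp (-⟪ξ, x⟫) ∂μ = L := by
    rw [hL]
    conv_rhs => rw [← hsymm]
    rw [integral_map measurable_neg.aemeasurable (by fun_prop)]
    simp
  have hLnf : ∫ z, exp (-f z) ∂Q = L ^ 2 := by
    have h1 : ∀ z, exp (-f z) = exp (-⟪ξ, z.1⟫) * exp (-⟪ξ, z.2⟫) := fun z => by
      rw [← exp_add, hf]; simp [inner_add_right]; ring
    simp_rw [h1]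
    rw [hQdef, integral_prod_mul (fun x : E => exp (-⟪ξ, x⟫)) (fun x : E => exp (-⟪ξ, x⟫)), hLneg, sq]
  have hE : ∫ z, exp (1 / a * |Y z|) ∂Q ≤ 1 / 2 * L ^ 2 * (1 + 2 * exp (m / 2)) := by
    have h1 := integral_exp_tilted (μ := Q) f (fun z => m / (2 * u) * |Y z|)
    rw [hLf, ← hνdef] at h1
    have hL1 : 0 < L ^ 2 := by rw [← hLf]; exact integral_exp_pos hint
    rw [h1, div_le_iff₀ hL1] at hexp
    have i1 : Integrable (fun z => exp (-f z)) Q :=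
      Continuous.integrable_of_ae_norm_le hQ (by fun_prop)
    have i2 : Integrable (fun z => exp ((f + fun z => m / (2 * u) * |Y z|) z)) Q :=
      Continuous.integrable_of_ae_norm_le hQ (by simp only [Pi.add_apply]; fun_prop)
    calc ∫ z, exp (1 / a * |Y z|) ∂Q
        ≤ ∫ z, (1 / 2 * exp (-f z) + 1 / 2 * exp ((f + fun z => m / (2 * u) * |Y z|) z)) ∂Q := by
          refine integral_mono (Continuous.integrable_of_ae_norm_le hQ (by fun_prop))
            ((i1.const_mul _).add (i2.const_mul _)) fun z => ?_
          have := convexOn_exp.2 (Set.mem_univ (-f z))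
            (Set.mem_univ ((f + fun z => m / (2 * u) * |Y z|) z))
            (by norm_num : (0 : ℝ) ≤ 1 / 2) (by norm_num : (0 : ℝ) ≤ 1 / 2) (by norm_num)
          simp only [smul_eq_mul] at this
          refine le_trans (le_of_eq ?_) this
          congr 1
          simp only [Pi.add_apply, ha]
          field_simp
          ring
      _ ≤ _ := by
          rw [integral_add (i1.const_mul _) (i2.const_mul _), integral_const_mul,
            integral_const_mul, hLnf]
          linarith
  set q := m * j with hq
  have hq1 : 1 ≤ q := Nat.one_le_iff_ne_zero.2 (by positivity)
  have hq0 : (0 : ℝ) < q := by positivity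
  have hup2 : ∫ z, Y z ^ (2 * q) ∂Q ≤ (2 * q * a * 8) ^ (2 * q) := by
    have h1 : ∫ z, Y z ^ (2 * q) ∂Q ≤
        ∫ z, a ^ (2 * q) * (2 * q).factorial * exp (1 / a * |Y z|) ∂Q :=
      integral_mono (Continuous.integrable_of_ae_norm_le hQ (by fun_prop))
        (Continuous.integrable_of_ae_norm_le hQ (by fun_prop))
        fun z => pow_mul_factorial_exp_ge ha0 q
    rw [integral_const_mul] at h1
    have hmq : (m : ℝ) ≤ q := by exact_mod_cast Nat.le_mul_of_pos_right m hj
    have h2 : 1 / 2 * L ^ 2 * (1 + 2 * exp (m / 2)) ≤ 64 ^ q := by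
      have h3 : L ^ 2 ≤ exp (2 * q) := by
        calc L ^ 2 ≤ exp P ^ 2 := by gcongr
          _ = exp (2 * P) := by rw [← exp_nat_mul]; norm_cast
          _ ≤ _ := by
            gcongr
            rw [hq]; push_cast; exact hPm
      have h4 : 1 / 2 * (1 + 2 * exp (m / 2)) ≤ exp (q : ℝ) := by
        have h5 : 1 ≤ exp ((m : ℝ) / 2) := one_le_exp (by positivity)
        have h6 : 3 / 2 ≤ exp ((m : ℝ) / 2) := by
          have h7 := add_one_le_exp ((m : ℝ) / 2)
          have h8 : (1 : ℝ) ≤ m := by exact_mod_cast hm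
          linarith
        have h7 : exp (m : ℝ) = exp ((m : ℝ) / 2) * exp ((m : ℝ) / 2) := by
          rw [← exp_add]; ring_nf
        have h8 : exp (m : ℝ) ≤ exp (q : ℝ) := by gcongr
        nlinarith
      calc 1 / 2 * L ^ 2 * (1 + 2 * exp (m / 2))
          = L ^ 2 * (1 / 2 * (1 + 2 * exp (m / 2))) := by ring
        _ ≤ exp (2 * q) * exp (q : ℝ) := by gcongr
        _ = (exp 1 ^ 3) ^ q := by
          rw [← exp_add, ← exp_nat_mul, ← exp_nat_mul]; congr 1; push_cast; ring
        _ ≤ 64 ^ q := by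
          gcongr
          have := exp_one_lt_d9
          calc exp 1 ^ 3 ≤ 4 ^ 3 := by gcongr; linarith
            _ = 64 := by norm_num
    have h3 : ((2 * q).factorial : ℝ) ≤ (2 * q) ^ (2 * q) := by
      exact_mod_cast Nat.factorial_le_pow (2 * q)
    calc _ ≤ a ^ (2 * q) * (2 * q).factorial * (1 / 2 * L ^ 2 * (1 + 2 * exp (m / 2))) :=
          h1.trans (by gcongr)
      _ ≤ a ^ (2 * q) * (2 * q) ^ (2 * q) * 64 ^ q := by gcongr
      _ = _ := by
        rw [mul_pow _ (8 : ℝ), mul_pow _ a, pow_mul (8 : ℝ)]; norm_num; ring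
  have hlo2 : (√m * α / 12) ^ (2 * q) ≤ ∫ z, Y z ^ (2 * q) ∂Q := by
    have h1 := (hlo t ht).trans (integral_inner_pow_le_prod hR hsymm v m)
    have h2 := (convexOn_pow (𝕜 := ℝ) j).map_integral_le (μ := Q) (f := fun z => Y z ^ (2 * m))
      (by fun_prop) isClosed_Ici
      (.of_forall fun z => by simp only [Set.mem_Ici]; rw [pow_mul]; positivity)
      (Continuous.integrable_of_ae_norm_le hQ (by fun_prop))
      (Continuous.integrable_of_ae_norm_le hQ (by simp only [Function.comp_def]; fun_prop))
    simp only [← pow_mul] at h2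
    rw [hq, ← mul_assoc, pow_mul (√m * α / 12)]
    refine le_trans ?_ h2
    gcongr
  have hfin := le_of_pow_le_pow_left₀ (by omega) (by positivity) (hlo2.trans hup2)
  have hsm : 0 < √(m : ℝ) := by positivity
  have h3 : 2 * q * a * 8 = √m * (3146112 * j * l) := by
    rw [ha, hu, hr, hq]; push_cast; field_simp; ring
  rw [h3, mul_div_assoc] at hfin
  have := le_of_mul_le_mul_left hfin hsm
  linarith

end TiltedVariance

lemma LinearMap.IsSymmetric.pow_le_det {E : Type*} [NormedAddCommGroup E] [InnerProductSpace ℝ E]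
    [FiniteDimensional ℝ E] {T : E →ₗ[ℝ] E} (hT : T.IsSymmetric) {n : ℕ}
    (hn : Module.finrank ℝ E = n) {c : ℝ} (hc : 0 < c)
    (h : ∀ (F : Submodule ℝ E) (l : ℝ), 1 ≤ Module.finrank ℝ F → 0 < l →
      (∀ θ ∈ F, ⟪T θ, θ⟫ ≤ l ^ 2 * ‖θ‖ ^ 2) → c * Module.finrank ℝ F / n ≤ l) :
    (c / exp 1) ^ (2 * n) ≤ LinearMap.det T := by
  have heig : ∀ i : Fin n, (c * ((n - i : ℕ) : ℝ) / n) ^ 2 ≤ hT.eigenvalues hn i := by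
    intro i
    have hn0 : 0 < n := i.pos
    by_contra! hlt
    set b := c * ((n - i : ℕ) : ℝ) / n with hb
    have hb0 : 0 < b := by
      have : 0 < n - (i : ℕ) := by omega
      positivity
    set e := hT.eigenvalues hn i with he
    set l := √((max e 0 + b ^ 2) / 2) with hl
    have hmax : max e 0 < b ^ 2 := max_lt hlt (by positivity)
    have hm0 : 0 ≤ max e 0 := le_max_right _ _
    have hl2 : l ^ 2 = (max e 0 + b ^ 2) / 2 := sq_sqrt (by positivity)
    have hl0 : 0 < l := by positivity
    have hlb : l < b := by
      refine lt_of_pow_lt_pow_left₀ 2 hb0.le ?_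
      rw [hl2]; linarith
    set B := hT.eigenvectorBasis hn with hB
    set F := Submodule.span ℝ (Set.range (B ∘ ((↑) : Set.Ici i → Fin n))) with hF
    have hFr : Module.finrank ℝ F = n - i := by
      rw [hF, finrank_span_eq_card (B.orthonormal.linearIndependent.comp _ Subtype.val_injective)]
      rw [Fintype.card_of_subtype (Finset.Ici i) (by simp), Fin.card_Ici]
    have := h F l (by omega) hl0 fun θ hθ => ?_
    · rw [hFr] at this
      exact absurd this (not_le.2 hlb)
    · have h0 : ∀ j : Fin n, j < i → ⟪B j, θ⟫ = 0 := by
        intro j hj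
        refine Submodule.span_induction (p := fun θ _ => ⟪B j, θ⟫ = 0) ?_ ?_ ?_ ?_ hθ
        · rintro _ ⟨k, rfl⟩
          exact B.inner_eq_zero (by have := k.2; rw [Set.mem_Ici] at this; exact (hj.trans_le this).ne)
        · simp
        · intro x y _ _ hx hy; rw [inner_add_right, hx, hy, add_zero]
        · intro a x _ hx; rw [real_inner_smul_right, hx, mul_zero]
      rw [← B.sum_inner_mul_inner, ← B.sum_sq_inner_right θ, Finset.mul_sum]
      refine Finset.sum_le_sum fun j _ => ?_
      have h1 : ⟪T θ, B j⟫ = hT.eigenvalues hn j * ⟪B j, θ⟫ := by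
        rw [hT, hT.apply_eigenvectorBasis, real_inner_comm]
        simp [real_inner_smul_left, hB]
      rw [h1]
      rcases lt_or_ge j i with hj | hj
      · rw [h0 j hj]; simp
      · have h2 : hT.eigenvalues hn j ≤ l ^ 2 := by
          refine (hT.eigenvalues_antitone hn hj).trans ?_
          rw [hl2]
          have := le_max_left e 0
          linarith
        rw [mul_assoc, ← sq]
        gcongr
  rw [hT.det_eq_prod_eigenvalues hn]
  calc (c / exp 1) ^ (2 * n) ≤ ∏ i : Fin n, (c * ((n - i : ℕ) : ℝ) / n) ^ 2 := by
        rw [Finset.prod_pow, mul_comm 2 n, pow_mul]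
        refine pow_le_pow_left₀ (by positivity) ?_ 2
        rcases Nat.eq_zero_or_pos n with rfl | hn0
        · simp
        rw [Finset.prod_div_distrib, Finset.prod_mul_distrib]
        simp only [Finset.prod_const, Finset.card_univ, Fintype.card_fin]
        have h1 : ∏ i : Fin n, ((n - i : ℕ) : ℝ) = n.factorial := by
          rw [← Nat.cast_prod, Fin.prod_univ_eq_prod_range (fun i => n - i) n]
          congr 1
          rw [← Nat.descFactorial_eq_prod_range, Nat.descFactorial_self]
        rw [h1, div_pow, mul_div_assoc, div_eq_mul_inv]
        gcongr
        have h2 := Real.pow_div_factorial_le_exp (n : ℝ) (by positivity) n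
        rw [← exp_one_pow, div_le_iff₀ (by positivity)] at h2
        rw [inv_le_iff_one_le_mul₀ (by positivity), div_mul_eq_mul_div, one_le_div (by positivity)]
        linarith
    _ ≤ ∏ i : Fin n, hT.eigenvalues hn i := Finset.prod_le_prod (fun i _ => by positivity)
        fun i _ => heig i

section LogLaplace

variable {E : Type*} [NormedAddCommGroup E] [InnerProductSpace ℝ E]
  [FiniteDimensional ℝ E] [MeasurableSpace E] [BorelSpace E] {μ : Measure E}

lemma hasFDerivAt_integral_exp_inner_smul [IsFiniteMeasure μ] {F : Type*} [NormedAddCommGroup F]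
    [NormedSpace ℝ F] {R : ℝ} (hR : ∀ᵐ x ∂μ, ‖x‖ ≤ R) {G : E → F}
    (hG : Continuous G) (ξ : E) :
    HasFDerivAt (fun ξ : E => ∫ x, exp ⟪ξ, x⟫ • G x ∂μ)
      (∫ x, (exp ⟪ξ, x⟫ • innerSL ℝ x).smulRight (G x) ∂μ) ξ := by
  have := FiniteDimensional.proper ℝ E
  refine hasFDerivAt_integral_of_dominated_of_fderiv_le (Metric.ball_mem_nhds ξ one_pos)
    (F := fun ξ x => exp ⟪ξ, x⟫ • G x)
    (F' := fun ξ x => (exp ⟪ξ, x⟫ • innerSL ℝ x).smulRight (G x))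
    (bound := fun x => exp ((‖ξ‖ + 1) * ‖x‖) * ‖x‖ * ‖G x‖)
    (.of_forall fun ζ => Continuous.aestronglyMeasurable (by fun_prop))
    (Continuous.integrable_of_ae_norm_le hR (by fun_prop))
    (Continuous.aestronglyMeasurable (by fun_prop)) (.of_forall fun x ζ hζ => ?_)
    (Continuous.integrable_of_ae_norm_le hR (by fun_prop)) (.of_forall fun x ζ _ => ?_)
  · rw [ContinuousLinearMap.norm_smulRight_apply, norm_smul, innerSL_apply_norm,
      norm_of_nonneg (exp_pos _).le]
    gcongr
    refine (real_inner_le_norm _ _).trans ?_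
    gcongr
    rw [mem_ball_iff_norm] at hζ
    have := norm_sub_norm_le ζ ξ
    linarith
  · have h1 : HasFDerivAt (fun ζ : E => ⟪ζ, x⟫) (innerSL ℝ x) ζ := by
      refine (innerSL ℝ x).hasFDerivAt.congr_of_eventuallyEq (.of_forall fun y => ?_)
      simp [real_inner_comm]
    exact h1.exp.smul_const (G x)

lemma exists_hasFDerivAt_integral_tilted [IsProbabilityMeasure μ] {R : ℝ}
    (hR : ∀ᵐ x ∂μ, ‖x‖ ≤ R) (ξ : E) :
    ∃ A : E →L[ℝ] E, HasFDerivAt (fun ξ : E => ∫ x, x ∂μ.tilted fun x => ⟪ξ, x⟫) A ξ ∧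
      ∀ η θ, ⟪A η, θ⟫ = (∫ x, ⟪x, η⟫ * ⟪x, θ⟫ ∂μ.tilted fun x => ⟪ξ, x⟫) -
        (∫ x, ⟪x, η⟫ ∂μ.tilted fun x => ⟪ξ, x⟫) * ∫ x, ⟪x, θ⟫ ∂μ.tilted fun x => ⟪ξ, x⟫ := by
  have := FiniteDimensional.proper ℝ E
  have hint : ∀ ξ : E, Integrable (fun x => exp ⟪ξ, x⟫) μ := fun ξ =>
    Continuous.integrable_of_ae_norm_le hR (by fun_prop)
  set Z : E → ℝ := fun ξ => ∫ x, exp ⟪ξ, x⟫ ∂μ with hZ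
  have hZ0 : ∀ ξ, 0 < Z ξ := fun ξ => integral_exp_pos (hint ξ)
  have hmean : (fun ξ : E => ∫ x, x ∂μ.tilted fun x => ⟪ξ, x⟫) =
      fun ξ => (Z ξ)⁻¹ • ∫ x, exp ⟪ξ, x⟫ • x ∂μ := by
    ext1 ζ
    rw [integral_tilted, ← integral_smul]
    simp [smul_smul, hZ, div_eq_inv_mul]
  have hZd := hasFDerivAt_integral_exp_inner_smul hR (G := fun _ : E => (1 : ℝ)) (by fun_prop) ξ
  have hNd := hasFDerivAt_integral_exp_inner_smul hR (G := fun x : E => x) (by fun_prop) ξ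
  simp only [smul_eq_mul, mul_one] at hZd
  have htil : ∀ g : E → ℝ, ∫ x, g x ∂(μ.tilted fun x => ⟪ξ, x⟫) =
      (Z ξ)⁻¹ * ∫ x, exp ⟪ξ, x⟫ * g x ∂μ := by
    intro g
    rw [integral_tilted, ← integral_const_mul]
    congr 1 with x
    rw [smul_eq_mul, hZ]; ring
  have hinv := (hasDerivAt_inv (hZ0 ξ).ne').comp_hasFDerivAt ξ hZd
  have hd := hinv.smul hNd
  refine ⟨_, by rw [hmean]; exact hd, fun η θ => ?_⟩
  have i1 : Integrable (fun x : E => (exp ⟪ξ, x⟫ • innerSL ℝ x).smulRight x) μ :=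
    Continuous.integrable_of_ae_norm_le hR (by fun_prop)
  have i2 : Integrable (fun x : E => (exp ⟪ξ, x⟫ • innerSL ℝ x).smulRight (1 : ℝ)) μ :=
    Continuous.integrable_of_ae_norm_le hR (by fun_prop)
  have i3 : Integrable (fun x : E => exp ⟪ξ, x⟫ • x) μ :=
    Continuous.integrable_of_ae_norm_le hR (by fun_prop)
  have i4 : Integrable (fun x : E => (exp ⟪ξ, x⟫ * ⟪x, η⟫) • x) μ :=
    Continuous.integrable_of_ae_norm_le hR (by fun_prop)
  simp only [add_apply, smul_apply,
    ContinuousLinearMap.smulRight_apply, ContinuousLinearMap.integral_apply i1,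
    ContinuousLinearMap.integral_apply i2, inner_add_left, real_inner_smul_left, smul_eq_mul,
    innerSL_apply_apply, mul_one, Function.comp_apply]
  rw [real_inner_comm, ← integral_inner i4, real_inner_comm θ, ← integral_inner i3, htil, htil, htil]
  simp only [real_inner_smul_right]
  have hcomm : ∀ x, ⟪θ, x⟫ = ⟪x, θ⟫ := fun x => real_inner_comm x θ
  simp only [hcomm, ← mul_assoc]
  have := (hZ0 ξ).ne'
  field_simp
  ring

lemma tilted_prod_inner_add [IsProbabilityMeasure μ] (ξ : E) :
    (μ.prod μ).tilted (fun z : E × E => ⟪ξ, z.1 + z.2⟫) =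
      (μ.tilted fun x => ⟪ξ, x⟫).prod (μ.tilted fun x => ⟪ξ, x⟫) := by
  have := FiniteDimensional.proper ℝ E
  rw [Measure.tilted, Measure.tilted, prod_withDensity (by fun_prop) (by fun_prop)]
  congr 1
  ext z
  have h1 : ∀ z : E × E, exp ⟪ξ, z.1 + z.2⟫ = exp ⟪ξ, z.1⟫ * exp ⟪ξ, z.2⟫ := fun z => by
    rw [← exp_add, inner_add_right]
  simp_rw [h1]
  rw [integral_prod_mul (fun x : E => exp ⟪ξ, x⟫) (fun x : E => exp ⟪ξ, x⟫),
    ← ENNReal.ofReal_mul (by positivity), mul_div_mul_comm]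

lemma integral_tilted_prod_inner_sub_sq [IsProbabilityMeasure μ] {R : ℝ}
    (hR : ∀ᵐ x ∂μ, ‖x‖ ≤ R) (ξ θ : E) :
    ∫ z : E × E, ⟪z.1 - z.2, θ⟫ ^ 2 ∂(μ.prod μ).tilted (fun z : E × E => ⟪ξ, z.1 + z.2⟫) =
      2 * ((∫ x, ⟪x, θ⟫ * ⟪x, θ⟫ ∂μ.tilted fun x => ⟪ξ, x⟫) -
        (∫ x, ⟪x, θ⟫ ∂μ.tilted fun x => ⟪ξ, x⟫) * ∫ x, ⟪x, θ⟫ ∂μ.tilted fun x => ⟪ξ, x⟫) := by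
  have := FiniteDimensional.proper ℝ E
  rw [tilted_prod_inner_add]
  set κ := μ.tilted fun x => ⟪ξ, x⟫ with hκ
  have : IsProbabilityMeasure κ := isProbabilityMeasure_tilted
    (Continuous.integrable_of_ae_norm_le hR (by fun_prop))
  have hκR : ∀ᵐ x ∂κ, ‖x‖ ≤ R := (tilted_absolutelyContinuous μ _).ae_le hR
  have hQ := ae_prod_norm_le hκR
  have h1 : ∀ z : E × E, ⟪z.1 - z.2, θ⟫ ^ 2 = ⟪z.1, θ⟫ * ⟪z.1, θ⟫ + ⟪z.2, θ⟫ * ⟪z.2, θ⟫ -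
      2 * (⟪z.1, θ⟫ * ⟪z.2, θ⟫) := fun z => by rw [inner_sub_left]; ring
  simp_rw [h1]
  rw [integral_sub (Continuous.integrable_of_ae_norm_le hQ (by fun_prop))
    (Continuous.integrable_of_ae_norm_le hQ (by fun_prop)),
    integral_add (Continuous.integrable_of_ae_norm_le hQ (by fun_prop))
    (Continuous.integrable_of_ae_norm_le hQ (by fun_prop)), integral_const_mul,
    integral_prod_mul (fun x : E => ⟪x, θ⟫) (fun x : E => ⟪x, θ⟫),
    integral_fun_fst (fun x : E => ⟪x, θ⟫ * ⟪x, θ⟫), integral_fun_snd (fun x : E => ⟪x, θ⟫ * ⟪x, θ⟫)]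
  simp
  ring

end LogLaplace

section CondVolume

variable {n : ℕ} {K : Set (EuclideanSpace ℝ (Fin n))}

lemma logConc_cond_prod_tilted (hKc : Convex ℝ K) (hK : IsCompact K) (hK0 : volume K ≠ 0)
    (ξ : EuclideanSpace ℝ (Fin n)) :
    LogConc (((ProbabilityTheory.cond volume K).prod (ProbabilityTheory.cond volume K)).tilted
      fun z : EuclideanSpace ℝ (Fin n) × EuclideanSpace ℝ (Fin n) => ⟪ξ, z.1 + z.2⟫) := by
  have hKt : volume K ≠ ∞ := hK.measure_lt_top.ne
  have : IsProbabilityMeasure (ProbabilityTheory.cond volume K) :=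
    ProbabilityTheory.cond_isProbabilityMeasure_of_finite hK0 hKt
  obtain ⟨R, hR⟩ := hK.isBounded.exists_norm_le
  have hR' : ∀ᵐ x ∂ProbabilityTheory.cond volume K, ‖x‖ ≤ R := by
    filter_upwards [ProbabilityTheory.ae_cond_mem hK.measurableSet] with x hx using hR x hx
  set f : EuclideanSpace ℝ (Fin n) × EuclideanSpace ℝ (Fin n) → ℝ := fun z => ⟪ξ, z.1 + z.2⟫ with hf
  set Z := ∫ z, exp (f z) ∂(ProbabilityTheory.cond volume K).prod (ProbabilityTheory.cond volume K)
    with hZ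
  have hZ0 : 0 < Z := integral_exp_pos
    (Continuous.integrable_of_ae_norm_le (ae_prod_norm_le hR') (by fun_prop))
  have h1 := ((prekopaLeindler_euclideanSpace n).prod
    (prekopaLeindler_euclideanSpace n)).logConc_restrict_tilt (hK.measurableSet.prod hK.measurableSet)
    (hKc.prod hKc) (φ := f) (by fun_prop) (fun a b x y => by
      simp only [hf, inner_add_right, Prod.fst_add, Prod.snd_add, Prod.smul_fst, Prod.smul_snd,
        real_inner_smul_right, smul_eq_mul]; ring)
  have hi0 : (volume K)⁻¹ ≠ 0 := ENNReal.inv_ne_zero.2 hKt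
  have hit : (volume K)⁻¹ ≠ ∞ := ENNReal.inv_ne_top.2 hK0
  have h2 : ((ProbabilityTheory.cond volume K).prod (ProbabilityTheory.cond volume K)).tilted f =
      ENNReal.ofReal Z⁻¹ • (volume K)⁻¹ • (volume K)⁻¹ •
        (((volume.prod volume).restrict (K ×ˢ K)).withDensity fun x => ENNReal.ofReal (exp (f x))) := by
    rw [← withDensity_smul_measure, ← withDensity_smul_measure, ← Measure.prod_restrict,
      ← Measure.prod_smul_left, ← Measure.prod_smul_right, ← withDensity_smul _ (by fun_prop),
      Measure.tilted]
    congr 1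
    ext z
    rw [Pi.smul_apply, smul_eq_mul, ← ENNReal.ofReal_mul (by positivity), hZ]
    congr 1
    rw [div_eq_inv_mul]
  rw [h2]
  exact ((h1.smul hi0 hit).smul hi0 hit).smul (by simpa using hZ0) ENNReal.ofReal_ne_top

end CondVolume

lemma stdGaussian_le_volume {E : Type*} [NormedAddCommGroup E] [InnerProductSpace ℝ E]
    [FiniteDimensional ℝ E] [MeasurableSpace E] [BorelSpace E] {S : Set E} (hS : MeasurableSet S) :
    ProbabilityTheory.stdGaussian E S ≤
      ENNReal.ofReal ((2 * π) ^ (-(Module.finrank ℝ E : ℝ) / 2)) * volume S := by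
  rw [stdGaussian_eq_withDensity, withDensity_apply _ hS, ← setLIntegral_const]
  refine lintegral_mono fun x => ENNReal.ofReal_le_ofReal ?_
  refine mul_le_of_le_one_right (by positivity) (exp_le_one_iff.2 ?_)
  have := sq_nonneg ‖x‖
  linarith

lemma lintegral_exp_inner_stdGaussian {E : Type*} [NormedAddCommGroup E] [InnerProductSpace ℝ E]
    [FiniteDimensional ℝ E] [MeasurableSpace E] [BorelSpace E] (v : E) :
    ∫⁻ g, ENNReal.ofReal (exp ⟪v, g⟫) ∂ProbabilityTheory.stdGaussian E =
      ENNReal.ofReal (exp (‖v‖ ^ 2 / 2)) := by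
  have := FiniteDimensional.proper ℝ E
  have h1 : ∫⁻ g, ENNReal.ofReal (exp ⟪v, g⟫) ∂ProbabilityTheory.stdGaussian E =
      ∫⁻ y, ENNReal.ofReal (exp y) ∂(ProbabilityTheory.stdGaussian E).map (fun x => ⟪v, x⟫) := by
    rw [lintegral_map (by fun_prop) (by fun_prop)]
  rw [h1, stdGaussian_map_inner, lintegral_map (by fun_prop) (by fun_prop)]
  have h2 := ProbabilityTheory.integrable_exp_mul_gaussianReal (μ := 0) (v := 1) ‖v‖
  rw [← ofReal_integral_eq_lintegral_ofReal h2 (.of_forall fun x => (exp_pos _).le)]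
  congr 1
  have h3 := ProbabilityTheory.mgf_gaussianReal (p := ProbabilityTheory.gaussianReal 0 1)
    (X := id) (μ := 0) (v := 1) (by simp) ‖v‖
  simp only [ProbabilityTheory.mgf, id] at h3
  rw [h3]; simp

lemma le_volume_setOf_laplace_le {E : Type*} [NormedAddCommGroup E] [InnerProductSpace ℝ E]
    [FiniteDimensional ℝ E] [MeasurableSpace E] [BorelSpace E] {n : ℕ}
    (hn : Module.finrank ℝ E = n) (hn1 : 1 ≤ n) {μ : Measure E} [IsProbabilityMeasure μ] {R s : ℝ} (hR : ∀ᵐ x ∂μ, ‖x‖ ≤ R) (hs : 0 < s) :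
    ENNReal.ofReal (s ^ n) ≤
      volume {ξ | ∫ x, exp ⟪ξ, x⟫ ∂μ ≤ 2 * exp (s ^ 2 * R ^ 2 / 2)} := by
  have := FiniteDimensional.proper ℝ E
  set Z : E → ℝ := fun ξ => ∫ x, exp ⟪ξ, x⟫ ∂μ with hZ
  set B := exp (s ^ 2 * R ^ 2 / 2) with hB
  have hZc : Continuous Z := by
    refine continuous_iff_continuousAt.2 fun ξ => ?_
    have := (hasFDerivAt_integral_exp_inner_smul hR (G := fun _ : E => (1 : ℝ)) (by fun_prop)
      ξ).continuousAt
    simpa using! this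
  have hint : ∀ ξ : E, Integrable (fun x => exp ⟪ξ, x⟫) μ := fun ξ =>
    Continuous.integrable_of_ae_norm_le hR (by fun_prop)
  set γ := ProbabilityTheory.stdGaussian E with hγ
  have hav : ∫⁻ g, ENNReal.ofReal (Z (s • g)) ∂γ ≤ ENNReal.ofReal B := by
    have h1 : ∀ g, ENNReal.ofReal (Z (s • g)) = ∫⁻ x, ENNReal.ofReal (exp ⟪s • x, g⟫) ∂μ := by
      intro g
      rw [hZ, ofReal_integral_eq_lintegral_ofReal (hint _) (.of_forall fun x => (exp_pos _).le)]
      have h2 : ∀ x, ⟪s • g, x⟫ = ⟪s • x, g⟫ := fun x => by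
        rw [real_inner_smul_left, real_inner_smul_left, real_inner_comm]
      simp_rw [h2]
    simp_rw [h1]
    rw [lintegral_lintegral_swap (by fun_prop)]
    simp_rw [hγ, lintegral_exp_inner_stdGaussian]
    calc _ ≤ ∫⁻ x, ENNReal.ofReal B ∂μ := by
          refine lintegral_mono_ae ?_
          filter_upwards [hR] with x hx
          refine ENNReal.ofReal_le_ofReal (exp_le_exp.2 ?_)
          rw [norm_smul, norm_of_nonneg hs.le, mul_pow]
          gcongr
      _ = _ := by simp
  set S : Set E := {g | Z (s • g) ≤ 2 * B} with hS
  have hSm : MeasurableSet S := measurableSet_le (by fun_prop) (by fun_prop)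
  have hB0 : 0 < B := exp_pos _
  have hSc : γ.real Sᶜ ≤ 1 / 2 := by
    have h1 := mul_meas_ge_le_lintegral₀ (μ := γ) (f := fun g => ENNReal.ofReal (Z (s • g)))
      (by fun_prop) (ENNReal.ofReal (2 * B))
    have h2 : γ Sᶜ ≤ γ {g | ENNReal.ofReal (2 * B) ≤ ENNReal.ofReal (Z (s • g))} := by
      refine measure_mono fun g hg => ?_
      have hg' : 2 * B < Z (s • g) := not_le.1 hg
      exact ENNReal.ofReal_le_ofReal hg'.le
    have h3 : ENNReal.ofReal (2 * B) * γ Sᶜ ≤ ENNReal.ofReal B := by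
      calc _ ≤ _ := by gcongr
        _ ≤ _ := h1.trans hav
    have h4 := ENNReal.toReal_mono ENNReal.ofReal_ne_top h3
    rw [ENNReal.toReal_mul, ENNReal.toReal_ofReal (by positivity), ENNReal.toReal_ofReal hB0.le] at h4
    refine le_of_mul_le_mul_left (a := 2 * B) ?_ (by positivity)
    calc _ ≤ B := h4
      _ = _ := by ring
  have hSg : ENNReal.ofReal (1 / 2) ≤ γ S := by
    rw [measureReal_compl hSm, probReal_univ] at hSc
    rw [← ofReal_measureReal]
    exact ENNReal.ofReal_le_ofReal (by linarith)
  have hvS : ENNReal.ofReal 1 ≤ volume S := by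
    have h1 := hSg.trans (stdGaussian_le_volume hSm)
    have h2 : (2 * π) ^ (-(Module.finrank ℝ E : ℝ) / 2) ≤ 1 / 2 := by
      have hn1' : (1 : ℝ) ≤ n := by exact_mod_cast hn1
      have hπ := pi_gt_three
      calc (2 * π) ^ (-(Module.finrank ℝ E : ℝ) / 2) ≤ (2 * π) ^ (-1 / 2 : ℝ) := by
            refine rpow_le_rpow_of_exponent_le (by linarith) ?_
            rw [hn]; linarith
        _ ≤ (2 ^ (2 : ℝ)) ^ (-1 / 2 : ℝ) := by
            refine rpow_le_rpow_of_nonpos (by positivity) ?_ (by norm_num)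
            norm_num; linarith
        _ = 1 / 2 := by rw [← rpow_mul (by norm_num)]; norm_num [rpow_neg_one]
    have h3 : ENNReal.ofReal (1 / 2) * 1 ≤ ENNReal.ofReal (1 / 2) * volume S := by
      rw [mul_one]
      exact h1.trans (by gcongr)
    rw [ENNReal.ofReal_one]
    exact (ENNReal.mul_le_mul_iff_right (by simp) (by simp)).1 h3
  have hsub : s • S ⊆ {ξ | Z ξ ≤ 2 * B} := by
    rintro _ ⟨g, hg, rfl⟩
    exact hg
  refine le_trans ?_ (measure_mono hsub)
  rw [Measure.addHaar_smul, hn, abs_of_pos (by positivity)]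
  calc ENNReal.ofReal (s ^ n) = ENNReal.ofReal (s ^ n) * ENNReal.ofReal 1 := by simp
    _ ≤ _ := by gcongr

lemma exists_nat_le_mul {k n : ℕ} {ρ R₀ : ℝ} (hk : 1 ≤ k) (hkn : k ≤ n) (hρ : 0 < ρ) :
    ∃ m j : ℕ, 1 ≤ m ∧ 1 ≤ j ∧ (m = 1 ∨ 66048 * ρ ^ 2 * m ≤ k) ∧
      log 2 + R₀ ^ 2 * n / (2 * ρ ^ 2) ≤ m * j ∧ (j : ℝ) ≤ (2 + 66048 * R₀ ^ 2) * n / k := by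
  have hk0 : (0 : ℝ) < k := by positivity
  have hkn' : (k : ℝ) ≤ n := by exact_mod_cast hkn
  set b : ℝ := k / (66048 * ρ ^ 2) with hb
  have hb0 : 0 < b := by positivity
  obtain ⟨m, hm1, hmk, hmb⟩ : ∃ m : ℕ, 1 ≤ m ∧ (m = 1 ∨ 66048 * ρ ^ 2 * m ≤ k) ∧ b / 2 ≤ m := by
    rcases lt_or_ge b 1 with h | h
    · exact ⟨1, le_rfl, Or.inl rfl, by push_cast; linarith⟩
    · refine ⟨⌊b⌋₊, Nat.one_le_floor_iff _ |>.2 h, Or.inr ?_, ?_⟩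
      · have := Nat.floor_le hb0.le
        rw [hb, le_div_iff₀ (by positivity)] at this
        rw [hb]; linarith
      · have h1 := Nat.lt_floor_add_one b
        have h2 : (1 : ℝ) ≤ ⌊b⌋₊ := by exact_mod_cast (Nat.one_le_floor_iff _).2 h
        linarith
  have hm0 : (0 : ℝ) < m := by positivity
  set P := log 2 + R₀ ^ 2 * n / (2 * ρ ^ 2) with hP
  have hlog : 0 < log 2 := log_pos (by norm_num)
  have hlog1 : log 2 ≤ 1 := by have := log_two_lt_d9; linarith
  have hP0 : 0 < P := by positivity
  refine ⟨m, ⌈P / m⌉₊, hm1, Nat.one_le_ceil_iff.2 (by positivity), hmk, ?_, ?_⟩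
  · have := Nat.le_ceil (P / m)
    rw [div_le_iff₀ hm0] at this
    linarith
  · have h1 := (Nat.ceil_lt_add_one (by positivity : 0 ≤ P / m)).le
    have h2 : P / m ≤ 1 + 66048 * R₀ ^ 2 * n / k := by
      rw [hP, add_div]
      have hm1' : (1 : ℝ) ≤ m := by exact_mod_cast hm1
      have h3 : log 2 / m ≤ 1 := by rw [div_le_one hm0]; linarith
      have h4 : R₀ ^ 2 * n / (2 * ρ ^ 2) / m ≤ R₀ ^ 2 * n / (2 * ρ ^ 2) / (b / 2) := by gcongr
      have h5 : R₀ ^ 2 * n / (2 * ρ ^ 2) / (b / 2) = 66048 * R₀ ^ 2 * n / k := by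
        rw [hb]; field_simp
      linarith
    have h3 : 1 ≤ (n : ℝ) / k := by rwa [one_le_div hk0]
    have h4 : (2 + 66048 * R₀ ^ 2) * n / k = 2 * (n / k) + 66048 * R₀ ^ 2 * n / k := by ring
    linarith

lemma le_of_moment_bounds {n : ℕ} (hn : 1 ≤ n) {K : Set (EuclideanSpace ℝ (Fin n))}
    (hKc : Convex ℝ K) (hK : IsCompact K) (hKs : K = -K) (hK0 : volume K ≠ 0) (hK1 : volume K ≤ 1)
    {α ρ R₀ : ℝ} (hα : 0 < α) (hρ : 0 < ρ) (hR : ∀ x ∈ K, ‖x‖ ≤ R₀ * √n * α)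
    (hlow : ∀ θ, α ^ 2 * ‖θ‖ ^ 2 ≤ ∫ x, ⟪x, θ⟫ ^ 2 ∂ProbabilityTheory.cond volume K)
    (hup : ∀ (q : ℕ) θ, 1 ≤ q → ∫ x, ⟪x, θ⟫ ^ (2 * q) ∂ProbabilityTheory.cond volume K
      ≤ 4 * q.factorial * (ρ * α * ‖θ‖) ^ (2 * q)) :
    α ≤ ρ * (37753344 * (2 + 66048 * R₀ ^ 2) * exp 1) ^ 2 := by
  set μ : Measure (EuclideanSpace ℝ (Fin n)) := ProbabilityTheory.cond volume K with hμ
  have hKt : volume K ≠ ∞ := hK.measure_lt_top.ne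
  have : IsProbabilityMeasure μ := ProbabilityTheory.cond_isProbabilityMeasure_of_finite hK0 hKt
  have hR' : ∀ᵐ x ∂μ, ‖x‖ ≤ R₀ * √n * α := by
    filter_upwards [ProbabilityTheory.ae_cond_mem hK.measurableSet] with x hx using hR x hx
  have hsymm : μ.map Neg.neg = μ := by
    have h1 : MeasurePreserving (Neg.neg : EuclideanSpace ℝ (Fin n) → _) (volume.restrict K)
        (volume.restrict K) := by
      have := (Measure.measurePreserving_neg (volume : Measure (EuclideanSpace ℝ (Fin n)))
        ).restrict_preimage hK.measurableSet
      rwa [Set.neg_preimage, ← hKs] at this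
    rw [hμ, ProbabilityTheory.cond, Measure.map_smul, h1.map_eq]
  set C₃ : ℝ := 2 + 66048 * R₀ ^ 2 with hC₃
  have hC₃0 : 0 < C₃ := by positivity
  have hn0 : (0 : ℝ) < n := by positivity
  set s : ℝ := 1 / (ρ * α) with hs
  have hs0 : 0 < s := by positivity
  set c : ℝ := α / (37753344 * C₃) with hc
  have hc0 : 0 < c := by positivity
  set D : Set (EuclideanSpace ℝ (Fin n)) := {ξ | ∫ x, exp ⟪ξ, x⟫ ∂μ ≤ 2 * exp (s ^ 2 * (R₀ * √n * α) ^ 2 / 2)} with hD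
  have hDv := le_volume_setOf_laplace_le (E := EuclideanSpace ℝ (Fin n)) (finrank_euclideanSpace_fin) hn hR' hs0
  choose A hA hAc using exists_hasFDerivAt_integral_tilted hR'
  have hDm : MeasurableSet D := by
    have hZc : Continuous fun ξ : EuclideanSpace ℝ (Fin n) => ∫ x, exp ⟪ξ, x⟫ ∂μ := by
      refine continuous_iff_continuousAt.2 fun ξ => ?_
      have := (hasFDerivAt_integral_exp_inner_smul hR'
        (G := fun _ : EuclideanSpace ℝ (Fin n) => (1 : ℝ)) (by fun_prop) ξ).continuousAt
      simpa using! this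
    exact measurableSet_le hZc.measurable measurable_const
  have hlogc := logConc_cond_prod_tilted hKc hK hK0
  have hvar : ∀ ξ θ, ∫ z : EuclideanSpace ℝ (Fin n) × EuclideanSpace ℝ (Fin n), ⟪z.1 - z.2, θ⟫ ^ 2
      ∂(μ.prod μ).tilted (fun z : EuclideanSpace ℝ (Fin n) × EuclideanSpace ℝ (Fin n) => ⟪ξ, z.1 + z.2⟫) = 2 * ⟪A ξ θ, θ⟫ := fun ξ θ => by
    rw [hAc, integral_tilted_prod_inner_sub_sq hR']
  have hAsymm : ∀ ξ, (A ξ : EuclideanSpace ℝ (Fin n) →ₗ[ℝ] EuclideanSpace ℝ (Fin n)).IsSymmetric := by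
    intro ξ x y
    simp only [ContinuousLinearMap.coe_coe]
    rw [hAc, real_inner_comm, hAc]
    simp only [mul_comm]
  have hpos : ∀ ξ θ, θ ≠ 0 → 0 < ⟪A ξ θ, θ⟫ := by
    intro ξ θ hθ
    by_contra! hneg
    set P := log (∫ x, exp ⟪ξ, x⟫ ∂μ) with hPdef
    have hZ0 : 0 < ∫ x, exp ⟪ξ, x⟫ ∂μ := integral_exp_pos
      (Continuous.integrable_of_ae_norm_le hR' (by fun_prop))
    obtain ⟨j, hjP⟩ := exists_nat_ge (max P 1)
    have hj1 : 1 ≤ j := by exact_mod_cast (le_max_right _ _).trans hjP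
    have hj0 : (0 : ℝ) < j := by positivity
    set l := α / (2 * (37753344 * j)) with hl
    have hl0 : 0 < l := by positivity
    have h1 := le_mul_of_tilted_variance_le hR' hsymm hα hρ hlow hup (hlogc ξ)
      (F := Submodule.span ℝ {θ}) (finrank_span_singleton hθ).ge hl0 (fun η hη => by
        obtain ⟨a, rfl⟩ := Submodule.mem_span_singleton.1 hη
        rw [hvar, map_smul, real_inner_smul_left, real_inner_smul_right]
        have h2 : a * (a * ⟪A ξ θ, θ⟫) ≤ 0 := by
          rw [← mul_assoc]
          exact mul_nonpos_of_nonneg_of_nonpos (mul_self_nonneg a) hneg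
        have h3 : 0 ≤ 2 * l ^ 2 * ‖a • θ‖ ^ 2 := by positivity
        linarith) le_rfl hj1 (Or.inl rfl) (P := P) (by rw [hPdef, exp_log hZ0])
      (by push_cast; rw [one_mul]; exact (le_max_left _ _).trans hjP)
    have h2 : 37753344 * (j : ℝ) * l = α / 2 := by rw [hl]; field_simp
    linarith
  have hinj : Function.Injective fun ξ : EuclideanSpace ℝ (Fin n) => ∫ x, x ∂μ.tilted fun x => ⟪ξ, x⟫ := by
    intro η ξ hηξ
    by_contra hne
    have hne' : ξ - η ≠ 0 := sub_ne_zero.2 (Ne.symm hne)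
    have hd : ∀ t : ℝ, HasDerivAt (fun t : ℝ => ⟪∫ x, x ∂μ.tilted fun x => ⟪η + t • (ξ - η), x⟫, ξ - η⟫)
        ⟪A (η + t • (ξ - η)) (ξ - η), ξ - η⟫ t := by
      intro t
      have h1 : HasDerivAt (fun t : ℝ => η + t • (ξ - η)) (ξ - η) t := by
        simpa using ((hasDerivAt_id t).smul_const (ξ - η)).const_add η
      have h2 := (hA (η + t • (ξ - η))).comp_hasDerivAt t h1
      simpa using h2.inner ℝ (hasDerivAt_const t (ξ - η))
    have hmono := strictMono_of_deriv_pos (fun t => by rw [(hd t).deriv]; exact hpos _ _ hne')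
    have := hmono (zero_lt_one' ℝ)
    simp only [zero_smul, add_zero, one_smul, add_sub_cancel] at this
    have hηξ' : (∫ x, x ∂μ.tilted fun x => ⟪η, x⟫) = ∫ x, x ∂μ.tilted fun x => ⟪ξ, x⟫ := hηξ
    rw [hηξ'] at this
    exact this.false
  have hrange : (fun ξ : EuclideanSpace ℝ (Fin n) => ∫ x, x ∂μ.tilted fun x => ⟪ξ, x⟫) '' D ⊆ K := by
    rintro _ ⟨ξ, _, rfl⟩
    have : IsProbabilityMeasure (μ.tilted fun x => ⟪ξ, x⟫) := isProbabilityMeasure_tilted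
      (Continuous.integrable_of_ae_norm_le hR' (by fun_prop))
    refine hKc.integral_mem hK.isClosed ((tilted_absolutelyContinuous μ _).ae_le
      (ProbabilityTheory.ae_cond_mem hK.measurableSet)) ?_
    exact Continuous.integrable_of_ae_norm_le ((tilted_absolutelyContinuous μ _).ae_le hR')
      (by fun_prop)
  have hdet : ∀ ξ ∈ D, (c / exp 1) ^ (2 * n) ≤ |(A ξ).det| := by
    intro ξ hξ
    refine le_trans ?_ (le_abs_self _)
    refine (hAsymm ξ).pow_le_det finrank_euclideanSpace_fin hc0 fun F l hF hl h => ?_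
    have hFn : Module.finrank ℝ F ≤ n := by
      have := Submodule.finrank_le F
      rwa [finrank_euclideanSpace_fin] at this
    obtain ⟨m, j, hm, hj, hmF, hPm, hjn⟩ := exists_nat_le_mul (R₀ := R₀) hF hFn hρ
    have hF0 : (0 : ℝ) < Module.finrank ℝ F := by positivity
    have h1 := le_mul_of_tilted_variance_le hR' hsymm hα hρ hlow hup (hlogc ξ) hF hl
      (fun θ hθ => by rw [hvar]; have := h θ hθ; simp only [ContinuousLinearMap.coe_coe] at this; linarith) hm hj hmF
      (P := log 2 + R₀ ^ 2 * n / (2 * ρ ^ 2)) (by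
        rw [exp_add, exp_log (by norm_num)]
        refine le_trans hξ (le_of_eq ?_)
        rw [hs, mul_pow, mul_pow, sq_sqrt hn0.le]
        congr 2
        field_simp) hPm
    have h2 : α ≤ 37753344 * (C₃ * n / Module.finrank ℝ F) * l := h1.trans (by gcongr)
    rw [hc, div_le_iff₀ hn0, div_mul_eq_mul_div, div_le_iff₀ (by positivity)]
    calc _ ≤ 37753344 * (C₃ * n / Module.finrank ℝ F) * l * Module.finrank ℝ F := by gcongr
      _ = _ := by field_simp
  have hcv := lintegral_abs_det_fderiv_eq_addHaar_image volume hDm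
    (fun ξ _ => (hA ξ).hasFDerivWithinAt) hinj.injOn
  have h1 : ENNReal.ofReal ((c / exp 1) ^ (2 * n)) * volume D ≤ 1 := by
    calc _ = ∫⁻ ξ in D, ENNReal.ofReal ((c / exp 1) ^ (2 * n)) := by rw [setLIntegral_const]
      _ ≤ ∫⁻ ξ in D, ENNReal.ofReal |(A ξ).det| :=
          setLIntegral_mono' hDm fun ξ hξ => ENNReal.ofReal_le_ofReal (hdet ξ hξ)
      _ = _ := hcv
      _ ≤ volume K := measure_mono hrange
      _ ≤ 1 := hK1
  have h2 : ((c / exp 1) ^ 2 * s) ^ n ≤ 1 := by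
    rw [← ENNReal.ofReal_le_one, mul_pow, ← pow_mul, ENNReal.ofReal_mul (by positivity)]
    refine le_trans ?_ h1
    gcongr
  have h3 := (pow_le_one_iff_of_nonneg (by positivity) (by omega)).1 h2
  rw [hc, hs, div_div, div_pow, div_mul_div_comm, mul_one, div_le_one (by positivity)] at h3
  have h4 : α * α ≤ α * (ρ * (37753344 * C₃ * exp 1) ^ 2) := by
    calc α * α = α ^ 2 := by ring
      _ ≤ _ := h3
      _ = _ := by ring
  exact le_of_mul_le_mul_left h4 hα

lemma Seminorm.exists_le_mul_norm {E : Type*} [NormedAddCommGroup E] [InnerProductSpace ℝ E]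
    [FiniteDimensional ℝ E] (p : Seminorm ℝ E) : ∃ b, 0 ≤ b ∧ ∀ x, p x ≤ b * ‖x‖ := by
  obtain ⟨b, hb, h⟩ := p.bound_of_continuous_normedSpace p.continuous_of_finiteDimensional
  exact ⟨b, hb.le, h⟩

lemma Seminorm.map_integral_le {E : Type*} [NormedAddCommGroup E] [InnerProductSpace ℝ E]
    [FiniteDimensional ℝ E] {Ω : Type*} [MeasurableSpace Ω] (p : Seminorm ℝ E) {μ : Measure Ω}
    [IsProbabilityMeasure μ] {f : Ω → E} (hf : Integrable f μ) :
    p (∫ x, f x ∂μ) ≤ ∫ x, p (f x) ∂μ := by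
  have hc := p.continuous_of_finiteDimensional
  obtain ⟨b, hb0, hb⟩ := p.exists_le_mul_norm
  refine p.convexOn.map_integral_le hc.continuousOn isClosed_univ (by simp) hf ?_
  refine (hf.norm.const_mul b).mono' (hc.comp_aestronglyMeasurable hf.1) (.of_forall fun x => ?_)
  simpa [abs_of_nonneg (apply_nonneg p _)] using hb (f x)

section Polar

variable {E : Type*} [NormedAddCommGroup E] [InnerProductSpace ℝ E] [FiniteDimensional ℝ E]
  [MeasurableSpace E] [BorelSpace E]

lemma Seminorm.integral_mul_fun_norm (p : Seminorm ℝ E) [Nontrivial E] (f : ℝ → ℝ) :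
    ∫ x, p x * f ‖x‖ = (∫ ξ : Metric.sphere (0 : E) 1, p ξ ∂(volume : Measure E).toSphere) *
      ∫ r : Set.Ioi (0 : ℝ), r * f r ∂Measure.volumeIoiPow (Module.finrank ℝ E - 1) := by
  calc ∫ x, p x * f ‖x‖
      = ∫ x : ({(0)}ᶜ : Set E), p x.1 * f (‖x.1‖) ∂((volume : Measure E).comap (↑)) := by
        rw [integral_subtype_comap (measurableSet_singleton _).compl fun x => p x * f (‖x‖),
          restrict_compl_singleton]
    _ = ∫ z, p z.1 * (z.2 * f z.2) ∂(volume : Measure E).toSphere.prod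
          (.volumeIoiPow (Module.finrank ℝ E - 1)) := by
        rw [← (volume : Measure E).measurePreserving_homeomorphUnitSphereProd.integral_comp
          (Homeomorph.measurableEmbedding _)]
        refine integral_congr_ae (.of_forall fun x => ?_)
        have hx : (0 : ℝ) < ‖x.1‖ := norm_pos_iff.2 x.2
        simp only [homeomorphUnitSphereProd_apply_snd_coe, homeomorphUnitSphereProd_apply_fst_coe,
          map_smul_eq_mul, norm_inv, norm_norm]
        field_simp
    _ = _ := integral_prod_mul (L := ℝ) (fun ξ : Metric.sphere (0 : E) 1 => p ξ)
        (fun r : Set.Ioi (0 : ℝ) => (r : ℝ) * f r)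

open ProbabilityTheory in
lemma Seminorm.integral_stdGaussian (p : Seminorm ℝ E) [Nontrivial E] :
    ∫ x, p x ∂stdGaussian E = (⨍ ξ : Metric.sphere (0 : E) 1, p ξ ∂(volume : Measure E).toSphere) *
      ∫ x, ‖x‖ ∂stdGaussian E := by
  have h1 : ∀ q : Seminorm ℝ E, ∫ x, q x ∂stdGaussian E = ∫ x, q x *
      ((2 * π) ^ (-(Module.finrank ℝ E : ℝ) / 2) * exp (-(1 / 2) * ‖x‖ ^ 2)) := by
    intro q
    rw [stdGaussian_eq_withDensity, integral_withDensity_eq_integral_toReal_smul (by fun_prop)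
      (by simp)]
    refine integral_congr_ae (.of_forall fun x => ?_)
    simp only [smul_eq_mul]
    rw [ENNReal.toReal_ofReal (by positivity), mul_comm]
  have h2 := p.integral_mul_fun_norm
    fun r => (2 * π) ^ (-(Module.finrank ℝ E : ℝ) / 2) * exp (-(1 / 2) * r ^ 2)
  have h3 := (normSeminorm ℝ E).integral_mul_fun_norm
    fun r => (2 * π) ^ (-(Module.finrank ℝ E : ℝ) / 2) * exp (-(1 / 2) * r ^ 2)
  have h4 := h1 (normSeminorm ℝ E)
  simp only [coe_normSeminorm] at h3 h4
  rw [h1, h4, h2, h3, average_eq, smul_eq_mul]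
  have h5 : ∀ ξ : Metric.sphere (0 : E) 1, ‖(ξ : E)‖ = 1 := fun ξ => by simp
  have h6 : (volume : Measure E).toSphere.real Set.univ ≠ 0 := by
    rw [measureReal_ne_zero_iff]
    exact fun h => Measure.toSphere_ne_zero (volume : Measure E) (Measure.measure_univ_eq_zero.1 h)
  simp only [h5, integral_const, smul_eq_mul, mul_one]
  rw [mul_mul_mul_comm, inv_mul_cancel₀ h6, one_mul]

open ProbabilityTheory in
lemma integral_norm_stdGaussian_le : ∫ x, ‖x‖ ∂stdGaussian E ≤ √(Module.finrank ℝ E) := by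
  refine le_sqrt_of_sq_le ?_
  have h := ((even_two).convexOn_pow (𝕜 := ℝ)).map_integral_le (μ := stdGaussian E)
    (f := fun x : E => ‖x‖) (by fun_prop) isClosed_univ (by simp)
    (by simpa using integrable_norm_pow_stdGaussian (E := E) 1) (integrable_norm_pow_stdGaussian 2)
  rwa [integral_norm_sq_stdGaussian] at h

end Polar

open ProbabilityTheory in
lemma half_le_integral_abs_gaussianReal : 1 / 2 ≤ ∫ x, |x| ∂gaussianReal 0 1 := by
  have h2 := integral_pow_gaussianReal 1
  have h4 := integral_pow_gaussianReal 2
  norm_num [Nat.doubleFactorial] at h2 h4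
  have hi : ∀ k : ℕ, Integrable (fun x : ℝ => |x| ^ k) (gaussianReal 0 1) := fun k => by
    simpa using (IsGaussian.memLp_id (gaussianReal 0 1) k (by finiteness)).integrable_norm_pow'
  have hi2 : Integrable (fun x : ℝ => x ^ 2) (gaussianReal 0 1) := by simpa using hi 2
  have hi4 : Integrable (fun x : ℝ => x ^ 4) (gaussianReal 0 1) := by
    simpa [Even.pow_abs (by decide : Even 4)] using hi 4
  calc (1 / 2 : ℝ) ≤ ∫ x, (3 / 4 * x ^ 2 - 1 / 16 * x ^ 4) ∂gaussianReal 0 1 := by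
        rw [integral_sub (hi2.const_mul _) (hi4.const_mul _), integral_const_mul,
          integral_const_mul, h2, h4]
        norm_num
    _ ≤ _ := by
        refine integral_mono ((hi2.const_mul _).sub (hi4.const_mul _)) (by simpa using hi 1)
          fun x => ?_
        have h0 := abs_nonneg x
        have h1 : x ^ 4 = |x| ^ 4 := by rw [Even.pow_abs (by decide : Even 4)]
        have h3 : 0 ≤ |x| * ((|x| - 2) ^ 2 * (|x| + 4)) := by positivity
        simp only
        rw [h1, ← sq_abs x]
        nlinarith

section Compare

variable {n : ℕ}

open ProbabilityTheory in
/-- A Gaussian vector with smaller covariance has a smaller average norm. -/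
lemma Seminorm.integral_sum_smul_stdGaussian_le (p : Seminorm ℝ (EuclideanSpace ℝ (Fin n)))
    {m : ℕ} (x : Fin m → EuclideanSpace ℝ (Fin n)) {σ : ℝ} (hσ : 0 ≤ σ)
    (h : ∀ ξ, ∑ j, ⟪x j, ξ⟫ ^ 2 ≤ σ ^ 2 * ‖ξ‖ ^ 2) :
    ∫ g : EuclideanSpace ℝ (Fin m), p (∑ j, g j • x j) ∂stdGaussian _ ≤
      σ * ∫ g, p g ∂stdGaussian (EuclideanSpace ℝ (Fin n)) := by
  set S : Matrix (Fin n) (Fin n) ℝ := fun a b =>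
    (if a = b then σ ^ 2 else 0) - ∑ j, x j a * x j b with hS
  have hquad : ∀ v : Fin n → ℝ, v ⬝ᵥ S.mulVec v =
      σ ^ 2 * ∑ a, v a ^ 2 - ∑ j, (∑ a, x j a * v a) ^ 2 := by
    intro v
    simp only [dotProduct, Matrix.mulVec, hS, sub_mul, Finset.sum_sub_distrib, mul_sub, ite_mul,
      zero_mul, Finset.sum_ite_eq, Finset.mem_univ, if_true]
    congr 1
    · rw [Finset.mul_sum]
      exact Finset.sum_congr rfl fun a _ => by ring
    · simp only [sq, Finset.sum_mul, Finset.mul_sum]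
      refine Eq.trans (Finset.sum_congr rfl fun b _ => ?_) Finset.sum_comm
      refine Eq.trans (Finset.sum_congr rfl fun a _ => ?_) Finset.sum_comm
      exact Finset.sum_congr rfl fun j _ => by ring
  have hSp : S.PosSemidef := by
    refine Matrix.PosSemidef.of_dotProduct_mulVec_nonneg ?_ fun v => ?_
    · ext a b
      rw [Matrix.conjTranspose_apply]
      simp only [hS, star_trivial, eq_comm (a := a), mul_comm]
    · have h1 := h (WithLp.toLp 2 v)
      simp only [star_trivial]
      rw [hquad]
      simp only [EuclideanSpace.real_norm_sq_eq, PiLp.inner_apply] at h1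
      simp only [RCLike.inner_apply, conj_trivial] at h1
      simp only [mul_comm (x _ _)]
      linarith
  set γ := stdGaussian (EuclideanSpace ℝ (Fin m)) with hγ
  set ν := multivariateGaussian (0 : EuclideanSpace ℝ (Fin n)) S with hν
  set Y : EuclideanSpace ℝ (Fin m) → EuclideanSpace ℝ (Fin n) := fun g => ∑ j, g j • x j with hY
  have hYc : Continuous Y := by fun_prop
  have : IsProbabilityMeasure (γ.map Y) := Measure.isProbabilityMeasure_map (by fun_prop)
  have : IsProbabilityMeasure ((stdGaussian (EuclideanSpace ℝ (Fin n))).map (σ • ·)) :=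
    Measure.isProbabilityMeasure_map (by fun_prop)
  have hνc : ∀ ξ, charFun ν ξ = Complex.exp (-(σ ^ 2 * ‖ξ‖ ^ 2 - ∑ j, ⟪x j, ξ⟫ ^ 2) / 2) := by
    intro ξ
    rw [hν, charFun_multivariateGaussian hSp, hquad]
    have h1 : ∀ j, ⟪x j, ξ⟫ = ∑ a, x j a * ξ a := fun j => by
      simp [PiLp.inner_apply, mul_comm]
    simp only [h1]
    rw [← EuclideanSpace.real_norm_sq_eq]
    simp only [inner_zero_right]
    push_cast
    congr 1
    ring
  have hsum : (γ.map Y) ∗ ν = (stdGaussian (EuclideanSpace ℝ (Fin n))).map (σ • ·) := by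
    refine Measure.ext_of_charFun ?_
    ext ξ
    rw [charFun_conv, hνc, charFun_map_smul, charFun_stdGaussian]
    have h1 : charFun (γ.map Y) ξ = charFun γ (WithLp.toLp 2 fun j => ⟪x j, ξ⟫) := by
      rw [charFun_apply, charFun_apply, integral_map hYc.aemeasurable (by fun_prop)]
      congr 1
      ext g
      congr 3
      rw [hY, sum_inner, PiLp.inner_apply]
      simp [real_inner_smul_left, mul_comm]
    rw [h1, charFun_stdGaussian, ← Complex.exp_add]
    congr 1
    have h2 : ‖WithLp.toLp 2 fun j => ⟪x j, ξ⟫‖ ^ 2 = ∑ j, ⟪x j, ξ⟫ ^ 2 := by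
      rw [EuclideanSpace.real_norm_sq_eq]
    rw [← h2, norm_smul, norm_of_nonneg hσ]
    push_cast
    ring
  have hc := p.continuous_of_finiteDimensional
  obtain ⟨b, hb0, hb⟩ := p.exists_le_mul_norm
  have hpi : Integrable p (stdGaussian (EuclideanSpace ℝ (Fin n))) := by
    simpa using p.integrable_pow_stdGaussian hb 1
  have hpI : Integrable p ((γ.map Y) ∗ ν) := by
    rw [hsum, integrable_map_measure (by fun_prop) (by fun_prop)]
    refine (hpi.const_mul σ).congr (.of_forall fun g => ?_)
    simp [map_smul_eq_mul, abs_of_nonneg hσ]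
  have hνi : Integrable id ν := IsGaussian.integrable_id
  have hin : ∀ y, p y ≤ ∫ h, p (y + h) ∂ν := by
    intro y
    have h1 : ∫ h, (y + h) ∂ν = y := by
      rw [integral_add (g := fun h => h) (integrable_const _) hνi]
      simp [hν, integral_id_multivariateGaussian]
    calc p y = p (∫ h, (y + h) ∂ν) := by rw [h1]
      _ ≤ _ := p.map_integral_le ((integrable_const _).add hνi)
  have hI := integral_conv hpI
  have hI2 := ((integrable_conv_iff hpI.1).1 hpI).2
  rw [integral_map (by fun_prop) ?_] at hI
  rw [integrable_map_measure ?_ (by fun_prop)] at hI2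
  · calc ∫ g, p (Y g) ∂γ ≤ ∫ g, ∫ h, p (Y g + h) ∂ν ∂γ := by
          refine integral_mono ?_ ?_ fun g => hin (Y g)
          · obtain ⟨b', hb0', hb'⟩ : ∃ b', 0 ≤ b' ∧ ∀ g, p (Y g) ≤ b' * ‖g‖ := by
              refine ⟨∑ j, p (x j), Finset.sum_nonneg fun j _ => apply_nonneg p _, fun g => ?_⟩
              refine (Finset.le_sum_of_subadditive p (map_zero p).le (map_add_le_add p) _ _).trans ?_
              rw [Finset.sum_mul]
              refine Finset.sum_le_sum fun j _ => ?_
              rw [map_smul_eq_mul, mul_comm]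
              exact mul_le_mul_of_nonneg_left (PiLp.norm_apply_le g j) (apply_nonneg p _)
            refine ((integrable_norm_pow_stdGaussian (E := EuclideanSpace ℝ (Fin m)) 1).const_mul b').mono' (by fun_prop)
              (.of_forall fun g => ?_)
            rw [norm_of_nonneg (apply_nonneg p _), pow_one]
            exact hb' g
          · refine hI2.congr (.of_forall fun g => ?_)
            simp [abs_of_nonneg (apply_nonneg p _)]
      _ = ∫ z, p z ∂((γ.map Y) ∗ ν) := hI.symm
      _ = _ := by
          rw [hsum, integral_map (by fun_prop) (by fun_prop), ← integral_const_mul]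
          refine integral_congr_ae (.of_forall fun g => ?_)
          simp [map_smul_eq_mul, abs_of_nonneg hσ]
  · have : Continuous fun z : EuclideanSpace ℝ (Fin n) × EuclideanSpace ℝ (Fin n) =>
      ‖p (z.1 + z.2)‖ := by fun_prop
    exact this.stronglyMeasurable.integral_prod_right.aestronglyMeasurable
  · have : Continuous fun z : EuclideanSpace ℝ (Fin n) × EuclideanSpace ℝ (Fin n) =>
      p (z.1 + z.2) := by fun_prop
    exact this.stronglyMeasurable.integral_prod_right.aestronglyMeasurable

lemma ae_pi_forall_norm_le {ι E : Type*} [Fintype ι] [NormedAddCommGroup E] [MeasurableSpace E]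
    {μ : Measure E} [IsProbabilityMeasure μ] {R : ℝ} (hR : ∀ᵐ x ∂μ, ‖x‖ ≤ R) :
    ∀ᵐ x ∂Measure.pi fun _ : ι => μ, ∀ j, ‖x j‖ ≤ R :=
  ae_all_iff.2 fun j => (measurePreserving_eval (fun _ : ι => μ) j).quasiMeasurePreserving.ae hR

open ProbabilityTheory in
/-- The average norm of a sum of independent symmetric vectors is controlled by the average of
the operator norm of these vectors. -/
lemma Seminorm.integral_sum_pi_le (hn : 1 ≤ n) (p : Seminorm ℝ (EuclideanSpace ℝ (Fin n))) {m : ℕ}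
    {μ : Measure (EuclideanSpace ℝ (Fin n))} [IsProbabilityMeasure μ] {R : ℝ}
    (hR : ∀ᵐ x ∂μ, ‖x‖ ≤ R) (hsymm : μ.map Neg.neg = μ)
    {σ : (Fin m → EuclideanSpace ℝ (Fin n)) → ℝ} (hσ : ∀ x, 0 ≤ σ x)
    (hσi : Integrable σ (Measure.pi fun _ => μ))
    (h : ∀ x ξ, ∑ j, ⟪x j, ξ⟫ ^ 2 ≤ σ x ^ 2 * ‖ξ‖ ^ 2) :
    ∫ x, p (∑ j, x j) ∂(Measure.pi fun _ : Fin m => μ) ≤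
      2 * (√n * ⨍ ξ, p (ξ : EuclideanSpace ℝ (Fin n))
        ∂((volume : Measure (EuclideanSpace ℝ (Fin n))).toSphere)) *
      ∫ x, σ x ∂(Measure.pi fun _ => μ) := by
  have : Nonempty (Fin n) := ⟨⟨0, hn⟩⟩
  set π' := Measure.pi fun _ : Fin m => μ with hπ
  set γ := stdGaussian (EuclideanSpace ℝ (Fin m)) with hγ
  have hc := p.continuous_of_finiteDimensional
  obtain ⟨b, hb0, hb⟩ := p.exists_le_mul_norm
  have hRπ : ∀ᵐ x ∂π', ∀ j, ‖x j‖ ≤ R := ae_pi_forall_norm_le hR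
  set G := ∫ g, p g ∂stdGaussian (EuclideanSpace ℝ (Fin n)) with hG
  set κ := ∫ t, |t| ∂gaussianReal 0 1 with hκ
  have hκ2 : 1 / 2 ≤ κ := half_le_integral_abs_gaussianReal
  have hng : Integrable (fun g => ‖g‖) γ := by simpa using integrable_norm_pow_stdGaussian 1
  have hint : ∀ a : ℝ → ℝ, Continuous a → (∀ t, |a t| ≤ |t|) → Integrable
      (fun z : (Fin m → EuclideanSpace ℝ (Fin n)) × EuclideanSpace ℝ (Fin m) =>
        p (∑ j, a (z.2 j) • z.1 j)) (π'.prod γ) := by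
    intro a ha hat
    have h1 : ∀ᵐ z ∂π'.prod γ, ∀ j, ‖z.1 j‖ ≤ R :=
      Measure.quasiMeasurePreserving_fst.ae hRπ
    refine ((hng.comp_snd π').const_mul (∑ _j : Fin m, b * R)).mono' (by fun_prop) ?_
    filter_upwards [h1] with z hz
    rw [norm_of_nonneg (apply_nonneg p _), Finset.sum_mul]
    refine (Finset.le_sum_of_subadditive p (map_zero p).le (map_add_le_add p) _ _).trans ?_
    refine Finset.sum_le_sum fun j _ => ?_
    rw [map_smul_eq_mul, mul_comm]
    have h2 : p (z.1 j) ≤ b * R := (hb _).trans (by gcongr; exact hz j)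
    have h3 : ‖a (z.2 j)‖ ≤ ‖z.2‖ := (hat _).trans (PiLp.norm_apply_le z.2 j)
    exact mul_le_mul h2 h3 (norm_nonneg _) ((apply_nonneg p _).trans h2)
  have hflip : ∀ g : EuclideanSpace ℝ (Fin m),
      ∫ x, p (∑ j, |g j| • x j) ∂π' = ∫ x, p (∑ j, g j • x j) ∂π' := by
    intro g
    have h1 : MeasurePreserving (fun (x : Fin m → EuclideanSpace ℝ (Fin n)) j =>
        if 0 ≤ g j then x j else -x j) π' π' := by
      refine measurePreserving_pi (fun _ => μ) (fun _ => μ)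
        (f := fun j x => if 0 ≤ g j then x else -x) fun j => ?_
      split_ifs
      · exact MeasurePreserving.id μ
      · exact ⟨measurable_neg, hsymm⟩
    conv_rhs => rw [← h1.map_eq]
    rw [integral_map h1.measurable.aemeasurable (by
      have : Continuous fun x : Fin m → EuclideanSpace ℝ (Fin n) => p (∑ j, g j • x j) := by fun_prop
      exact this.aestronglyMeasurable)]
    refine integral_congr_ae (.of_forall fun x => ?_)
    simp only
    congr 2
    ext1 j
    split_ifs with hj
    · rw [abs_of_nonneg hj]
    · rw [abs_of_neg (not_le.1 hj), smul_neg, neg_smul]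
  have hcoord : ∀ j : Fin m, Integrable (fun g : EuclideanSpace ℝ (Fin m) => |g j|) γ ∧
      ∫ g, |g j| ∂γ = κ := by
    intro j
    constructor
    · exact hng.mono' (by fun_prop) (.of_forall fun g => by
        simpa using PiLp.norm_apply_le g j)
    · have h1 := stdGaussian_map_inner (EuclideanSpace.single j (1 : ℝ))
      have h2 := congrArg (fun ν => ∫ t, |t| ∂ν) h1
      simp only at h2
      rw [integral_map (by fun_prop) (by fun_prop), integral_map (by fun_prop) (by fun_prop)] at h2
      simpa [EuclideanSpace.inner_single_left] using! h2
  have hjensen : ∀ x : Fin m → EuclideanSpace ℝ (Fin n),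
      κ * p (∑ j, x j) ≤ ∫ g, p (∑ j, |g j| • x j) ∂γ := by
    intro x
    have h1 : ∫ g, ∑ j, |g j| • x j ∂γ = κ • ∑ j, x j := by
      rw [integral_finsetSum _ fun j _ => (hcoord j).1.smul_const _, Finset.smul_sum]
      exact Finset.sum_congr rfl fun j _ => by rw [integral_smul_const, (hcoord j).2]
    have h2 := p.map_integral_le (integrable_finsetSum Finset.univ
      fun j _ => (hcoord j).1.smul_const (x j))
    rwa [h1, map_smul_eq_mul, norm_of_nonneg (by linarith)] at h2
  have hpπ : Integrable (fun x => p (∑ j, x j)) π' := by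
    refine (integrable_const (∑ _j : Fin m, b * R)).mono' (by fun_prop) ?_
    filter_upwards [hRπ] with x hx
    rw [norm_of_nonneg (apply_nonneg p _)]
    refine (Finset.le_sum_of_subadditive p (map_zero p).le (map_add_le_add p) _ _).trans ?_
    exact Finset.sum_le_sum fun j _ => (hb _).trans (by gcongr; exact hx j)
  have habs := hint (fun t => |t|) continuous_abs fun t => (abs_abs t).le
  have hid := hint id continuous_id fun t => le_rfl
  have hmain : κ * ∫ x, p (∑ j, x j) ∂π' ≤ G * ∫ x, σ x ∂π' := by
    calc κ * ∫ x, p (∑ j, x j) ∂π' = ∫ x, κ * p (∑ j, x j) ∂π' := by rw [integral_const_mul]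
      _ ≤ ∫ x, ∫ g, p (∑ j, |g j| • x j) ∂γ ∂π' :=
          integral_mono (hpπ.const_mul _) habs.integral_prod_left hjensen
      _ = ∫ g, ∫ x, p (∑ j, |g j| • x j) ∂π' ∂γ := integral_integral_swap habs
      _ = ∫ g, ∫ x, p (∑ j, g j • x j) ∂π' ∂γ := by simp_rw [hflip]
      _ = ∫ x, ∫ g, p (∑ j, g j • x j) ∂γ ∂π' := (integral_integral_swap hid).symm
      _ ≤ ∫ x, σ x * G ∂π' := by
          refine integral_mono hid.integral_prod_left (hσi.mul_const _) fun x => ?_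
          exact p.integral_sum_smul_stdGaussian_le x (hσ x) (h x)
      _ = _ := by rw [integral_mul_const, mul_comm]
  have hI0 : 0 ≤ ∫ x, p (∑ j, x j) ∂π' := integral_nonneg fun _ => apply_nonneg p _
  have hS0 : 0 ≤ ∫ x, σ x ∂π' := integral_nonneg hσ
  have hM0 : 0 ≤ ⨍ ξ, p (ξ : EuclideanSpace ℝ (Fin n))
        ∂((volume : Measure (EuclideanSpace ℝ (Fin n))).toSphere) := by
    rw [average_eq]
    exact smul_nonneg (by positivity) (integral_nonneg fun _ => apply_nonneg p _)
  have hGM : G ≤ √n * ⨍ ξ, p (ξ : EuclideanSpace ℝ (Fin n))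
        ∂((volume : Measure (EuclideanSpace ℝ (Fin n))).toSphere) := by
    rw [hG, p.integral_stdGaussian, mul_comm]
    have h2 := integral_norm_stdGaussian_le (E := EuclideanSpace ℝ (Fin n))
    rw [finrank_euclideanSpace_fin] at h2
    gcongr
  calc ∫ x, p (∑ j, x j) ∂π' ≤ 2 * (κ * ∫ x, p (∑ j, x j) ∂π') := by nlinarith
    _ ≤ 2 * (G * ∫ x, σ x ∂π') := by gcongr
    _ ≤ 2 * ((√n * ⨍ ξ, p (ξ : EuclideanSpace ℝ (Fin n))
        ∂((volume : Measure (EuclideanSpace ℝ (Fin n))).toSphere)) * ∫ x, σ x ∂π') := by gcongr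
    _ = _ := by ring

end Compare

lemma integral_sqrt_le {Ω : Type*} [MeasurableSpace Ω] {μ : Measure Ω} [IsProbabilityMeasure μ]
    {f : Ω → ℝ} (hf0 : ∀ x, 0 ≤ f x) (hf : Integrable f μ) :
    Integrable (fun x => √(f x)) μ ∧ ∫ x, √(f x) ∂μ ≤ √(∫ x, f x ∂μ) := by
  have hs : Integrable (fun x => √(f x)) μ := by
    refine (hf.add (integrable_const 1)).mono' (continuous_sqrt.comp_aestronglyMeasurable hf.1) (.of_forall fun x => ?_)
    rw [norm_of_nonneg (sqrt_nonneg _)]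
    refine sqrt_le_iff.2 ⟨add_nonneg (hf0 x) zero_le_one, ?_⟩
    simp only [Pi.add_apply]
    nlinarith [hf0 x, sq_nonneg (f x)]
  refine ⟨hs, le_sqrt_of_sq_le ?_⟩
  have h2 : ∀ x, √(f x) ^ 2 = f x := fun x => sq_sqrt (hf0 x)
  have h := ((even_two).convexOn_pow (𝕜 := ℝ)).map_integral_le (μ := μ)
    (f := fun x => √(f x)) (by fun_prop) isClosed_univ (by simp) hs
    (hf.congr (.of_forall fun x => (h2 x).symm))
  simpa only [h2] using h

lemma ae_pi_norm_le {ι E : Type*} [Fintype ι] [NormedAddCommGroup E] [MeasurableSpace E]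
    {μ : Measure E} [IsProbabilityMeasure μ] {R : ℝ} (hR : ∀ᵐ x ∂μ, ‖x‖ ≤ R) :
    ∀ᵐ x ∂Measure.pi fun _ : ι => μ, ‖x‖ ≤ |R| := by
  filter_upwards [ae_pi_forall_norm_le hR] with x hx
  exact (pi_norm_le_iff_of_nonneg (abs_nonneg R)).2 fun j => (hx j).trans (le_abs_self R)

lemma integral_inner_sq_of_isotropic {n : ℕ} {μ : Measure (EuclideanSpace ℝ (Fin n))} {L : ℝ}
    (h : ∀ θ, ‖θ‖ = 1 → ∫ x, ⟪x, θ⟫ ^ 2 ∂μ = L ^ 2) (θ : EuclideanSpace ℝ (Fin n)) :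
    ∫ x, ⟪x, θ⟫ ^ 2 ∂μ = L ^ 2 * ‖θ‖ ^ 2 := by
  rcases eq_or_ne θ 0 with rfl | hθ
  · simp
  have hθ' : ‖θ‖ ≠ 0 := norm_ne_zero_iff.2 hθ
  rw [← h (‖θ‖⁻¹ • θ) (by rw [norm_smul, norm_inv, norm_norm, inv_mul_cancel₀ hθ']),
    ← integral_mul_const]
  refine integral_congr_ae (.of_forall fun x => ?_)
  simp only [real_inner_smul_right]
  field_simp

section Moments

variable {n : ℕ} {μ : Measure (EuclideanSpace ℝ (Fin n))} [IsProbabilityMeasure μ]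

lemma LogConc.integral_inner_pow_four_le (hμ : LogConc μ) (hsymm : μ.map Neg.neg = μ) {R L : ℝ}
    (hR : ∀ᵐ x ∂μ, ‖x‖ ≤ R) (hL : 0 < L) {θ : EuclideanSpace ℝ (Fin n)} (hθ : ‖θ‖ = 1)
    (h : ∫ x, ⟪x, θ⟫ ^ 2 ∂μ = L ^ 2) : ∫ x, ⟪x, θ⟫ ^ 4 ∂μ ≤ 2 ^ 20 * L ^ 4 := by
  have hφ : Measurable fun x : EuclideanSpace ℝ (Fin n) => ⟪x, θ⟫ := by fun_prop
  set ν := μ.map fun x => ⟪x, θ⟫ with hν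
  have : IsProbabilityMeasure ν := Measure.isProbabilityMeasure_map hφ.aemeasurable
  have hνl : LogConc ν := hμ.map hφ fun a b x y => by
    simp [inner_add_left, real_inner_smul_left]
  have hνs : ν.map Neg.neg = ν := by
    rw [hν, Measure.map_map measurable_neg hφ]
    conv_rhs => rw [← hsymm]
    rw [Measure.map_map hφ measurable_neg]
    congr 1
    ext x
    simp
  have hνR : ∀ᵐ t ∂ν, |t| ≤ R := by
    rw [hν, ae_map_iff hφ.aemeasurable (measurableSet_le (by fun_prop) (by fun_prop))]
    filter_upwards [hR] with x hx
    have := abs_real_inner_le_norm x θ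
    rw [hθ, mul_one] at this
    exact this.trans hx
  have hch : ν.real (Set.Ici (4 * L)) ≤ exp (-2 * 1) / 2 := by
    have h1 := mul_meas_ge_le_integral_of_nonneg (μ := μ) (f := fun x => ⟪x, θ⟫ ^ 2)
      (.of_forall fun x => sq_nonneg _)
      (Continuous.integrable_of_ae_norm_le hR (by fun_prop)) ((4 * L) ^ 2)
    rw [h] at h1
    have h2 : ν.real (Set.Ici (4 * L)) ≤ μ.real {x | (4 * L) ^ 2 ≤ ⟪x, θ⟫ ^ 2} := by
      rw [hν, map_measureReal_apply hφ measurableSet_Ici]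
      refine measureReal_mono fun x hx => ?_
      exact pow_le_pow_left₀ (by positivity) (show 4 * L ≤ ⟪x, θ⟫ from hx) 2
    have h3 : μ.real {x | (4 * L) ^ 2 ≤ ⟪x, θ⟫ ^ 2} ≤ 1 / 16 := by
      have h4 : (4 * L) ^ 2 * μ.real {x | (4 * L) ^ 2 ≤ ⟪x, θ⟫ ^ 2} ≤ (4 * L) ^ 2 * (1 / 16) :=
        h1.trans (le_of_eq (by ring))
      exact le_of_mul_le_mul_left h4 (by positivity)
    have h5 : (1 : ℝ) / 8 ≤ exp (-2 * 1) := by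
      rw [show (-2 : ℝ) * 1 = -(1 + 1) by norm_num, exp_neg, exp_add, one_div]
      have := exp_one_lt_d9
      have h6 := exp_pos 1
      exact inv_anti₀ (by positivity) (by nlinarith)
    linarith
  have hexp := hνl.integral_exp_le hνs hνR (u := 4 * L) (by positivity) le_rfl hch
  have hb : exp (1 / 2 : ℝ) ≤ 2 := by
    rw [show (1 / 2 : ℝ) = 1 - 1 / 2 by norm_num]
    have h6 : exp (1 / 2 : ℝ) * exp (1 / 2 : ℝ) = exp 1 := by rw [← exp_add]; norm_num
    have := exp_one_lt_d9
    have h7 := exp_pos (1 / 2 : ℝ)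
    rw [show (1 : ℝ) - 1 / 2 = 1 / 2 by norm_num]
    nlinarith
  have hi : ∀ f : ℝ → ℝ, Continuous f → Integrable f ν := fun f hf =>
    Continuous.integrable_of_ae_norm_le (by simpa using hνR) hf
  calc ∫ x, ⟪x, θ⟫ ^ 4 ∂μ = ∫ t, t ^ 4 ∂ν := by
        rw [hν, integral_map hφ.aemeasurable (by fun_prop)]
    _ ≤ ∫ t, (8 * L) ^ (2 * 2) * (2 * 2).factorial * exp (1 / (8 * L) * |t|) ∂ν :=
        integral_mono (hi _ (by fun_prop)) (hi _ (by fun_prop))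
          fun t => pow_mul_factorial_exp_ge (by positivity) 2
    _ = (8 * L) ^ (2 * 2) * (2 * 2).factorial * ∫ t, exp (1 / (2 * (4 * L)) * |t|) ∂ν := by
        rw [integral_const_mul, show 2 * (4 * L) = 8 * L by ring]
    _ ≤ (8 * L) ^ (2 * 2) * (2 * 2).factorial * (2 * 2) := by
        have := hexp.trans (mul_le_mul_of_nonneg_left hb (by norm_num : (0 : ℝ) ≤ 2))
        gcongr
    _ ≤ _ := by
        norm_num [Nat.factorial]
        nlinarith [pow_pos hL 4]

/-- The Hilbert–Schmidt norm of the Gram matrix bounds the square of the operator norm. -/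
lemma sum_inner_sq_le_sqrt_gram {E ι : Type*} [Fintype ι] [NormedAddCommGroup E]
    [InnerProductSpace ℝ E] (x : ι → E) (ξ : E) :
    ∑ j, ⟪x j, ξ⟫ ^ 2 ≤ √(∑ i, ∑ j, ⟪x i, x j⟫ ^ 2) * ‖ξ‖ ^ 2 := by
  set A := ∑ j, ⟪x j, ξ⟫ ^ 2 with hA
  set H := ∑ i, ∑ j, ⟪x i, x j⟫ ^ 2 with hH
  have hA0 : 0 ≤ A := Finset.sum_nonneg fun _ _ => sq_nonneg _
  have hH0 : 0 ≤ H := Finset.sum_nonneg fun _ _ => Finset.sum_nonneg fun _ _ => sq_nonneg _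
  set y := ∑ j, ⟪x j, ξ⟫ • x j with hy
  have h1 : A = ⟪y, ξ⟫ := by
    rw [hy, sum_inner]
    exact Finset.sum_congr rfl fun j _ => by rw [real_inner_smul_left, sq]
  have h2 : ‖y‖ ^ 2 ≤ A * √H := by
    have h3 : ‖y‖ ^ 2 = ∑ z : ι × ι, (⟪x z.1, ξ⟫ * ⟪x z.2, ξ⟫) * ⟪x z.1, x z.2⟫ := by
      rw [← real_inner_self_eq_norm_sq, hy, sum_inner, Fintype.sum_prod_type]
      refine Finset.sum_congr rfl fun i _ => ?_
      rw [inner_sum]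
      refine Finset.sum_congr rfl fun j _ => ?_
      rw [real_inner_smul_left, real_inner_smul_right]; ring
    have h4 := Finset.sum_mul_sq_le_sq_mul_sq Finset.univ
      (fun z : ι × ι => ⟪x z.1, ξ⟫ * ⟪x z.2, ξ⟫) fun z : ι × ι => ⟪x z.1, x z.2⟫
    have h5 : ∑ z : ι × ι, (⟪x z.1, ξ⟫ * ⟪x z.2, ξ⟫) ^ 2 = A ^ 2 := by
      rw [Fintype.sum_prod_type, sq A, hA, Finset.sum_mul_sum]
      simp only [mul_pow]
    rw [← h3, h5, Fintype.sum_prod_type] at h4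
    replace h4 : (‖y‖ ^ 2) ^ 2 ≤ (A * √H) ^ 2 := by rwa [mul_pow, sq_sqrt hH0]
    exact (pow_le_pow_iff_left₀ (by positivity) (by positivity) two_ne_zero).1 h4
  have h6 : A ^ 2 ≤ A * (√H * ‖ξ‖ ^ 2) := by
    calc A ^ 2 ≤ (‖y‖ * ‖ξ‖) ^ 2 := by
          rw [h1]
          exact pow_le_pow_left₀ (h1 ▸ hA0) (real_inner_le_norm y ξ) 2
      _ = ‖y‖ ^ 2 * ‖ξ‖ ^ 2 := by ring
      _ ≤ A * √H * ‖ξ‖ ^ 2 := by gcongr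
      _ = _ := by ring
  rcases hA0.eq_or_lt with h | h
  · rw [← h]; positivity
  · rw [sq] at h6
    exact le_of_mul_le_mul_left h6 h

lemma integral_norm_sq_of_isotropic {R L : ℝ} (hR : ∀ᵐ x ∂μ, ‖x‖ ≤ R)
    (h : ∀ θ, ‖θ‖ = 1 → ∫ x, ⟪x, θ⟫ ^ 2 ∂μ = L ^ 2) : ∫ x, ‖x‖ ^ 2 ∂μ = n * L ^ 2 := by
  simp only [EuclideanSpace.real_norm_sq_eq]
  rw [integral_finsetSum _ fun i _ => Continuous.integrable_of_ae_norm_le hR (by fun_prop)]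
  have h1 : ∀ i, ∫ x : EuclideanSpace ℝ (Fin n), x i ^ 2 ∂μ = L ^ 2 := fun i => by
    rw [← h (EuclideanSpace.single i 1) (by simp)]
    simp [EuclideanSpace.inner_single_right]
  simp [h1]

open ProbabilityTheory in
lemma integral_gram_sq_le (hμ : LogConc μ) (hsymm : μ.map Neg.neg = μ) {R L : ℝ}
    (hR : ∀ᵐ x ∂μ, ‖x‖ ≤ R) (hL : 0 < L) (h : ∀ θ, ‖θ‖ = 1 → ∫ x, ⟪x, θ⟫ ^ 2 ∂μ = L ^ 2)
    {i j : Fin n} (hn : 1 ≤ n) :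
    ∫ x, ⟪x i, x j⟫ ^ 2 ∂(Measure.pi fun _ : Fin n => μ) ≤
      if i = j then 2 ^ 20 * n ^ 2 * L ^ 4 else n * L ^ 4 := by
  split_ifs with hij
  · subst hij
    have h1 : ∫ x, ⟪x i, x i⟫ ^ 2 ∂(Measure.pi fun _ : Fin n => μ) = ∫ y, ⟪y, y⟫ ^ 2 ∂μ := by
      conv_rhs => rw [← (measurePreserving_eval (fun _ : Fin n => μ) i).map_eq]
      rw [integral_map (measurable_pi_apply i).aemeasurable (by
        have : Continuous fun y : EuclideanSpace ℝ (Fin n) => ⟪y, y⟫ ^ 2 := by fun_prop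
        exact this.aestronglyMeasurable)]
    rw [h1]
    calc ∫ y, ⟪y, y⟫ ^ 2 ∂μ ≤ ∫ y : EuclideanSpace ℝ (Fin n), n * ∑ k, y k ^ 4 ∂μ := by
          refine integral_mono (Continuous.integrable_of_ae_norm_le hR (by fun_prop))
            (Continuous.integrable_of_ae_norm_le hR (by fun_prop)) fun y => ?_
          have h2 := sq_sum_le_card_mul_sum_sq (s := Finset.univ) (f := fun k => y k ^ 2)
          simp only [Finset.card_univ, Fintype.card_fin, ← pow_mul] at h2
          simp only [real_inner_self_eq_norm_sq]
          rw [EuclideanSpace.real_norm_sq_eq]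
          exact h2
      _ = n * ∑ k, ∫ y : EuclideanSpace ℝ (Fin n), y k ^ 4 ∂μ := by
          rw [integral_const_mul, integral_finsetSum _ fun i _ =>
            Continuous.integrable_of_ae_norm_le hR (by fun_prop)]
      _ ≤ n * ∑ _k : Fin n, 2 ^ 20 * L ^ 4 := by
          gcongr with k
          have h3 := hμ.integral_inner_pow_four_le hsymm hR hL
            (θ := EuclideanSpace.single k 1) (by simp) (h _ (by simp))
          simpa [EuclideanSpace.inner_single_right] using h3
      _ = _ := by simp; ring
  · have hind : IndepFun (fun x : Fin n → EuclideanSpace ℝ (Fin n) => x i) (fun x => x j)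
        (Measure.pi fun _ : Fin n => μ) :=
      (iIndepFun_pi (μ := fun _ : Fin n => μ) (X := fun _ => id)
        fun _ => measurable_id.aemeasurable).indepFun hij
    have hmap := (indepFun_iff_map_prod_eq_prod_map_map (measurable_pi_apply i).aemeasurable
      (measurable_pi_apply j).aemeasurable).1 hind
    have he : ∀ k, (Measure.pi fun _ : Fin n => μ).map (fun x => x k) = μ := fun k =>
      (measurePreserving_eval (fun _ : Fin n => μ) k).map_eq
    rw [he, he] at hmap
    have hc : Continuous fun z : EuclideanSpace ℝ (Fin n) × EuclideanSpace ℝ (Fin n) =>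
      ⟪z.1, z.2⟫ ^ 2 := by fun_prop
    have h1 : ∫ x, ⟪x i, x j⟫ ^ 2 ∂(Measure.pi fun _ : Fin n => μ) =
        ∫ z, ⟪z.1, z.2⟫ ^ 2 ∂μ.prod μ := by
      rw [← hmap, integral_map (by fun_prop) hc.aestronglyMeasurable]
    have hi : Integrable (fun z : EuclideanSpace ℝ (Fin n) × EuclideanSpace ℝ (Fin n) =>
        ⟪z.1, z.2⟫ ^ 2) (μ.prod μ) :=
      Continuous.integrable_of_ae_norm_le (ae_prod_norm_le hR) hc
    rw [h1, integral_prod _ hi]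
    have h2 : ∀ y, ∫ x, ⟪y, x⟫ ^ 2 ∂μ = L ^ 2 * ‖y‖ ^ 2 := fun y => by
      rw [← integral_inner_sq_of_isotropic h]
      simp_rw [real_inner_comm]
    simp only [h2]
    rw [integral_const_mul, integral_norm_sq_of_isotropic hR h]
    exact le_of_eq (by ring)

/-- The average operator norm of independent isotropic log-concave vectors. -/
lemma integral_sqrt_sqrt_gram_le (hμ : LogConc μ) (hsymm : μ.map Neg.neg = μ) {R L : ℝ}
    (hR : ∀ᵐ x ∂μ, ‖x‖ ≤ R) (hL : 0 < L) (h : ∀ θ, ‖θ‖ = 1 → ∫ x, ⟪x, θ⟫ ^ 2 ∂μ = L ^ 2)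
    (hn : 1 ≤ n) :
    Integrable (fun x => √√(∑ i, ∑ j, ⟪x i, x j⟫ ^ 2)) (Measure.pi fun _ : Fin n => μ) ∧
    ∫ x, √√(∑ i, ∑ j, ⟪x i, x j⟫ ^ 2) ∂(Measure.pi fun _ : Fin n => μ) ≤
      64 * (n : ℝ) ^ ((3 : ℝ) / 4) * L := by
  have hi : ∀ f : (Fin n → EuclideanSpace ℝ (Fin n)) → ℝ, Continuous f →
      Integrable f (Measure.pi fun _ : Fin n => μ) := fun f hf =>
    Continuous.integrable_of_ae_norm_le (ae_pi_norm_le hR) hf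
  have h1 := integral_sqrt_le (μ := Measure.pi fun _ : Fin n => μ)
    (f := fun x => ∑ i, ∑ j, ⟪x i, x j⟫ ^ 2)
    (fun x => Finset.sum_nonneg fun _ _ => Finset.sum_nonneg fun _ _ => sq_nonneg _)
    (hi _ (by fun_prop))
  have h2 := integral_sqrt_le (fun x => sqrt_nonneg _) h1.1
  refine ⟨h2.1, h2.2.trans ((sqrt_le_sqrt (h1.2)).trans ?_)⟩
  have hn1 : (1 : ℝ) ≤ n := by exact_mod_cast hn
  have hH : ∫ x, ∑ i, ∑ j, ⟪x i, x j⟫ ^ 2 ∂(Measure.pi fun _ : Fin n => μ) ≤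
      (64 ^ 2 * (√n) ^ 3 * L ^ 2) ^ 2 := by
    rw [integral_finsetSum _ fun i _ => hi _ (by fun_prop)]
    calc _ ≤ ∑ i : Fin n, ∑ j : Fin n, (if i = j then 2 ^ 20 * n ^ 2 * L ^ 4 else n * L ^ 4) := by
          refine Finset.sum_le_sum fun i _ => ?_
          rw [integral_finsetSum _ fun i _ => hi _ (by fun_prop)]
          exact Finset.sum_le_sum fun j _ => integral_gram_sq_le hμ hsymm hR hL h hn
      _ ≤ ∑ i : Fin n, ∑ j : Fin n, ((if i = j then 2 ^ 20 * n ^ 2 * L ^ 4 else 0) + n * L ^ 4) := by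
          gcongr with i _ j _
          have : 0 ≤ n * L ^ 4 := by positivity
          split_ifs <;> linarith
      _ = (2 ^ 20 + 1) * n ^ 3 * L ^ 4 := by
          simp [Finset.sum_add_distrib]; ring
      _ ≤ 2 ^ 24 * n ^ 3 * L ^ 4 := by gcongr; norm_num
      _ = _ := by
          have : (n : ℝ) ^ 3 = (√n) ^ 6 := by
            rw [show (6 : ℕ) = 2 * 3 by norm_num, pow_mul, sq_sqrt (by positivity)]
          rw [this]; ring
  have h3 : √(∫ x, ∑ i, ∑ j, ⟪x i, x j⟫ ^ 2 ∂(Measure.pi fun _ : Fin n => μ)) ≤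
      (64 * (n : ℝ) ^ ((3 : ℝ) / 4) * L) ^ 2 := by
    refine (sqrt_le_sqrt hH).trans (le_of_eq ?_)
    rw [sqrt_sq (by positivity), mul_pow, mul_pow, ← rpow_natCast (_ ^ _) 2, ← rpow_mul (by positivity),
      sqrt_eq_rpow, ← rpow_natCast (_ ^ _) 3, ← rpow_mul (by positivity)]
    norm_num
  exact (sqrt_le_sqrt h3).trans (le_of_eq (sqrt_sq (by positivity)))

end Moments

lemma sum_inner_sq_le_of_half_net {E ι : Type*} [Fintype ι] [NormedAddCommGroup E]
    [InnerProductSpace ℝ E] [FiniteDimensional ℝ E] {N : Finset E}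
    (hN : ∀ x : E, ‖x‖ = 1 → ∃ y ∈ N, ‖x - y‖ ≤ 1 / 2) (x : ι → E) {A : ℝ}
    (hA : ∀ y ∈ N, ∑ j, ⟪x j, y⟫ ^ 2 ≤ A) (hA0 : 0 ≤ A) (ξ : E) :
    ∑ j, ⟪x j, ξ⟫ ^ 2 ≤ 4 * A * ‖ξ‖ ^ 2 := by
  let φ : E →ₗ[ℝ] EuclideanSpace ℝ ι :=
    { toFun := fun ξ => WithLp.toLp 2 fun j => ⟪x j, ξ⟫
      map_add' := fun a b => by ext j; simp [inner_add_right]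
      map_smul' := fun c a => by ext j; simp [real_inner_smul_right] }
  have hφ : ∀ ξ, ‖φ ξ‖ ^ 2 = ∑ j, ⟪x j, ξ⟫ ^ 2 := fun ξ => by
    rw [EuclideanSpace.real_norm_sq_eq]; rfl
  have h := Seminorm.le_of_half_net ((normSeminorm ℝ (EuclideanSpace ℝ ι)).comp φ) hN
    (C := √A) (fun y hy => le_sqrt_of_sq_le (by
      rw [Seminorm.comp_apply, coe_normSeminorm, hφ]; exact hA y hy)) ξ
  rw [Seminorm.comp_apply, coe_normSeminorm] at h
  calc ∑ j, ⟪x j, ξ⟫ ^ 2 = ‖φ ξ‖ ^ 2 := (hφ ξ).symm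
    _ ≤ (2 * √A * ‖ξ‖) ^ 2 := by gcongr
    _ = _ := by rw [mul_pow, mul_pow, sq_sqrt hA0]; ring

section PsiTwo

variable {n : ℕ} {μ : Measure (EuclideanSpace ℝ (Fin n))} [IsProbabilityMeasure μ]

/-- The average operator norm of independent `ψ₂` vectors. -/
lemma exists_sum_inner_sq_le_of_integral_exp_le (hn : 1 ≤ n) {R r : ℝ} (hR : ∀ᵐ x ∂μ, ‖x‖ ≤ R)
    (hr : 0 < r)
    (h : ∀ θ : EuclideanSpace ℝ (Fin n), ‖θ‖ = 1 → ∫ x, exp ((⟪x, θ⟫ / r) ^ 2) ∂μ ≤ 2) :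
    ∃ σ : (Fin n → EuclideanSpace ℝ (Fin n)) → ℝ, (∀ x, 0 ≤ σ x) ∧
      Integrable σ (Measure.pi fun _ : Fin n => μ) ∧
      (∀ x ξ, ∑ j, ⟪x j, ξ⟫ ^ 2 ≤ σ x ^ 2 * ‖ξ‖ ^ 2) ∧
      ∫ x, σ x ∂(Measure.pi fun _ : Fin n => μ) ≤ 4 * r * √n := by
  obtain ⟨N, hN1, hN, hNc⟩ := exists_sphere_net (EuclideanSpace ℝ (Fin n))
    (ε := 1 / 2) (by norm_num)
  have hNc' : (N.card : ℝ) ≤ 5 ^ n := by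
    refine hNc.trans (le_of_eq ?_)
    rw [finrank_euclideanSpace_fin]; norm_num
  have hNne : N.Nonempty := by
    obtain ⟨y, hy, -⟩ := hN (EuclideanSpace.single ⟨0, hn⟩ 1) (by simp)
    exact ⟨y, hy⟩
  have hi : ∀ f : (Fin n → EuclideanSpace ℝ (Fin n)) → ℝ, Continuous f →
      Integrable f (Measure.pi fun _ : Fin n => μ) := fun f hf =>
    Continuous.integrable_of_ae_norm_le (ae_pi_norm_le hR) hf
  let Z : (Fin n → EuclideanSpace ℝ (Fin n)) → ℝ := fun x =>
    ∑ θ ∈ N, exp (∑ j, (⟪x j, θ⟫ / r) ^ 2)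
  have hZc : Continuous Z := by fun_prop
  have hZle : ∀ x, ∀ θ ∈ N, exp (∑ j, (⟪x j, θ⟫ / r) ^ 2) ≤ Z x := fun x θ hθ =>
    Finset.single_le_sum (f := fun θ => exp (∑ j, (⟪x j, θ⟫ / r) ^ 2))
      (fun _ _ => (exp_pos _).le) hθ
  have hZ1 : ∀ x, 1 ≤ Z x := fun x => by
    obtain ⟨θ, hθ⟩ := hNne
    exact (one_le_exp (Finset.sum_nonneg fun _ _ => sq_nonneg _)).trans (hZle x θ hθ)
  have hZint : ∫ x, Z x ∂(Measure.pi fun _ : Fin n => μ) ≤ 10 ^ n := by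
    calc ∫ x, Z x ∂(Measure.pi fun _ : Fin n => μ)
        = ∑ θ ∈ N, ∫ x, exp (∑ j, (⟪x j, θ⟫ / r) ^ 2) ∂(Measure.pi fun _ : Fin n => μ) :=
          integral_finsetSum _ fun θ _ => hi _ (by fun_prop)
      _ = ∑ θ ∈ N, (∫ x, exp ((⟪x, θ⟫ / r) ^ 2) ∂μ) ^ n := by
          refine Finset.sum_congr rfl fun θ _ => ?_
          simp only [exp_sum]
          rw [integral_fintype_prod_eq_prod (fun _ : Fin n => fun x => exp ((⟪x, θ⟫ / r) ^ 2))]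
          simp
      _ ≤ ∑ θ ∈ N, 2 ^ n := by
          gcongr with θ hθ
          exact h θ (hN1 θ hθ)
      _ = N.card * 2 ^ n := by simp
      _ ≤ 5 ^ n * 2 ^ n := by gcongr
      _ = 10 ^ n := by rw [← mul_pow]; norm_num
  have hlogc : Continuous fun x => log (Z x) :=
    hZc.log fun x => (zero_lt_one.trans_le (hZ1 x)).ne'
  have hlogint : ∫ x, log (Z x) ∂(Measure.pi fun _ : Fin n => μ) ≤ n * log 10 := by
    calc _ ≤ ∫ x, (n * log 10 + (Z x / 10 ^ n - 1)) ∂(Measure.pi fun _ : Fin n => μ) := by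
          refine integral_mono (hi _ hlogc) (hi _ (by fun_prop)) fun x => ?_
          have hZ0 := zero_lt_one.trans_le (hZ1 x)
          have h1 := log_le_sub_one_of_pos (show 0 < Z x / 10 ^ n by positivity)
          rw [log_div hZ0.ne' (by positivity), log_pow] at h1
          simp only
          linarith
      _ = n * log 10 + ((∫ x, Z x ∂(Measure.pi fun _ : Fin n => μ)) / 10 ^ n - 1) := by
          rw [integral_add (integrable_const _) (hi _ (by fun_prop)),
            integral_sub (hi _ (by fun_prop)) (integrable_const _), integral_div]
          simp
      _ ≤ n * log 10 + (10 ^ n / 10 ^ n - 1) := by gcongr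
      _ = _ := by rw [div_self (by positivity)]; ring
  have hs := integral_sqrt_le (μ := Measure.pi fun _ : Fin n => μ)
    (f := fun x => log (Z x)) (fun x => log_nonneg (hZ1 x)) (hi _ hlogc)
  refine ⟨fun x => 2 * r * √(log (Z x)), fun x => by positivity, hs.1.const_mul _,
    fun x ξ => ?_, ?_⟩
  · have := sum_inner_sq_le_of_half_net hN x (A := r ^ 2 * log (Z x)) (fun θ hθ => ?_)
      (mul_nonneg (sq_nonneg _) (log_nonneg (hZ1 x))) ξ
    · rw [mul_pow, sq_sqrt (log_nonneg (hZ1 x))]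
      exact this.trans (le_of_eq (by ring))
    · have h1 : ∑ j, (⟪x j, θ⟫ / r) ^ 2 ≤ log (Z x) := by
        rw [le_log_iff_exp_le (zero_lt_one.trans_le (hZ1 x))]
        exact hZle x θ hθ
      calc ∑ j, ⟪x j, θ⟫ ^ 2 = r ^ 2 * ∑ j, (⟪x j, θ⟫ / r) ^ 2 := by
            rw [Finset.mul_sum]
            refine Finset.sum_congr rfl fun j _ => ?_
            field_simp
        _ ≤ _ := by gcongr
  · rw [integral_const_mul]
    have hlog10 : log 10 ≤ 2 ^ 2 := by
      rw [log_le_iff_le_exp (by norm_num), show (2 : ℝ) ^ 2 = 1 + 1 + 1 + 1 by norm_num, exp_add,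
        exp_add, exp_add]
      have := exp_one_gt_d9
      have h2 : (2 : ℝ) ≤ exp 1 := by linarith
      nlinarith [mul_le_mul h2 h2 (by norm_num) (by positivity)]
    calc _ ≤ 2 * r * √(n * 2 ^ 2) := by
          gcongr
          exact hs.2.trans (sqrt_le_sqrt (hlogint.trans (by gcongr)))
      _ = 4 * r * √n := by
          rw [sqrt_mul (by positivity), sqrt_sq (by norm_num)]; ring

end PsiTwo

lemma integral_inner_pow_smul {E : Type*} [NormedAddCommGroup E] [InnerProductSpace ℝ E]
    [MeasurableSpace E] (ν : Measure E) {θ : E} (hθ : θ ≠ 0) (k : ℕ) :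
    ∫ x, ⟪x, θ⟫ ^ k ∂ν = ‖θ‖ ^ k * ∫ x, ⟪x, ‖θ‖⁻¹ • θ⟫ ^ k ∂ν := by
  have hθ' : ‖θ‖ ≠ 0 := norm_ne_zero_iff.2 hθ
  rw [← integral_const_mul]
  refine integral_congr_ae (.of_forall fun x => ?_)
  simp only [real_inner_smul_right]
  rw [← mul_pow, mul_inv_cancel_left₀ hθ']

lemma integral_cond_eq {α : Type*} [MeasurableSpace α] (μ : Measure α) (s : Set α) (f : α → ℝ) :
    ∫ x, f x ∂ProbabilityTheory.cond μ s = (μ.real s)⁻¹ * ∫ x in s, f x ∂μ := by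
  rw [ProbabilityTheory.cond, integral_smul_measure, ENNReal.toReal_inv]
  rfl

section Truncation

variable {n : ℕ} {μ : Measure (EuclideanSpace ℝ (Fin n))} [IsProbabilityMeasure μ] {R L : ℝ}

lemma half_le_measureReal_closedBall (hn : 1 ≤ n) (hR : ∀ᵐ x ∂μ, ‖x‖ ≤ R) (hL : 0 < L)
    (h : ∀ θ, ‖θ‖ = 1 → ∫ x, ⟪x, θ⟫ ^ 2 ∂μ = L ^ 2) :
    1 / 2 ≤ μ.real (Metric.closedBall 0 (2048 * √n * L)) := by
  have hn0 : (0 : ℝ) < n := by exact_mod_cast hn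
  have h1 := mul_meas_ge_le_integral_of_nonneg (μ := μ) (f := fun x => ‖x‖ ^ 2)
    (.of_forall fun x => sq_nonneg _)
    (Continuous.integrable_of_ae_norm_le hR (by fun_prop)) ((2048 * √n * L) ^ 2)
  rw [integral_norm_sq_of_isotropic hR h] at h1
  have h2 : μ.real (Metric.closedBall 0 (2048 * √n * L))ᶜ ≤
      μ.real {x | (2048 * √n * L) ^ 2 ≤ ‖x‖ ^ 2} := by
    refine measureReal_mono fun x hx => ?_
    have hx' : 2048 * √n * L < ‖x‖ := by simpa using hx
    exact pow_le_pow_left₀ (by positivity) hx'.le 2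
  rw [measureReal_compl Metric.isClosed_closedBall.measurableSet, probReal_univ] at h2
  have h3 : (2048 * √n * L) ^ 2 = 2048 ^ 2 * (n * L ^ 2) := by
    rw [mul_pow, mul_pow, sq_sqrt hn0.le]; ring
  rw [h3, mul_right_comm] at h1
  have h4 : 2048 ^ 2 * μ.real {x | 2048 ^ 2 * (n * L ^ 2) ≤ ‖x‖ ^ 2} ≤ 1 :=
    le_of_mul_le_mul_right (by rwa [one_mul]) (show 0 < n * L ^ 2 by positivity)
  rw [h3] at h2
  linarith

lemma half_le_setIntegral_inner_sq (hn : 1 ≤ n) (hμ : LogConc μ) (hsymm : μ.map Neg.neg = μ)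
    (hR : ∀ᵐ x ∂μ, ‖x‖ ≤ R) (hL : 0 < L)
    (h : ∀ θ, ‖θ‖ = 1 → ∫ x, ⟪x, θ⟫ ^ 2 ∂μ = L ^ 2) {θ : EuclideanSpace ℝ (Fin n)}
    (hθ : ‖θ‖ = 1) :
    L ^ 2 / 2 ≤ ∫ x in Metric.closedBall 0 (2048 * √n * L), ⟪x, θ⟫ ^ 2 ∂μ := by
  have hn0 : (0 : ℝ) < n := by exact_mod_cast hn
  set D := Metric.closedBall (0 : EuclideanSpace ℝ (Fin n)) (2048 * √n * L) with hD
  have hDm : MeasurableSet D := Metric.isClosed_closedBall.measurableSet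
  have hi : ∀ f : EuclideanSpace ℝ (Fin n) → ℝ, Continuous f → Integrable f μ := fun f hf =>
    Continuous.integrable_of_ae_norm_le hR hf
  have h1 := integral_add_compl hDm (hi (fun x => ⟪x, θ⟫ ^ 2) (by fun_prop))
  rw [h θ hθ] at h1
  let g : EuclideanSpace ℝ (Fin n) → ℝ := fun x =>
    1 / 2 * (1 / (2 ^ 21 * L ^ 2) * ⟪x, θ⟫ ^ 4 + 1 / (2 * n) * ‖x‖ ^ 2)
  have hg : Continuous g := by fun_prop
  have h2 : ∫ x in Dᶜ, ⟪x, θ⟫ ^ 2 ∂μ ≤ ∫ x in Dᶜ, g x ∂μ := by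
    refine setIntegral_mono_on (hi _ (by fun_prop)).integrableOn (hi _ hg).integrableOn hDm.compl
      fun x hx => ?_
    have hx' : 2048 * √n * L < ‖x‖ := by simpa [hD] using hx
    have h3 : 2 ^ 21 * L ^ 2 ≤ 1 / (2 * n) * ‖x‖ ^ 2 := by
      have h4 : (2048 * √n * L) ^ 2 ≤ ‖x‖ ^ 2 := pow_le_pow_left₀ (by positivity) hx'.le 2
      rw [mul_pow, mul_pow, sq_sqrt hn0.le] at h4
      rw [one_div, ← div_eq_inv_mul, le_div_iff₀ (by positivity)]
      linarith
    have h5 : 2 * ⟪x, θ⟫ ^ 2 ≤ 1 / (2 ^ 21 * L ^ 2) * ⟪x, θ⟫ ^ 4 + 2 ^ 21 * L ^ 2 := by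
      have hb : 0 < 2 ^ 21 * L ^ 2 := by positivity
      have h6 : 1 / (2 ^ 21 * L ^ 2) * ⟪x, θ⟫ ^ 4 + 2 ^ 21 * L ^ 2 - 2 * ⟪x, θ⟫ ^ 2 =
          1 / (2 ^ 21 * L ^ 2) * (⟪x, θ⟫ ^ 2 - 2 ^ 21 * L ^ 2) ^ 2 := by
        field_simp; ring
      have h7 : 0 ≤ 1 / (2 ^ 21 * L ^ 2) * (⟪x, θ⟫ ^ 2 - 2 ^ 21 * L ^ 2) ^ 2 := by positivity
      linarith
    simp only [g]
    linarith
  have h3 : ∫ x in Dᶜ, g x ∂μ ≤ ∫ x, g x ∂μ :=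
    setIntegral_le_integral (hi _ hg) (.of_forall fun x => by
      simp only [g, Pi.zero_apply]; positivity)
  have h4 : ∫ x, g x ∂μ ≤ L ^ 2 / 2 := by
    simp only [g]
    rw [integral_const_mul, integral_add (hi _ (by fun_prop)) (hi _ (by fun_prop)),
      integral_const_mul, integral_const_mul, integral_norm_sq_of_isotropic hR h]
    calc _ ≤ 1 / 2 * (1 / (2 ^ 21 * L ^ 2) * (2 ^ 20 * L ^ 4) + 1 / (2 * n) * (n * L ^ 2)) := by
          gcongr
          exact hμ.integral_inner_pow_four_le hsymm hR hL hθ (h θ hθ)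
      _ = _ := by field_simp; ring
  linarith

end Truncation

/-- A `ψ₂` estimate for a symmetric isotropic convex body bounds its isotropic constant. -/
lemma isotropicConstant_le_of_integral_exp_le {n : ℕ} (hn : 1 ≤ n)
    {B : Set (EuclideanSpace ℝ (Fin n))} (hB : IsSymmConvexBody B) (hv : volume B = 1) {L r : ℝ}
    (hL : 0 < L) (hr : 0 < r)
    (h : ∀ θ : EuclideanSpace ℝ (Fin n), ‖θ‖ = 1 → ∫ x in B, ⟪x, θ⟫ ^ 2 = L ^ 2)
    (hψ : ∀ θ : EuclideanSpace ℝ (Fin n), ‖θ‖ = 1 → ∫ x in B, exp ((⟪x, θ⟫ / r) ^ 2) ≤ 2)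
    {R : ℝ} (hR : ∀ x ∈ B, ‖x‖ ≤ R) (hlc : LogConc (volume.restrict B))
    (hsymm : (volume.restrict B).map Neg.neg = volume.restrict B) :
    L / 2 ≤ 2 * r / L * (37753344 * (2 + 66048 * 4096 ^ 2) * exp 1) ^ 2 := by
  obtain ⟨hBc, hBk, -, hBs⟩ := hB
  have hBm := hBk.measurableSet
  have hprob : IsProbabilityMeasure (volume.restrict B) := ⟨by simpa using hv⟩
  have hRae : ∀ᵐ x ∂volume.restrict B, ‖x‖ ≤ R := by
    filter_upwards [ae_restrict_mem hBm] with x hx using hR x hx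
  have hi : ∀ f : EuclideanSpace ℝ (Fin n) → ℝ, Continuous f →
      Integrable f (volume.restrict B) := fun f hf => Continuous.integrable_of_ae_norm_le hRae hf
  set D := Metric.closedBall (0 : EuclideanSpace ℝ (Fin n)) (2048 * √n * L) with hD
  have hDm : MeasurableSet D := Metric.isClosed_closedBall.measurableSet
  have hrr : volume.restrict (D ∩ B) = (volume.restrict B).restrict D :=
    (Measure.restrict_restrict hDm).symm
  have hvol : volume.real (D ∩ B) = (volume.restrict B).real D := by
    rw [measureReal_restrict_apply hDm]
  have hvlow : 1 / 2 ≤ volume.real (D ∩ B) := by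
    rw [hvol]; exact half_le_measureReal_closedBall hn hRae hL h
  have hvup : volume (D ∩ B) ≤ 1 := hv ▸ measure_mono Set.inter_subset_right
  have hvup' : volume.real (D ∩ B) ≤ 1 := ENNReal.toReal_le_of_le_ofReal zero_le_one (by simpa)
  have hv0 : 0 < volume.real (D ∩ B) := by linarith
  have hinv1 : 1 ≤ (volume.real (D ∩ B))⁻¹ := (one_le_inv₀ hv0).2 hvup'
  have hinv2 : (volume.real (D ∩ B))⁻¹ ≤ 2 := by
    rw [inv_le_comm₀ hv0 two_pos]; linarith
  refine le_of_moment_bounds (α := L / 2) (ρ := 2 * r / L) (R₀ := 4096) (K := D ∩ B) hn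
    ((convex_closedBall _ _).inter hBc) (hBk.inter_left Metric.isClosed_closedBall) ?_ ?_ hvup
    (by positivity) (by positivity) ?_ ?_ ?_
  · rw [Set.inter_neg, ← hBs, hD, neg_closedBall, neg_zero]
  · intro h0
    simp [measureReal_def, h0] at hv0
  · intro x hx
    have : ‖x‖ ≤ 2048 * √n * L := by simpa [hD] using hx.1
    exact this.trans (le_of_eq (by ring))
  · intro θ
    rcases eq_or_ne θ 0 with rfl | hθ
    · simp
    have hu : ‖‖θ‖⁻¹ • θ‖ = 1 := by
      rw [norm_smul, norm_inv, norm_norm, inv_mul_cancel₀ (norm_ne_zero_iff.2 hθ)]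
    rw [integral_inner_pow_smul _ hθ, integral_cond_eq, hrr]
    have h1 := half_le_setIntegral_inner_sq hn hlc hsymm hRae hL h hu
    have h2 : (L / 2) ^ 2 ≤ (volume.real (D ∩ B))⁻¹ *
        ∫ x in D, ⟪x, ‖θ‖⁻¹ • θ⟫ ^ 2 ∂volume.restrict B := by
      nlinarith [sq_nonneg L]
    rw [mul_comm]
    gcongr
  · intro q θ hq
    rcases eq_or_ne θ 0 with rfl | hθ
    · have : 2 * q ≠ 0 := by omega
      simp [this]
    have hu : ‖‖θ‖⁻¹ • θ‖ = 1 := by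
      rw [norm_smul, norm_inv, norm_norm, inv_mul_cancel₀ (norm_ne_zero_iff.2 hθ)]
    rw [integral_inner_pow_smul _ hθ, integral_cond_eq, hrr]
    set e := ‖θ‖⁻¹ • θ with he
    have h1 : ∫ x in D, ⟪x, e⟫ ^ (2 * q) ∂volume.restrict B ≤ 2 * (q.factorial * r ^ (2 * q)) := by
      calc _ ≤ ∫ x, ⟪x, e⟫ ^ (2 * q) ∂volume.restrict B :=
            setIntegral_le_integral (hi _ (by fun_prop))
              (.of_forall fun x => (even_two_mul q).pow_nonneg _)
        _ ≤ ∫ x, q.factorial * r ^ (2 * q) * exp ((⟪x, e⟫ / r) ^ 2) ∂volume.restrict B := by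
            refine integral_mono (hi _ (by fun_prop)) (hi _ (by fun_prop)) fun x => ?_
            have h2 := pow_div_factorial_le_exp (x := (⟪x, e⟫ / r) ^ 2) (sq_nonneg _) q
            rw [← pow_mul, div_pow, div_div, div_le_iff₀ (by positivity)] at h2
            exact h2.trans (le_of_eq (by ring))
        _ = q.factorial * r ^ (2 * q) * ∫ x in B, exp ((⟪x, e⟫ / r) ^ 2) :=
            integral_const_mul _ _
        _ ≤ q.factorial * r ^ (2 * q) * 2 := by
            gcongr
            exact hψ e hu
        _ = _ := by ring
    have h0 : 0 ≤ ∫ x in D, ⟪x, e⟫ ^ (2 * q) ∂volume.restrict B :=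
      integral_nonneg fun x => (even_two_mul q).pow_nonneg _
    calc _ ≤ ‖θ‖ ^ (2 * q) * (2 * (2 * (q.factorial * r ^ (2 * q)))) := by gcongr
      _ = _ := by
        rw [show 2 * r / L * (L / 2) = r by field_simp, mul_pow]; ring

lemma gauge_linearEquiv_image {E F : Type*} [AddCommGroup E] [Module ℝ E] [AddCommGroup F]
    [Module ℝ F] (T : E ≃ₗ[ℝ] F) (K : Set E) (x : E) : gauge (T '' K) (T x) = gauge K x := by
  simp only [gauge]
  congr! 3 with r
  rw [← Set.mem_preimage, ← image_smul_set, T.injective.preimage_image]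

lemma log_two_div_pos {δ : ℝ} (hδ0 : 0 < δ) (hδ1 : δ < 1) : 0 < log (2 / δ) :=
  log_pos (by rw [lt_div_iff₀ hδ0]; linarith)

section Image

variable {n : ℕ} {K : Set (EuclideanSpace ℝ (Fin n))}
  (T : EuclideanSpace ℝ (Fin n) ≃ₗ[ℝ] EuclideanSpace ℝ (Fin n))

lemma IsSymmConvexBody.image (hK : IsSymmConvexBody K) : IsSymmConvexBody (T '' K) := by
  obtain ⟨hc, hk, hi, hs⟩ := hK
  let e := T.toContinuousLinearEquiv
  have he : ⇑T = e := rfl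
  refine ⟨hc.linear_image T.toLinearMap, ?_, ?_, ?_⟩
  · exact hk.image e.continuous
  · rw [he, ← ContinuousLinearEquiv.coe_toHomeomorph, ← e.toHomeomorph.image_interior]
    exact hi.image _
  · conv_lhs => rw [hs]
    exact Set.image_neg T.toLinearMap K

lemma measurePreserving_restrict_image
    (hT : LinearMap.det (T : EuclideanSpace ℝ (Fin n) →ₗ[ℝ] EuclideanSpace ℝ (Fin n)) = 1)
    (K : Set (EuclideanSpace ℝ (Fin n))) :
    MeasurePreserving T (volume.restrict K) (volume.restrict (T '' K)) := by
  have hc : Continuous T := T.toContinuousLinearEquiv.continuous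
  have h : MeasurePreserving T (volume : Measure (EuclideanSpace ℝ (Fin n))) volume := by
    refine ⟨hc.measurable, ?_⟩
    have := Measure.map_linearMap_addHaar_eq_smul_addHaar
      (volume : Measure (EuclideanSpace ℝ (Fin n))) (f := T.toLinearMap) (by rw [hT]; simp)
    rw [hT] at this
    simpa using this
  exact h.restrict_image_emb T.toContinuousLinearEquiv.toHomeomorph.measurableEmbedding K

lemma setIntegral_gauge_sum_eq (hK : IsSymmConvexBody K) (hv : volume K = 1)
    (hT : LinearMap.det (T : EuclideanSpace ℝ (Fin n) →ₗ[ℝ] EuclideanSpace ℝ (Fin n)) = 1) :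
    ∫ x in Set.univ.pi fun _ : Fin n => K, gauge K (∑ j, x j) =
      ∫ x, (hK.image T).seminorm (∑ j, x j)
        ∂Measure.pi fun _ : Fin n => volume.restrict (T '' K) := by
  have hp : IsProbabilityMeasure (volume.restrict K) := ⟨by simpa using hv⟩
  have hm := measurePreserving_restrict_image T hT K
  have hp' : IsProbabilityMeasure (volume.restrict (T '' K)) :=
    hm.map_eq ▸ Measure.isProbabilityMeasure_map hm.aemeasurable
  have h1 := measurePreserving_pi (fun _ : Fin n => volume.restrict K)
    (fun _ : Fin n => volume.restrict (T '' K)) (f := fun _ => T) fun _ => hm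
  have hc : Continuous fun x : Fin n → EuclideanSpace ℝ (Fin n) =>
      (hK.image T).seminorm (∑ j, x j) :=
    (hK.image T).continuous_seminorm.comp (by fun_prop)
  rw [volume_pi, Measure.restrict_pi_pi, ← h1.map_eq,
    integral_map h1.aemeasurable hc.aestronglyMeasurable]
  refine integral_congr_ae (.of_forall fun x => ?_)
  simp only
  rw [IsSymmConvexBody.coe_seminorm, ← map_sum, gauge_linearEquiv_image]

lemma IsPsiTwoBody.integral_exp_le {ϱ L R : ℝ} (hψ : IsPsiTwoBody K ϱ) (hϱ : 0 < ϱ)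
    (hK : IsSymmConvexBody K) (hv : volume K = 1)
    (hT : LinearMap.det (T : EuclideanSpace ℝ (Fin n) →ₗ[ℝ] EuclideanSpace ℝ (Fin n)) = 1)
    (hL : 0 < L) (hR : ∀ x ∈ K, ‖x‖ ≤ R)
    {θ : EuclideanSpace ℝ (Fin n)} (hθ : ‖θ‖ = 1) (h : ∫ x in T '' K, ⟪x, θ⟫ ^ 2 = L ^ 2) :
    ∫ x in T '' K, exp ((⟪x, θ⟫ / (2 * ϱ * L)) ^ 2) ≤ 2 := by
  have hp : IsProbabilityMeasure (volume.restrict K) := ⟨by simpa using hv⟩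
  have hm := measurePreserving_restrict_image T hT K
  have hRae : ∀ᵐ x ∂volume.restrict K, ‖x‖ ≤ R := by
    filter_upwards [ae_restrict_mem hK.2.1.measurableSet] with x hx using hR x hx
  have hi : ∀ f : EuclideanSpace ℝ (Fin n) → ℝ, Continuous f →
      Integrable f (volume.restrict K) := fun f hf => Continuous.integrable_of_ae_norm_le hRae hf
  set ξ₀ := LinearMap.adjoint T.toLinearMap θ with hξ₀
  have had : ∀ x, ⟪T x, θ⟫ = ⟪x, ξ₀⟫ := fun x =>
    (LinearMap.adjoint_inner_right T.toLinearMap x θ).symm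
  have hξ₀0 : ξ₀ ≠ 0 := fun h0 => by
    have := had (T.symm θ)
    rw [h0, inner_zero_right, T.apply_symm_apply, real_inner_self_eq_norm_sq, hθ] at this
    norm_num at this
  have hs : 0 < ‖ξ₀‖ := norm_pos_iff.2 hξ₀0
  set ξ := ‖ξ₀‖⁻¹ • ξ₀ with hξ
  have hξ1 : ‖ξ‖ = 1 := by rw [hξ, norm_smul, norm_inv, norm_norm, inv_mul_cancel₀ hs.ne']
  have hTξ : ∀ x, ⟪T x, θ⟫ = ‖ξ₀‖ * ⟪x, ξ⟫ := fun x => by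
    rw [had, hξ, real_inner_smul_right, mul_inv_cancel_left₀ hs.ne']
  have hint : ∫ x in K, ⟪x, ξ⟫ ^ 2 = (L / ‖ξ₀‖) ^ 2 := by
    rw [← hm.map_eq, integral_map hm.aemeasurable
      (Continuous.aestronglyMeasurable (by fun_prop))] at h
    simp only [hTξ, mul_pow] at h
    rw [integral_const_mul] at h
    rw [div_pow, eq_div_iff (by positivity), mul_comm, h]
  have hlt : sInf {r : ℝ | 0 < r ∧ (∫ x in K, exp ((|⟪x, ξ⟫| / r) ^ 2)) ≤ 2} <
      2 * ϱ * L / ‖ξ₀‖ := by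
    refine (hψ ξ hξ1).trans_lt ?_
    rw [hint, sqrt_sq (by positivity)]
    have : 0 < ϱ * (L / ‖ξ₀‖) := by positivity
    calc ϱ * (L / ‖ξ₀‖) < 2 * (ϱ * (L / ‖ξ₀‖)) := by linarith
      _ = _ := by ring
  obtain ⟨r, ⟨hr0, hr⟩, hrlt⟩ := exists_lt_of_csInf_lt (by
    refine ⟨2 * (|R| + 1), by positivity, ?_⟩
    calc ∫ x in K, exp ((|⟪x, ξ⟫| / (2 * (|R| + 1))) ^ 2) ≤ ∫ x in K, (2 : ℝ) := by
          refine integral_mono_ae (hi _ (by fun_prop)) (integrable_const _) ?_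
          filter_upwards [hRae] with x hx
          have h1 : |⟪x, ξ⟫| ≤ |R| := by
            have := abs_real_inner_le_norm x ξ
            rw [hξ1, mul_one] at this
            exact this.trans (hx.trans (le_abs_self R))
          have h2 : |⟪x, ξ⟫| / (2 * (|R| + 1)) ≤ 1 / 2 := by
            rw [div_le_iff₀ (by positivity)]; linarith
          have h3 : (|⟪x, ξ⟫| / (2 * (|R| + 1))) ^ 2 ≤ (1 / 2) ^ 2 := by gcongr
          rw [← le_log_iff_exp_le two_pos]
          have := log_two_gt_d9
          linarith
      _ = 2 := by simp) hlt
  rw [← hm.map_eq, integral_map hm.aemeasurable (Continuous.aestronglyMeasurable (by fun_prop))]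
  refine le_trans (integral_mono (hi _ ?_) (hi _ (by fun_prop)) fun x => ?_) hr
  · have : Continuous T := T.toContinuousLinearEquiv.continuous
    fun_prop
  · simp only
    rw [exp_le_exp, hTξ, ← sq_abs]
    refine pow_le_pow_left₀ (abs_nonneg _) ?_ 2
    rw [abs_div, abs_mul, abs_norm, abs_of_pos (show 0 < 2 * ϱ * L by positivity)]
    rw [lt_div_iff₀ hs] at hrlt
    rw [div_le_div_iff₀ (by positivity) hr0]
    nlinarith [abs_nonneg ⟪x, ξ⟫]

end Image

/-- there are absolute constants `c, c' > 0` such that for every centrally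
symmetric convex body `K` of volume 1 in `ℝⁿ` and every `δ ∈ (0,1)`,
`β^{(R)}_{δ,n}(K,K) ≤ c log(2/δ) ∫_K⋯∫_K ‖∑ x_j‖_K`; consequently
`β^{(R)}_{δ,n}(K,K) ≤ c' log(2/δ) L_K n^{3/4} √n M(K_iso)` where `K_iso = T(K)`,
`T ∈ SL(n)`, is an isotropic image of `K`, and if moreover `K` is a `ψ₂`-body with
constant `ϱ`, then `β^{(R)}_{δ,n}(K,K) ≤ c' log(2/δ) ϱ² √n · √n M(K_iso)`. -/
theorem stmt19 :
    ∃ c c' : ℝ, 0 < c ∧ 0 < c' ∧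
      ∀ (n : ℕ)
        (K : Set (EuclideanSpace ℝ (Fin n))) (_hK : IsSymmConvexBody K)
        (_hKvol : volume K = 1)
        (T : EuclideanSpace ℝ (Fin n) ≃ₗ[ℝ] EuclideanSpace ℝ (Fin n))
        (_hT : LinearMap.det (T : EuclideanSpace ℝ (Fin n) →ₗ[ℝ] EuclideanSpace ℝ (Fin n)) = 1)
        (L : ℝ) (_hKiso : IsIsotropic (T '' K) L)
        (δ : ℝ) (_hδ0 : 0 < δ) (_hδ1 : δ < 1),
        betaR K δ
            ≤ c * Real.log (2 / δ)
                * (∫ x in Set.univ.pi fun _ : Fin n => K, gauge K (∑ j, x j)) ∧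
          betaR K δ
            ≤ c' * Real.log (2 / δ) * L * (n : ℝ) ^ ((3 : ℝ) / 4)
                * (Real.sqrt n * sphereM (T '' K)) ∧
          ∀ ϱ : ℝ, 0 < ϱ → IsPsiTwoBody K ϱ →
            betaR K δ
              ≤ c' * Real.log (2 / δ) * ϱ ^ 2 * Real.sqrt n
                  * (Real.sqrt n * sphereM (T '' K)) := by
  set C : ℝ := (37753344 * (2 + 66048 * 4096 ^ 2) * exp 1) ^ 2 with hC
  have hC0 : 0 < C := by positivity
  refine ⟨16, 2048 * (C + 1), by norm_num, by positivity, ?_⟩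
  intro n K hK hv T hT L hiso δ hδ0 hδ1
  have hlog := log_two_div_pos hδ0 hδ1
  have h1 := betaR_le_integral hK hv hδ0 hδ1
  refine ⟨h1, ?_⟩
  rcases Nat.eq_zero_or_pos n with rfl | hn
  · have h0 : betaR K δ ≤ 0 := by simpa using h1
    exact ⟨by simpa using h0, fun _ _ _ => by simpa using h0⟩
  obtain ⟨hv', -, hL, hiso⟩ := hiso
  have hTK := hK.image T
  set B := T '' K with hB
  have hBm := hTK.2.1.measurableSet
  have hprob : IsProbabilityMeasure (volume.restrict B) := ⟨by simpa using hv'⟩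
  obtain ⟨R, hR⟩ := hTK.2.1.isBounded.exists_norm_le
  obtain ⟨R', hR'⟩ := hK.2.1.isBounded.exists_norm_le
  have hRae : ∀ᵐ x ∂volume.restrict B, ‖x‖ ≤ R := by
    filter_upwards [ae_restrict_mem hBm] with x hx using hR x hx
  have hlc : LogConc (volume.restrict B) :=
    (prekopaLeindler_euclideanSpace n).logConc_restrict hBm hTK.1
  have hsymm : (volume.restrict B).map Neg.neg = volume.restrict B := by
    have := ((Measure.measurePreserving_neg (volume : Measure (EuclideanSpace ℝ (Fin n)))
      ).restrict_preimage hBm).map_eq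
    rwa [Set.neg_preimage, ← hTK.2.2.2] at this
  have hM : 0 ≤ √n * sphereM B :=
    mul_nonneg (sqrt_nonneg _) (integral_nonneg fun _ => gauge_nonneg _)
  have hkey : ∀ σ : (Fin n → EuclideanSpace ℝ (Fin n)) → ℝ, (∀ x, 0 ≤ σ x) →
      Integrable σ (Measure.pi fun _ => volume.restrict B) →
      (∀ x ξ, ∑ j, ⟪x j, ξ⟫ ^ 2 ≤ σ x ^ 2 * ‖ξ‖ ^ 2) → ∀ S,
      ∫ x, σ x ∂(Measure.pi fun _ => volume.restrict B) ≤ S →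
      betaR K δ ≤ 16 * log (2 / δ) * (2 * (√n * sphereM B) * S) := by
    intro σ hσ0 hσi hσ S hS
    rw [setIntegral_gauge_sum_eq T hK hv hT] at h1
    refine h1.trans (mul_le_mul_of_nonneg_left ?_ (by positivity))
    exact ((hK.image T).seminorm.integral_sum_pi_le hn hRae hsymm hσ0 hσi hσ).trans
      (mul_le_mul_of_nonneg_left hS (mul_nonneg zero_le_two hM))
  refine ⟨?_, fun ϱ hϱ hψ => ?_⟩
  · obtain ⟨hσi, hσ⟩ := integral_sqrt_sqrt_gram_le hlc hsymm hRae hL hiso hn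
    refine (hkey _ (fun x => sqrt_nonneg _) hσi (fun x ξ => ?_) _ hσ).trans ?_
    · rw [sq_sqrt (sqrt_nonneg _)]
      exact sum_inner_sq_le_sqrt_gram x ξ
    · have hA : 0 ≤ log (2 / δ) * L * (n : ℝ) ^ ((3 : ℝ) / 4) * (√n * sphereM B) := by positivity
      nlinarith [mul_nonneg hC0.le hA]
  · have hexp : ∀ θ : EuclideanSpace ℝ (Fin n), ‖θ‖ = 1 →
        ∫ x in B, exp ((⟪x, θ⟫ / (2 * ϱ * L)) ^ 2) ≤ 2 := fun θ hθ =>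
      hψ.integral_exp_le T hϱ hK hv hT hL hR' hθ (hiso θ hθ)
    have hr : 0 < 2 * ϱ * L := by positivity
    have hLϱ := isotropicConstant_le_of_integral_exp_le hn hTK hv' hL hr hiso hexp hR hlc hsymm
    rw [← hC, show 2 * (2 * ϱ * L) / L = 4 * ϱ by field_simp; ring] at hLϱ
    obtain ⟨σ, hσ0, hσi, hσ, hσS⟩ := exists_sum_inner_sq_le_of_integral_exp_le hn hRae hr hexp
    refine (hkey σ hσ0 hσi hσ _ hσS).trans ?_
    have hA : 0 ≤ log (2 / δ) * ϱ * √n * (√n * sphereM B) := by positivity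
    calc 16 * log (2 / δ) * (2 * (√n * sphereM B) * (4 * (2 * ϱ * L) * √n))
        = 256 * L * (log (2 / δ) * ϱ * √n * (√n * sphereM B)) := by ring
      _ ≤ 2048 * (C + 1) * ϱ * (log (2 / δ) * ϱ * √n * (√n * sphereM B)) := by
          refine mul_le_mul_of_nonneg_right ?_ hA
          nlinarith
      _ = _ := by ring
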